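/- arXiv:1102.0697 — 3 statements merged into one kernel-verified Lean document; each statement's English description precedes it below -/
import Mathlib

section
/- Let k ∈ ℕ and let G be a graph that has an end ω of vertex-degree at least (3/2)k − 1. Then the [k] × ℕ grid is a minor of G. -/
open SimpleGraph Cardinal

universe u v

variable {V : Type u}

/-- A ray in `G`: an injective sequence of vertices with consecutive vertices adjacent. -/
def IsRay (G : SimpleGraph V) (f : ℕ → V) : Prop :=
  Function.Injective f ∧ ∀ n : ℕ, G.Adj (f n) (f (n + 1))

/-- Two rays are equivalent (belong to the same end) if no finite vertex set separates them:
for every finite `S` there are arbitrarily late vertices of the two rays joined by a walk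
avoiding `S`. -/
def RayEquiv (G : SimpleGraph V) (f g : ℕ → V) : Prop :=
  ∀ S : Finset V, ∀ m₀ n₀ : ℕ, ∃ m n : ℕ, m₀ ≤ m ∧ n₀ ≤ n ∧
    ∃ w : G.Walk (f m) (g n), ∀ x ∈ w.support, x ∉ S

/-- `G` has `H` as a minor: disjoint nonempty connected branch sets, one for each vertex of
`H`, with edges of `G` between branch sets corresponding to adjacent vertices of `H`. -/
def HasMinor {W : Type v} (G : SimpleGraph V) (H : SimpleGraph W) : Prop :=
  ∃ B : W → Set V, (∀ w, (B w).Nonempty) ∧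
    (Pairwise fun w w' => Disjoint (B w) (B w')) ∧
    (∀ w, (G.induce (B w)).Connected) ∧
    ∀ ⦃w w'⦄, H.Adj w w' → ∃ u ∈ B w, ∃ x ∈ B w', G.Adj u x

/-- The `[k] × ℕ` grid. -/
def gridN (k : ℕ) : SimpleGraph (Fin k × ℕ) :=
  SimpleGraph.fromRel fun a b =>
    (a.1 = b.1 ∧ b.2 = a.2 + 1) ∨ (a.2 = b.2 ∧ (b.1 : ℕ) = (a.1 : ℕ) + 1)

/-- The `ℕ × ℕ` grid. -/
def gridNN : SimpleGraph (ℕ × ℕ) :=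
  SimpleGraph.fromRel fun a b =>
    (a.1 = b.1 ∧ b.2 = a.2 + 1) ∨ (a.2 = b.2 ∧ b.1 = a.1 + 1)

/-- `G` is `k`-connected: more than `k` vertices, and deleting fewer than `k` vertices
leaves a connected graph. -/
def KConnected (G : SimpleGraph V) (k : ℕ) : Prop :=
  (k : Cardinal) < #V ∧
  ∀ S : Finset V, S.card < k → (G.induce ((S : Set V))ᶜ).Connected

/-- `G` is `k`-edge-connected: deleting fewer than `k` edges leaves a connected graph. -/
def KEdgeConnected (G : SimpleGraph V) (k : ℕ) : Prop :=
  ∀ F : Finset (Sym2 V), F.card < k → (G.deleteEdges (F : Set (Sym2 V))).Connected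

/-- There are `m` pairwise vertex-disjoint rays all in the end of the ray `f`. -/
def HasVDisjointRays (G : SimpleGraph V) (f : ℕ → V) (m : ℕ) : Prop :=
  ∃ F : Fin m → ℕ → V, (∀ i, IsRay G (F i)) ∧ (∀ i, RayEquiv G (F i) f) ∧
    Pairwise fun i j => Disjoint (Set.range (F i)) (Set.range (F j))

/-- The set of edges used by a ray. -/
def rayEdges (f : ℕ → V) : Set (Sym2 V) := Set.range fun n => s(f n, f (n + 1))

/-- There are `m` pairwise edge-disjoint rays all in the end of the ray `f`. -/
def HasEDisjointRays (G : SimpleGraph V) (f : ℕ → V) (m : ℕ) : Prop :=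
  ∃ F : Fin m → ℕ → V, (∀ i, IsRay G (F i)) ∧ (∀ i, RayEquiv G (F i) f) ∧
    Pairwise fun i j => Disjoint (rayEdges (F i)) (rayEdges (F j))

/-- `G` is `k`-connected but deleting any edge destroys `k`-connectivity. -/
def EdgeMinKConnected (G : SimpleGraph V) (k : ℕ) : Prop :=
  KConnected G k ∧ ∀ e ∈ G.edgeSet, ¬ KConnected (G.deleteEdges {e}) k

/-- `G` is `k`-connected but deleting any vertex destroys `k`-connectivity. -/
def VertexMinKConnected (G : SimpleGraph V) (k : ℕ) : Prop :=
  KConnected G k ∧ ∀ x : V, ¬ KConnected (G.induce {x}ᶜ) k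

section Tokens

variable {W : Type*} {ι κ : Type*} {H : SimpleGraph W}

/-- Two placements of tokens on distinct vertices of `H` that differ by sliding a single token
along an edge. -/
def TokenMove (H : SimpleGraph W) (c c' : ι → W) : Prop :=
  Function.Injective c ∧ Function.Injective c' ∧
    ∃ t, H.Adj (c t) (c' t) ∧ ∀ s, s ≠ t → c' s = c s

/-- Reachability of token placements by sliding tokens one at a time. -/
def TokenReach (H : SimpleGraph W) : (ι → W) → (ι → W) → Prop :=
  Relation.ReflTransGen (TokenMove H)

/-- Two tokens can be brought to adjacent vertices. -/
def TokenRel (H : SimpleGraph W) (c : ι → W) (a b : ι) : Prop :=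
  ∃ c', TokenReach H c c' ∧ H.Adj (c' a) (c' b)

theorem TokenMove.symm {c c' : ι → W} (h : TokenMove H c c') : TokenMove H c' c := by
  obtain ⟨hc, hc', t, hadj, hs⟩ := h
  exact ⟨hc', hc, t, hadj.symm, fun s hst => (hs s hst).symm⟩

theorem TokenReach.symm {c c' : ι → W} (h : TokenReach H c c') : TokenReach H c' c := by
  induction h with
  | refl => exact Relation.ReflTransGen.refl
  | tail _ hm ih => exact Relation.ReflTransGen.head hm.symm ih

theorem TokenReach.trans {c c' c'' : ι → W} (h : TokenReach H c c')
    (h' : TokenReach H c' c'') : TokenReach H c c'' :=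
  Relation.ReflTransGen.trans h h'

theorem TokenReach.injective {c c' : ι → W} (h : TokenReach H c c')
    (hc : Function.Injective c) : Function.Injective c' := by
  induction h with
  | refl => exact hc
  | tail _ hm _ => exact hm.2.1

theorem TokenMove.comp_equiv {c c' : ι → W} (h : TokenMove H c c') (e : κ ≃ ι) :
    TokenMove H (c ∘ e) (c' ∘ e) := by
  obtain ⟨hc, hc', t, hadj, hs⟩ := h
  refine ⟨hc.comp e.injective, hc'.comp e.injective, e.symm t, by simpa using hadj, ?_⟩
  intro s hst
  exact hs (e s) fun h => hst (by rw [← h, e.symm_apply_apply])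

theorem TokenReach.comp_equiv {c c' : ι → W} (h : TokenReach H c c') (e : κ ≃ ι) :
    TokenReach H (c ∘ e) (c' ∘ e) := by
  induction h with
  | refl => exact Relation.ReflTransGen.refl
  | tail _ hm ih => exact Relation.ReflTransGen.tail ih (hm.comp_equiv e)

theorem TokenRel.symm {c : ι → W} {a b : ι} (h : TokenRel H c a b) : TokenRel H c b a := by
  obtain ⟨c', hr, hadj⟩ := h
  exact ⟨c', hr, hadj.symm⟩

theorem TokenRel.of_reach {c c' : ι → W} {a b : ι} (h : TokenRel H c' a b)
    (hr : TokenReach H c c') : TokenRel H c a b := by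
  obtain ⟨c'', hr', hadj⟩ := h
  exact ⟨c'', hr.trans hr', hadj⟩

open Classical in
/-- The placement with tokens `a` and `b` interchanged is reachable. -/
def Swappable (H : SimpleGraph W) (c : ι → W) (a b : ι) : Prop :=
  TokenReach H c (c ∘ Equiv.swap a b)

open Classical in
theorem Swappable.of_reach {c c' : ι → W} {a b : ι} (h : Swappable H c' a b)
    (hr : TokenReach H c c') : Swappable H c a b :=
  (hr.trans h).trans (hr.comp_equiv (Equiv.swap a b)).symm

open Classical in
theorem TokenRel.swap {c : ι → W} {a b s : ι} (h : TokenRel H c a s) (hab : Swappable H c a b)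
    (hsa : s ≠ a) (hsb : s ≠ b) : TokenRel H c b s := by
  obtain ⟨c', hr, hadj⟩ := h
  refine ⟨c' ∘ Equiv.swap a b, hab.trans (hr.comp_equiv _), ?_⟩
  simpa [Equiv.swap_apply_of_ne_of_ne hsa hsb] using hadj

open Classical in
theorem tokenReach_update {c : ι → W} (hc : Function.Injective c) {t : ι} {y : W}
    (hadj : H.Adj (c t) y) (hy : ∀ s, c s ≠ y) : TokenReach H c (Function.update c t y) := by
  refine Relation.ReflTransGen.single ⟨hc, ?_, t, by simpa using hadj, ?_⟩
  · intro a b hab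
    by_cases ha : a = t <;> by_cases hb : b = t
    · rw [ha, hb]
    · subst ha
      rw [Function.update_self, Function.update_of_ne hb] at hab
      exact absurd hab.symm (hy b)
    · subst hb
      rw [Function.update_self, Function.update_of_ne ha] at hab
      exact absurd hab (hy a)
    · rw [Function.update_of_ne ha, Function.update_of_ne hb] at hab
      exact hc hab
  · intro s hs
    exact Function.update_of_ne hs _ _

/-- Two tokens on neighbours of a free vertex `u` with a further free neighbour can be
interchanged. -/
theorem swappable_of_junction {c : ι → W} (hc : Function.Injective c) {a b : ι} {u z : W}
    (hab : a ≠ b) (ha : H.Adj u (c a)) (hb : H.Adj u (c b)) (hz : H.Adj u z)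
    (hu : ∀ s, c s ≠ u) (hzc : ∀ s, c s ≠ z) : Swappable H c a b := by
  classical
  have hba : b ≠ a := hab.symm
  have huz := hz.ne
  have hua := ha.ne
  have hub := hb.ne
  have hcab : c a ≠ c b := fun h => hab (hc h)
  have h1 := tokenReach_update hc ha.symm hu
  have i1 := h1.injective hc
  have h2 := tokenReach_update (t := a) (y := z) i1 (by simpa using hz) (by
    intro s
    by_cases hs : s = a
    · subst hs; simpa using huz
    · simpa [Function.update_of_ne hs] using hzc s)
  have i2 := h2.injective i1
  simp only [Function.update_idem] at h2 i2
  have h3 := tokenReach_update (t := b) (y := u) i2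
    (by simpa [Function.update_of_ne hba] using hb.symm) (by
    intro s
    by_cases hs : s = a
    · subst hs; simpa using huz.symm
    · simpa [Function.update_of_ne hs] using hu s)
  have i3 := h3.injective i2
  have h4 := tokenReach_update (t := b) (y := c a) i3 (by simpa using ha) (by
    intro s
    by_cases hs : s = b
    · subst hs; simpa using hua
    · by_cases hs' : s = a
      · subst hs'; simpa [Function.update_of_ne hs] using (hzc s).symm
      · simpa [Function.update_of_ne hs, Function.update_of_ne hs'] using
          fun h => hs' (hc h))
  have i4 := h4.injective i3
  simp only [Function.update_idem] at h4 i4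
  have h5 := tokenReach_update (t := a) (y := u) i4
    (by simpa [Function.update_of_ne hab] using hz.symm) (by
    intro s
    by_cases hs : s = b
    · subst hs; simpa using hua.symm
    · by_cases hs' : s = a
      · subst hs'; simpa [Function.update_of_ne hs] using huz.symm
      · simpa [Function.update_of_ne hs, Function.update_of_ne hs'] using hu s)
  have i5 := h5.injective i4
  have h6 := tokenReach_update (t := a) (y := c b) i5 (by simpa using hb) (by
    intro s
    by_cases hs' : s = a
    · subst hs'; simpa using hub
    · by_cases hs : s = b
      · subst hs; simpa [Function.update_of_ne hs'] using hcab
      · simpa [Function.update_of_ne hs, Function.update_of_ne hs'] using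
          fun h => hs (hc h))
  have h := ((((h1.trans h2).trans h3).trans h4).trans h5).trans h6
  unfold Swappable
  convert h using 1
  funext s
  by_cases hs' : s = a
  · subst hs'; simp
  · by_cases hs : s = b
    · subst hs; simp [Function.update_of_ne hs']
    · simp [Function.update_of_ne hs, Function.update_of_ne hs',
        Equiv.swap_apply_of_ne_of_ne hs' hs]

/-- Two tokens on neighbours of a free vertex can be made adjacent. -/
theorem tokenRel_of_common_neighbor {c : ι → W} (hc : Function.Injective c) {a b : ι} {u : W}
    (hab : a ≠ b) (ha : H.Adj u (c a)) (hb : H.Adj u (c b)) (hu : ∀ s, c s ≠ u) :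
    TokenRel H c a b := by
  classical
  refine ⟨_, tokenReach_update hc ha.symm hu, ?_⟩
  simpa [Function.update_of_ne hab.symm] using hb

/-- The first `N` values of `q` are the consecutive vertices of a path in `H`. -/
def IsPathSeq (H : SimpleGraph W) (q : ℕ → W) (N : ℕ) : Prop :=
  (∀ i < N, ∀ j < N, q i = q j → i = j) ∧ ∀ i, i + 1 < N → H.Adj (q i) (q (i + 1))

theorem IsPathSeq.mono {q : ℕ → W} {M N : ℕ} (h : IsPathSeq H q N) (hMN : M ≤ N) :
    IsPathSeq H q M :=
  ⟨fun i hi j hj => h.1 i (by omega) j (by omega), fun i hi => h.2 i (by omega)⟩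

theorem IsPathSeq.drop {q : ℕ → W} {N : ℕ} (h : IsPathSeq H q N) (a : ℕ) :
    IsPathSeq H (fun n => q (a + n)) (N - a) :=
  ⟨fun i hi j hj hij => by have := h.1 _ (by omega) _ (by omega) hij; omega,
    fun i hi => h.2 (a + i) (by omega)⟩

theorem IsPathSeq.reverse {q : ℕ → W} {N M : ℕ} (h : IsPathSeq H q N) (hM : M < N) :
    IsPathSeq H (fun n => q (M - n)) (M + 1) := by
  refine ⟨fun i hi j hj hij => by have := h.1 _ (by omega) _ (by omega) hij; omega,
    fun i hi => ?_⟩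
  have := h.2 (M - (i + 1)) (by omega)
  rw [show M - (i + 1) + 1 = M - i by omega] at this
  exact this.symm

theorem IsPathSeq.append {a b : ℕ → W} {A B : ℕ} (ha : IsPathSeq H a A) (hb : IsPathSeq H b B)
    (hdis : ∀ i < A, ∀ j < B, a i ≠ b j) (hadj : 0 < A → 0 < B → H.Adj (a (A - 1)) (b 0)) :
    IsPathSeq H (fun n => if n < A then a n else b (n - A)) (A + B) := by
  constructor
  · intro i hi j hj hij
    dsimp only at hij
    split_ifs at hij with h1 h2 h2
    · exact ha.1 i h1 j h2 hij
    · exact absurd hij (hdis i h1 _ (by omega))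
    · exact absurd hij.symm (hdis j h2 _ (by omega))
    · have := hb.1 _ (by omega) _ (by omega) hij
      omega
  · intro i hi
    dsimp only
    split_ifs with h1 h2 h2
    · exact ha.2 i h2
    · have := hadj (by omega) (by omega)
      rwa [show i = A - 1 by omega, show A - 1 + 1 - A = 0 by omega]
    · omega
    · have := hb.2 (i - A) (by omega)
      rwa [show i + 1 - A = i - A + 1 by omega]

/-- A token can slide along a path of free vertices. -/
theorem tokenReach_slide {q : ℕ → W} {N : ℕ} (hq : IsPathSeq H q N) {t : ι} {a b : ℕ}
    (hab : a ≤ b) (hb : b < N) : ∀ {c c' : ι → W}, Function.Injective c → c t = q a →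
    (∀ x, a < x → x ≤ b → ∀ s, c s ≠ q x) → c' t = q b → (∀ s, s ≠ t → c' s = c s) →
    TokenReach H c c' := by
  classical
  induction b, hab using Nat.le_induction with
  | base =>
    intro c c' _ ht _ ht' hs
    have : c' = c := by
      funext s
      by_cases h : s = t
      · rw [h, ht, ht']
      · exact hs s h
    rw [this]
    exact Relation.ReflTransGen.refl
  | succ b hab ih =>
    intro c c' hc ht hfree ht' hs
    have h1 : TokenReach H c (Function.update c t (q b)) :=
      ih (by omega) hc ht (fun x hx hxb => hfree x hx (by omega)) (by simp)
        (fun s hs => Function.update_of_ne hs _ _)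
    have h2 := tokenReach_update (H := H) (t := t) (y := q (b + 1)) (h1.injective hc)
      (by simpa using hq.2 b hb) (by
        intro s
        by_cases h : s = t
        · subst h
          simp only [Function.update_self]
          intro hh
          have := hq.1 _ (by omega) _ hb hh
          omega
        · rw [Function.update_of_ne h]
          exact hfree _ (by omega) le_rfl s)
    have : c' = Function.update (Function.update c t (q b)) t (q (b + 1)) := by
      funext s
      by_cases h : s = t
      · subst h; simp [ht']
      · simp [Function.update_of_ne h, hs s h]
    rw [this]
    exact h1.trans h2

theorem tokenReach_abacus_right {q : ℕ → W} {τ : ℕ → ι} {pos pos' : ℕ → ℕ} (n : ℕ) :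
    ∀ {N : ℕ}, IsPathSeq H q N → (∀ i j, i < j → j < n → pos i < pos j) →
    (∀ i j, i < j → j < n → pos' i < pos' j) → (∀ i < n, pos i ≤ pos' i) →
    (∀ i < n, pos' i < N) → ∀ {c c' : ι → W}, Function.Injective c →
    (∀ i < n, c (τ i) = q (pos i)) → (∀ i < n, c' (τ i) = q (pos' i)) →
    (∀ s, (∀ i < n, s ≠ τ i) → c' s = c s ∧ ∀ x < N, c s ≠ q x) → TokenReach H c c' := by
  classical
  induction n with
  | zero =>
    intro N _ _ _ _ _ c c' _ _ _ hs
    rw [show c' = c from funext fun s => (hs s (by simp)).1]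
    exact Relation.ReflTransGen.refl
  | succ n ih =>
    intro N hq hpos hpos' hle hN c c' hc hτ hτ' hs
    have hτne : ∀ i < n, τ i ≠ τ n := by
      intro i hi h
      have h1 := hτ i (by omega)
      have h2 := hτ n (by omega)
      rw [h, h2] at h1
      have := hpos i n hi (by omega)
      have h3 := hle n (by omega)
      have h4 := hN n (by omega)
      have := hq.1 _ (by omega) _ (by omega) h1
      omega
    have hposlt : pos n < N := lt_of_le_of_lt (hle n (by omega)) (hN n (by omega))
    have h1 : TokenReach H c (Function.update c (τ n) (q (pos' n))) := by
      refine tokenReach_slide hq (hle n (by omega)) (hN n (by omega)) hc (hτ n (by omega)) ?_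
        (by simp) (fun s hs => Function.update_of_ne hs _ _)
      intro x hx hx' s hsx
      have hxN := hN n (by omega)
      by_cases h : ∃ i < n + 1, s = τ i
      · obtain ⟨i, hi, rfl⟩ := h
        rw [hτ i hi] at hsx
        have hin : pos i ≤ pos n := by
          rcases Nat.lt_or_ge i n with h | h
          · exact (hpos i n h (by omega)).le
          · rw [show i = n by omega]
        have := hq.1 _ (by omega) _ (by omega) hsx
        omega
      · push Not at h
        exact (hs s h).2 x (by omega) hsx
    refine h1.trans (ih (N := pos' n) (hq.mono (hN n (by omega)).le)
      (fun i j hij hj => hpos i j hij (by omega)) (fun i j hij hj => hpos' i j hij (by omega))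
      (fun i hi => hle i (by omega)) (fun i hi => hpos' i n hi (by omega)) (h1.injective hc)
      ?_ (fun i hi => hτ' i (by omega)) ?_)
    · intro i hi
      rw [Function.update_of_ne (hτne i hi)]
      exact hτ i (by omega)
    · intro s hsi
      have hN' := hN n (by omega)
      by_cases h : s = τ n
      · subst h
        rw [Function.update_self]
        refine ⟨hτ' n (by omega), fun x hx hh => ?_⟩
        have := hq.1 _ hN' _ (by omega) hh
        omega
      · rw [Function.update_of_ne h]
        have := hs s (by
          intro i hi
          rcases Nat.lt_or_ge i n with h' | h'
          · exact hsi i h'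
          · rw [show i = n by omega]; exact h)
        exact ⟨this.1, fun x hx => this.2 x (by omega)⟩

/-- Tokens on a path can be slid along it to any other positions in the same order. -/
theorem tokenReach_abacus {q : ℕ → W} {N : ℕ} (hq : IsPathSeq H q N) {τ : ℕ → ι}
    {pos pos' : ℕ → ℕ} {n : ℕ} (hpos : ∀ i j, i < j → j < n → pos i < pos j)
    (hpos' : ∀ i j, i < j → j < n → pos' i < pos' j) (hN : ∀ i < n, pos i < N)
    (hN' : ∀ i < n, pos' i < N) {c c' : ι → W} (hc : Function.Injective c)
    (hτ : ∀ i < n, c (τ i) = q (pos i)) (hτ' : ∀ i < n, c' (τ i) = q (pos' i))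
    (hs : ∀ s, (∀ i < n, s ≠ τ i) → c' s = c s ∧ ∀ x < N, c s ≠ q x) :
    TokenReach H c c' := by
  classical
  have hτinj : ∀ i < n, ∀ j < n, τ i = τ j → i = j := by
    intro i hi j hj h
    have h1 := hτ i hi
    rw [h, hτ j hj] at h1
    have h2 := hq.1 _ (hN j hj) _ (hN i hi) h1
    rcases lt_trichotomy i j with h | h | h
    · have := hpos i j h hj; omega
    · exact h
    · have := hpos j i h hi; omega
  let d : ι → W := fun s => if h : ∃ i < n, s = τ i then q (max (pos h.choose) (pos' h.choose))
    else c s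
  have hd : ∀ i < n, d (τ i) = q (max (pos i) (pos' i)) := by
    intro i hi
    have h : ∃ j < n, τ i = τ j := ⟨i, hi, rfl⟩
    have : h.choose = i := (hτinj i hi _ h.choose_spec.1 h.choose_spec.2).symm
    simp only [d, dif_pos h, this]
  have hd' : ∀ s, (∀ i < n, s ≠ τ i) → d s = c s := by
    intro s hs
    have h : ¬ ∃ j < n, s = τ j := by push Not; exact hs
    simp only [d, dif_neg h]
  have hmax : ∀ i j, i < j → j < n → max (pos i) (pos' i) < max (pos j) (pos' j) := by
    intro i j hij hj
    have := hpos i j hij hj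
    have := hpos' i j hij hj
    omega
  have hmaxN : ∀ i < n, max (pos i) (pos' i) < N := fun i hi => max_lt (hN i hi) (hN' i hi)
  have h1 : TokenReach H c d := tokenReach_abacus_right n hq hpos hmax
    (fun i _ => le_max_left _ _) hmaxN hc hτ hd (fun s h => ⟨hd' s h, (hs s h).2⟩)
  have hc' : Function.Injective c' := by
    intro s s' hss
    by_cases h : ∃ i < n, s = τ i <;> by_cases h' : ∃ i < n, s' = τ i
    · obtain ⟨i, hi, rfl⟩ := h
      obtain ⟨j, hj, rfl⟩ := h'
      rw [hτ' i hi, hτ' j hj] at hss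
      have h2 := hq.1 _ (hN' i hi) _ (hN' j hj) hss
      rcases lt_trichotomy i j with h | h | h
      · have := hpos' i j h hj; omega
      · rw [h]
      · have := hpos' j i h hi; omega
    · obtain ⟨i, hi, rfl⟩ := h
      push Not at h'
      rw [hτ' i hi, (hs s' h').1] at hss
      exact absurd hss.symm ((hs s' h').2 _ (hN' i hi))
    · obtain ⟨i, hi, rfl⟩ := h'
      push Not at h
      rw [hτ' i hi, (hs s h).1] at hss
      exact absurd hss ((hs s h).2 _ (hN' i hi))
    · push Not at h h'
      rw [(hs s h).1, (hs s' h').1] at hss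
      exact hc hss
  have h2 : TokenReach H c' d := tokenReach_abacus_right n hq hpos' hmax
    (fun i _ => le_max_right _ _) hmaxN hc' hτ' hd (fun s h => by
      rw [(hs s h).1]
      exact ⟨hd' s h, (hs s h).2⟩)
  exact h1.trans h2.symm

/-- `K` tokens can be placed on `H` so that consecutive ones can be brought together. -/
def LinkableTokens (H : SimpleGraph W) (K : ℕ) : Prop :=
  ∃ c : Fin K → W, Function.Injective c ∧
    ∀ i j : Fin K, (j : ℕ) = i + 1 → TokenRel H c i j

/-- Tokens graded so that any two tokens in equal or consecutive grades can be brought together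
can be enumerated with consecutive tokens linkable. -/
theorem linkableTokens_of_grading [Fintype ι] {c : ι → W} (hc : Function.Injective c)
    (g : ι → ℕ) (hg : ∀ a i, i < g a → ∃ b, g b = i)
    (hrel : ∀ a b, a ≠ b → g a ≤ g b → g b ≤ g a + 1 → TokenRel H c a b) :
    LinkableTokens H (Fintype.card ι) := by
  classical
  let e₀ := (Fintype.equivFin ι).symm
  let e : Fin (Fintype.card ι) ≃ ι := (Tuple.sort (g ∘ e₀)).trans e₀
  have hmono : Monotone (g ∘ e) := Tuple.monotone_sort (g ∘ e₀)
  refine ⟨c ∘ e, hc.comp e.injective, ?_⟩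
  intro i j hij
  have hlt : i < j := by rw [Fin.lt_def]; omega
  obtain ⟨c', hr, hadj⟩ := hrel (e i) (e j) (fun h => hlt.ne (e.injective h)) (hmono hlt.le) (by
    by_contra hcon
    push Not at hcon
    obtain ⟨b, hb⟩ := hg (e j) (g (e i) + 1) hcon
    obtain ⟨l, rfl⟩ := e.surjective b
    have h1 : i < l := by
      by_contra h
      have := hmono (not_lt.mp h)
      simp only [Function.comp] at this
      omega
    have h2 : l < j := by
      by_contra h
      have := hmono (not_lt.mp h)
      simp only [Function.comp] at this
      omega
    rw [Fin.lt_def] at h1 h2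
    omega)
  exact ⟨c' ∘ e, hr.comp_equiv e, hadj⟩

end Tokens
section PathSeq

variable {W : Type*} {H : SimpleGraph W}

theorem IsPathSeq.le_card [Fintype W] {q : ℕ → W} {N : ℕ} (h : IsPathSeq H q N) :
    N ≤ Fintype.card W := by
  have := Fintype.card_le_of_injective (fun i : Fin N => q i)
    (fun i j hij => Fin.ext (h.1 i i.2 j j.2 hij))
  simpa using this

theorem IsPathSeq.singleton (w : W) : IsPathSeq H (fun _ => w) 1 :=
  ⟨fun i hi j hj _ => by omega, fun i hi => by omega⟩

theorem Nat.exists_greatest_of_bounded {P : ℕ → Prop} {n b : ℕ} (hn : P n)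
    (hb : ∀ m, P m → m ≤ b) : ∃ N, P N ∧ n ≤ N ∧ ∀ m, P m → m ≤ N := by
  classical
  exact ⟨Nat.findGreatest P b, Nat.findGreatest_spec (hb n hn) hn,
    Nat.le_findGreatest (hb n hn) hn, fun m hm => Nat.le_findGreatest (hb m hm) hm⟩

/-- A connected graph has an edge leaving any nonempty proper vertex set. -/
theorem SimpleGraph.Connected.exists_adj_boundary (hH : H.Connected) {S : Set W} {a b : W}
    (ha : a ∈ S) (hb : b ∉ S) : ∃ x ∈ S, ∃ y ∉ S, H.Adj x y := by
  obtain ⟨w⟩ := hH.preconnected a b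
  obtain ⟨d, _, h1, h2⟩ := w.exists_boundary_dart S ha hb
  exact ⟨d.fst, h1, d.snd, h2, d.adj⟩

/-- A path disjoint from a longest path and ending in a neighbour of its `j`-th vertex is at most
as long as either side of that vertex. -/
theorem IsPathSeq.arm_le {q a : ℕ → W} {p A j : ℕ} (hq : IsPathSeq H q p)
    (hmax : ∀ q' N, IsPathSeq H q' N → N ≤ p) (ha : IsPathSeq H a A) (hj : j < p)
    (hdis : ∀ i < A, ∀ x < p, a i ≠ q x) (hadj : H.Adj (a (A - 1)) (q j)) :
    A ≤ j ∧ A + j + 1 ≤ p := by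
  have h1 := hmax _ _ (ha.append (hq.drop j) (fun i hi x hx => hdis i hi _ (by omega))
    (fun _ _ => by simpa using hadj))
  have h2 := hmax _ _ (ha.append (hq.reverse hj) (fun i hi x hx => hdis i hi _ (by omega))
    (fun _ _ => by simpa using hadj))
  omega

/-- Every vertex off a path can be joined to it by a path meeting it only in its first vertex. -/
theorem IsPathSeq.exists_hanging (hH : H.Connected) {q : ℕ → W} {p : ℕ} (hp : 1 ≤ p) {w : W}
    (hw : ∀ x < p, w ≠ q x) : ∃ r : ℕ → W, ∃ e j : ℕ, 1 ≤ e ∧ j < p ∧ r 0 = q j ∧ r e = w ∧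
      IsPathSeq H r (e + 1) ∧ ∀ i, 1 ≤ i → i ≤ e → ∀ x < p, r i ≠ q x := by
  have key : ∀ w, ∃ r : ℕ → W, ∃ e j : ℕ, j < p ∧ r 0 = q j ∧ r e = w ∧
      IsPathSeq H r (e + 1) ∧ ∀ i, 1 ≤ i → i ≤ e → ∀ x < p, r i ≠ q x := by
    by_contra! hcon
    obtain ⟨w, hw⟩ := hcon
    let S : Set W := {w | ∃ r : ℕ → W, ∃ e j : ℕ, j < p ∧ r 0 = q j ∧ r e = w ∧
      IsPathSeq H r (e + 1) ∧ ∀ i, 1 ≤ i → i ≤ e → ∀ x < p, r i ≠ q x}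
    have hP : ∀ x < p, q x ∈ S := fun x hx =>
      ⟨fun _ => q x, 0, x, hx, rfl, rfl, IsPathSeq.singleton _, fun i hi hi' => by omega⟩
    obtain ⟨x, ⟨r, e, j, hj, h0, he, hr, hP'⟩, y, hy, hxy⟩ :=
      hH.exists_adj_boundary (hP 0 hp) (b := w) (by
        rintro ⟨r, e, j, hj, h0, he, hr, h⟩
        obtain ⟨i, hi, hi', x, hx, hne⟩ := hw r e j hj h0 he hr
        exact h i hi hi' x hx hne)
    refine hy ⟨_, e + 1, j, hj, ?_, ?_, hr.append (IsPathSeq.singleton y) ?_ ?_, ?_⟩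
    · simpa using h0
    · simp
    · rintro i hi - - rfl
      exact hy ⟨r, i, j, hj, h0, rfl, hr.mono (by omega), fun l hl hl' => hP' l hl (by omega)⟩
    · intro _ _
      simpa [he] using hxy
    · intro i hi hi' x hx
      split_ifs with h
      · exact hP' i hi (by omega) x hx
      · rintro rfl
        exact hy (hP x hx)
  obtain ⟨r, e, j, hj, h0, he, hr, hP⟩ := key w
  refine ⟨r, e, j, ?_, hj, h0, he, hr, hP⟩
  rcases Nat.eq_zero_or_pos e with rfl | h
  · exact absurd (he.symm.trans h0) (hw j hj)
  · exact h

end PathSeq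

section Beads

variable {W : Type*} {ι : Type*} {H : SimpleGraph W}

theorem exists_tokenReach_abacus {q : ℕ → W} {N : ℕ} (hq : IsPathSeq H q N) {τ : ℕ → ι}
    {pos pos' : ℕ → ℕ} {n : ℕ} (hpos : ∀ i j, i < j → j < n → pos i < pos j)
    (hpos' : ∀ i j, i < j → j < n → pos' i < pos' j) (hN : ∀ i < n, pos i < N)
    (hN' : ∀ i < n, pos' i < N) {c : ι → W} (hc : Function.Injective c)
    (hτ : ∀ i < n, c (τ i) = q (pos i)) (hs : ∀ s, (∀ i < n, s ≠ τ i) → ∀ x < N, c s ≠ q x) :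
    ∃ c', TokenReach H c c' ∧ (∀ i < n, c' (τ i) = q (pos' i)) ∧
      ∀ s, (∀ i < n, s ≠ τ i) → c' s = c s := by
  classical
  have hτinj : ∀ i < n, ∀ j < n, τ i = τ j → i = j := by
    intro i hi j hj h
    have h1 := hτ i hi
    rw [h, hτ j hj] at h1
    have h2 := hq.1 _ (hN j hj) _ (hN i hi) h1
    rcases lt_trichotomy i j with h | h | h
    · have := hpos i j h hj; omega
    · exact h
    · have := hpos j i h hi; omega
  let d : ι → W := fun s => if h : ∃ i < n, s = τ i then q (pos' h.choose) else c s
  have hd : ∀ i < n, d (τ i) = q (pos' i) := by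
    intro i hi
    have h : ∃ j < n, τ i = τ j := ⟨i, hi, rfl⟩
    have : h.choose = i := (hτinj i hi _ h.choose_spec.1 h.choose_spec.2).symm
    simp only [d, dif_pos h, this]
  have hd' : ∀ s, (∀ i < n, s ≠ τ i) → d s = c s := by
    intro s hs
    have h : ¬ ∃ j < n, s = τ j := by push Not; exact hs
    simp only [d, dif_neg h]
  exact ⟨d, tokenReach_abacus hq hpos hpos' hN hN' hc hτ hd (fun s h => ⟨hd' s h, hs s h⟩),
    hd, hd'⟩

/-- A token at the end of an arm all of whose vertices carry tokens can be exchanged with a bead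
on the path the arm is attached to, provided the path has enough free vertices. -/
theorem swappable_bead {q r : ℕ → W} {p n e j : ℕ} (hq : IsPathSeq H q p)
    (hr : IsPathSeq H r (e + 1)) (he : 1 ≤ e) (h0 : r 0 = q j)
    (hdis : ∀ i, 1 ≤ i → i ≤ e → ∀ x < p, r i ≠ q x) (hn : 1 ≤ n) (hej : e ≤ j)
    (hjp : e + j + 1 ≤ p) (hnp : n + e + 1 ≤ p) {c : ι → W} (hc : Function.Injective c)
    {τ σ : ℕ → ι} (hτ : ∀ i < n, c (τ i) = q i)
    (hs : ∀ s, (∀ i < n, s ≠ τ i) → ∀ x < p, c s ≠ q x)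
    (hσ : ∀ i, 1 ≤ i → i ≤ e → c (σ i) = r i) :
    Swappable H c (τ (min j n - 1)) (σ e) ∧ TokenRel H c (τ (min j n - 1)) (σ e) := by
  obtain ⟨c₁, hr₁, hτ₁, hs₁⟩ := exists_tokenReach_abacus hq (τ := τ) (n := n) (pos := fun i => i)
    (pos' := fun i => if i ≤ min j n - 1 then j - 1 - (min j n - 1 - i) else p - n + i)
    (fun i j h _ => h) (fun i i' h _ => by split_ifs <;> omega)
    (fun i h => by omega) (fun i h => by split_ifs <;> omega) hc hτ hs
  have hc₁ := hr₁.injective hc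
  have hστ : ∀ i, 1 ≤ i → i ≤ e → ∀ i' < n, σ i ≠ τ i' := by
    intro i hi hi' i' hi'' h
    have h1 := hσ i hi hi'
    rw [h, hτ i' hi''] at h1
    exact hdis i hi hi' i' (by omega) h1.symm
  have hσ₁ : ∀ i, 1 ≤ i → i ≤ e → c₁ (σ i) = r i := fun i hi hi' => by
    rw [hs₁ _ (hστ i hi hi'), hσ i hi hi']
  have hfree₁ : ∀ s, ∀ x, j ≤ x → x ≤ j + e → c₁ s ≠ q x := by
    intro s x hx hx' h
    by_cases hsτ : ∃ i < n, s = τ i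
    · obtain ⟨i, hi, rfl⟩ := hsτ
      rw [hτ₁ i hi] at h
      have := hq.1 _ (by split_ifs <;> omega) _ (by omega) h
      split_ifs at this <;> omega
    · push Not at hsτ
      rw [hs₁ s hsτ] at h
      exact hs s hsτ x (by omega) h
  have hQ := ((hr.reverse (M := e) (by omega)).mono (M := e) (by omega)).append
    ((hq.drop j).mono (M := e + 1) (by omega))
    (fun i hi x hx => hdis _ (by omega) (by omega) _ (by omega)) (fun _ _ => by
      have := hr.2 0 (by omega)
      rw [h0] at this
      rw [show e - (e - 1) = 0 + 1 by omega]
      exact this.symm)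
  obtain ⟨c₂, hr₂, hσ₂, hs₂⟩ := exists_tokenReach_abacus hQ (τ := fun b => σ (e - b)) (n := e)
    (pos := fun i => i) (pos' := fun i => e + 1 + i) (fun i j h _ => h)
    (fun i i' h _ => by omega) (fun i h => by omega)
    (fun i h => by omega) hc₁
    (fun i hi => by
      rw [if_pos hi]
      exact hσ₁ _ (by omega) (by omega)) (by
    intro s hsσ x hx
    split_ifs with h
    · rw [← hσ₁ (e - x) (by omega) (by omega)]
      exact fun hh => hsσ x h (hc₁ hh)
    · exact hfree₁ s _ (by omega) (by omega))
  have hc₂ := hr₂.injective hc₁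
  have hfree₂ : ∀ s, c₂ s ≠ q j ∧ c₂ s ≠ r 1 := by
    intro s
    by_cases hsσ : ∃ b < e, s = σ (e - b)
    · obtain ⟨b, hb, rfl⟩ := hsσ
      have h2 := hσ₂ b hb
      rw [if_neg (by omega)] at h2
      rw [h2]
      refine ⟨fun h => ?_, (hdis 1 le_rfl he _ (by omega)).symm⟩
      have := hq.1 _ (by omega) _ (by omega) h
      omega
    · push Not at hsσ
      rw [hs₂ s hsσ]
      refine ⟨hfree₁ s j le_rfl (by omega), fun h => ?_⟩
      rw [← hσ₁ 1 le_rfl he] at h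
      exact hsσ (e - 1) (by omega) (by rw [hc₁ h]; congr 1; omega)
  have hbead : c₂ (τ (min j n - 1)) = q (j - 1) := by
    rw [hs₂ _ (fun b hb => (hστ _ (by omega) (by omega) _ (by omega)).symm), hτ₁ _ (by omega)]
    congr 1
    rw [if_pos le_rfl]
    omega
  have hend : c₂ (σ e) = q (j + 1) := by
    have := hσ₂ 0 (by omega)
    rw [if_neg (by omega)] at this
    rw [Nat.sub_zero] at this
    rw [this]
    congr 1
    omega
  have hne : τ (min j n - 1) ≠ σ e := (hστ e he le_rfl _ (by omega)).symm
  have hadj1 : H.Adj (q j) (c₂ (τ (min j n - 1))) := by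
    rw [hbead]
    have := hq.2 (j - 1) (by omega)
    rw [show j - 1 + 1 = j by omega] at this
    exact this.symm
  have hadj2 : H.Adj (q j) (c₂ (σ e)) := by
    rw [hend]
    exact hq.2 j (by omega)
  have hadj3 : H.Adj (q j) (r 1) := by
    rw [← h0]
    exact hr.2 0 (by omega)
  have hreach := hr₁.trans hr₂
  exact ⟨(swappable_of_junction hc₂ hne hadj1 hadj2 hadj3 (fun s => (hfree₂ s).1)
    (fun s => (hfree₂ s).2)).of_reach hreach,
    (tokenRel_of_common_neighbor hc₂ hne hadj1 hadj2 (fun s => (hfree₂ s).1)).of_reach hreach⟩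

/-- Tokens each exchangeable with one of a sequence of consecutively related beads are
linkable. -/
theorem linkableTokens_of_beads [Fintype ι] {c : ι → W} (hc : Function.Injective c) {n : ℕ}
    (τ : ℕ → ι) (g : ι → ℕ) (hgn : ∀ a, g a < n) (hgτ : ∀ i < n, g (τ i) = i)
    (hbead : ∀ i, i + 1 < n → TokenRel H c (τ i) (τ (i + 1)))
    (hother : ∀ a, a ≠ τ (g a) → Swappable H c (τ (g a)) a ∧ TokenRel H c (τ (g a)) a) :
    LinkableTokens H (Fintype.card ι) := by
  refine linkableTokens_of_grading hc g
    (fun a i hi => ⟨τ i, hgτ i (hi.trans (hgn a))⟩) ?_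
  intro a b hab h1 h2
  rcases Nat.lt_or_ge (g a) (g b) with h | h
  · have hb : g b = g a + 1 := by omega
    have hgb := hgn b
    have hrel : TokenRel H c (τ (g a)) (τ (g b)) := by
      rw [hb]
      exact hbead _ (by omega)
    have hne : ∀ x y, g x ≠ g y → x ≠ y := fun x y h hxy => h (by rw [hxy])
    have hrel' : TokenRel H c a (τ (g b)) := by
      by_cases ha : a = τ (g a)
      · rwa [← ha] at hrel
      · refine hrel.swap (hother a ha).1 (hne _ _ ?_) (hne _ _ ?_)
        · rw [hgτ _ (by omega), hgτ _ (by omega)]; omega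
        · rw [hgτ _ (by omega)]; omega
    by_cases hbt : b = τ (g b)
    · rwa [← hbt] at hrel'
    · refine (hrel'.symm.swap (hother b hbt).1 (hne _ _ ?_) hab).symm
      rw [hgτ _ (by omega)]
      omega
  · have hgab : g a = g b := le_antisymm h1 h
    by_cases ha : a = τ (g a)
    · have hb : b ≠ τ (g b) := fun hb => hab (by rw [ha, hb, hgab])
      have := (hother b hb).2
      rwa [← hgab, ← ha] at this
    · by_cases hb : b = τ (g b)
      · have := (hother a ha).2
        rw [hgab, ← hb] at this
        exact this.symm
      · have := (hother a ha).2.swap (by rw [hgab]; exact (hother b hb).1) ha hab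
        exact this.symm

end Beads
section Linkable

variable {W : Type*} {H : SimpleGraph W}

/-- The sequence `q` with `v` inserted at index `i`. -/
def insertSeq (q : ℕ → W) (v : W) (i n : ℕ) : W :=
  if n < i then q n else if n = i then v else q (n - 1)

theorem IsPathSeq.insertSeq_injective {q : ℕ → W} {p i : ℕ} {v : W} (hq : IsPathSeq H q p)
    (hi : i < p) (hv : ∀ x < p, v ≠ q x) :
    Function.Injective fun n : Fin (p + 1) => insertSeq q v i n := by
  intro a b hab
  have ha := a.2
  have hb := b.2
  ext
  simp only [insertSeq] at hab
  split_ifs at hab with h1 h2 h3 h4 h5 h6 h7 h8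
  · exact hq.1 _ (by omega) _ (by omega) hab
  · exact absurd hab.symm (hv _ (by omega))
  · have := hq.1 _ (by omega) _ (by omega) hab; omega
  · exact absurd hab (hv _ (by omega))
  · omega
  · exact absurd hab (hv _ (by omega))
  · have := hq.1 _ (by omega) _ (by omega) hab; omega
  · exact absurd hab.symm (hv _ (by omega))
  · have := hq.1 _ (by omega) _ (by omega) hab; omega

theorem IsPathSeq.linkableTokens {q : ℕ → W} {p : ℕ} (hq : IsPathSeq H q p) :
    LinkableTokens H p := by
  refine ⟨fun i => q i, fun i j h => Fin.ext (hq.1 i i.2 j j.2 h), ?_⟩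
  intro i j hij
  refine ⟨_, Relation.ReflTransGen.refl, ?_⟩
  have := hq.2 i (by omega)
  rwa [← hij] at this

/-- A path filled with tokens together with one further token that can be brought next to two
consecutive tokens of the path. -/
theorem IsPathSeq.linkableTokens_insertSeq {q : ℕ → W} {p i : ℕ} {v : W} (hq : IsPathSeq H q p)
    (hi : i < p) (hv : ∀ x < p, v ≠ q x)
    (hafter : ∀ a b : Fin (p + 1), (a : ℕ) = i → (b : ℕ) = i + 1 →
      TokenRel H (fun n : Fin (p + 1) => insertSeq q v i n) a b)
    (hbefore : ∀ a b : Fin (p + 1), (a : ℕ) + 1 = i → (b : ℕ) = i →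
      TokenRel H (fun n : Fin (p + 1) => insertSeq q v i n) a b) :
    LinkableTokens H (p + 1) := by
  refine ⟨_, hq.insertSeq_injective hi hv, ?_⟩
  intro a b hab
  have hb := b.2
  by_cases h1 : (a : ℕ) = i
  · exact hafter a b h1 (by omega)
  by_cases h2 : (b : ℕ) = i
  · exact hbefore a b (by omega) h2
  refine ⟨_, Relation.ReflTransGen.refl, ?_⟩
  simp only [insertSeq]
  rw [if_neg h1, if_neg h2]
  split_ifs with h3 h4 h4
  · have := hq.2 a (by omega)
    rwa [← hab] at this
  · omega
  · omega
  · have := hq.2 (a - 1) (by omega)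
    rwa [show (a : ℕ) - 1 + 1 = b - 1 by omega] at this

/-- The index in `insertSeq` of the `b`-th vertex of the original sequence. -/
def skipIndex (p i b : ℕ) : Fin (p + 1) :=
  Fin.ofNat (p + 1) (if b < i then b else b + 1)

theorem skipIndex_val {p i b : ℕ} (hb : b < p) :
    (skipIndex p i b : ℕ) = if b < i then b else b + 1 := by
  simp only [skipIndex, Fin.val_ofNat]
  exact Nat.mod_eq_of_lt (by split_ifs <;> omega)

theorem insertSeq_skipIndex {q : ℕ → W} {p i b : ℕ} {v : W} (hb : b < p) :
    insertSeq q v i (skipIndex p i b) = q b := by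
  rw [skipIndex_val hb, insertSeq]
  split_ifs
  · rfl
  · omega
  · omega
  · rfl

theorem ne_skipIndex {p i n : ℕ} {s : Fin (p + 1)} (hnp : n ≤ p)
    (hs : ∀ b < n, s ≠ skipIndex p i b) : (s : ℕ) = i ∨ n < s ∨ (i ≤ n ∧ n < i) ∨
      (n ≤ s ∧ (s : ℕ) < i) := by
  by_contra hcon
  have h2 := s.2
  rcases Nat.lt_or_ge (s : ℕ) i with h | h
  · refine hs s (by omega) (Fin.ext ?_)
    rw [skipIndex_val (by omega), if_pos h]
  · refine hs (s - 1) (by omega) (Fin.ext ?_)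
    rw [skipIndex_val (by omega), if_neg (by omega)]
    omega

/-- Two vertices off a path attached to it at `q i` and `q i'` respectively. -/
theorem IsPathSeq.linkableTokens_of_two_gates {q : ℕ → W} {p i i' : ℕ} {v v' : W}
    (hq : IsPathSeq H q p) (hii' : i ≤ i') (hi' : i' < p) (hv : ∀ x < p, v ≠ q x)
    (hv' : ∀ x < p, v' ≠ q x) (hvv' : v ≠ v') (hadj : H.Adj (q i) v) (hadj' : H.Adj (q i') v') :
    LinkableTokens H (p + 1) := by
  have hc := hq.insertSeq_injective (i := i) (by omega) hv
  refine hq.linkableTokens_insertSeq (i := i) (by omega) hv ?_ ?_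
  · intro a b ha hb
    refine ⟨_, Relation.ReflTransGen.refl, ?_⟩
    simp [insertSeq, ha, hb, hadj.symm]
  · intro a b ha hb
    have hpath := (hq.mono (M := i' + 1) (by omega)).append (IsPathSeq.singleton v')
      (fun x hx _ _ => (hv' x (by omega)).symm) (fun _ _ => by simpa using hadj')
    obtain ⟨c', hr, hτ', hs'⟩ := exists_tokenReach_abacus hpath (τ := skipIndex p i)
      (pos := fun b => b) (pos' := fun b => if b + 1 < i then b else b + 1) (n := i' + 1)
      (fun i j h _ => h) (fun x y h _ => by split_ifs <;> omega) (fun i h => by omega)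
      (fun x h => by split_ifs <;> omega) hc
      (fun b hb => by
        rw [if_pos hb]
        exact insertSeq_skipIndex (by omega)) (by
        intro s hs x hx
        have hsp := s.2
        simp only [insertSeq]
        rcases ne_skipIndex (by omega) hs with h | h | h | h
        · rw [if_neg (by omega), if_pos h]
          split_ifs
          · exact hv x (by omega)
          · exact hvv'
        · rw [if_neg (by omega), if_neg (by omega)]
          split_ifs
          · intro hh
            have := hq.1 _ (by omega) _ (by omega) hh
            omega
          · exact (hv' _ (by omega)).symm
        · omega
        · omega)
    refine ⟨c', hr, ?_⟩
    have ha' : a = skipIndex p i (i - 1) := by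
      ext
      rw [skipIndex_val (by omega), if_pos (by omega)]
      omega
    have hb' : c' b = v := by
      rw [hs' b]
      · simp [insertSeq, hb]
      · intro x hx h
        rw [h, skipIndex_val (by omega)] at hb
        split_ifs at hb <;> omega
    have hpos : (if i - 1 + 1 < i then i - 1 else i - 1 + 1) = i := by split_ifs <;> omega
    rw [hb', ha', hτ' _ (by omega), hpos, if_pos (by omega)]
    exact hadj

/-- A path attached to `q i` by its first vertex, with a branch at its `l`-th vertex. -/
theorem IsPathSeq.linkableTokens_of_branch {q f : ℕ → W} {p i l : ℕ} {g : W}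
    (hq : IsPathSeq H q p) (hi : i < p) (hf : IsPathSeq H f (l + 2))
    (hfq : ∀ y < l + 2, ∀ x < p, f y ≠ q x) (hadj : H.Adj (q i) (f 0))
    (hg : ∀ x < p, g ≠ q x) (hgf : ∀ y < l + 2, g ≠ f y) (hlg : H.Adj (f l) g) :
    LinkableTokens H (p + 1) := by
  classical
  have hv := hfq (l + 1) (by omega)
  have hc := hq.insertSeq_injective (i := i) (by omega) hv
  have hrev := hf.reverse (M := l + 1) (by omega)
  have hslide : ∀ {c : Fin (p + 1) → W} {t : Fin (p + 1)}, Function.Injective c →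
      c t = f (l + 1) → (∀ y ≤ l, ∀ s, c s ≠ f y) →
      TokenReach H c (Function.update c t (f 0)) := by
    intro c t hc ht hfree
    refine tokenReach_slide hrev (Nat.zero_le (l + 1)) (by omega) hc (by simpa using ht) ?_
      (by simp) (fun s hs => Function.update_of_ne hs _ _)
    intro x hx _ s
    exact hfree _ (by omega) s
  have hcase : ∀ s : Fin (p + 1), ((s : ℕ) = i ∧ insertSeq q (f (l + 1)) i s = f (l + 1)) ∨
      ∃ x < p, insertSeq q (f (l + 1)) i s = q x := by
    intro s
    have := s.2
    simp only [insertSeq]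
    split_ifs with h1 h2
    · exact Or.inr ⟨s, by omega, rfl⟩
    · exact Or.inl ⟨h2, rfl⟩
    · exact Or.inr ⟨s - 1, by omega, rfl⟩
  refine hq.linkableTokens_insertSeq hi hv ?_ ?_
  · intro a b ha hb
    refine ⟨_, hslide (t := a) hc (by simp [insertSeq, ha]) ?_, ?_⟩
    · intro y hy s
      rcases hcase s with ⟨-, h⟩ | ⟨x, hx, h⟩
      · rw [h]
        intro hh
        have := hf.1 _ (by omega) _ (by omega) hh
        omega
      · rw [h]
        exact (hfq y (by omega) x hx).symm
    · rw [Function.update_self, Function.update_of_ne (by rintro rfl; omega)]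
      simpa [insertSeq, hb] using hadj.symm
  · intro a b ha hb
    have hpath := ((hq.mono (M := i + 1) (by omega)).append (hf.mono (M := l + 1) (by omega))
      (fun x hx y hy => (hfq y (by omega) x (by omega)).symm)
      (fun _ _ => by simpa using hadj)).append (IsPathSeq.singleton g) (by
        intro x hx _ _
        split_ifs with h
        · exact (hg x (by omega)).symm
        · exact (hgf _ (by omega)).symm) (fun _ _ => by
        rw [if_neg (by omega), show i + 1 + (l + 1) - 1 - (i + 1) = l by omega]
        exact hlg)
    obtain ⟨c', hr, hτ', hs'⟩ := exists_tokenReach_abacus hpath (τ := skipIndex p i)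
      (pos := fun b => b)
      (pos' := fun b => if b + 1 < i then b else if b + 1 = i then i else i + 1 + (l + 1))
      (n := i + 1)
      (fun i j h _ => h) (fun x y h _ => by split_ifs <;> omega) (fun i h => by omega)
      (fun x h => by split_ifs <;> omega) hc
      (fun b hb => by
        rw [if_pos (by omega), if_pos hb]
        exact insertSeq_skipIndex (by omega)) (by
        intro s hs x hx
        have hsp := s.2
        simp only [insertSeq]
        rcases ne_skipIndex (by omega) hs with h | h | h | h
        · rw [if_neg (by omega), if_pos h]
          split_ifs
          · exact hv x (by omega)
          · intro hh
            have := hf.1 _ (by omega) _ (by omega) hh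
            omega
          · exact (hgf _ (by omega)).symm
        · rw [if_neg (by omega), if_neg (by omega)]
          split_ifs
          · intro hh
            have := hq.1 _ (by omega) _ (by omega) hh
            omega
          · exact (hfq _ (by omega) _ (by omega)).symm
          · exact (hg _ (by omega)).symm
        · omega
        · omega)
    have hc' := hr.injective hc
    have ha' : a = skipIndex p i (i - 1) := by
      ext
      rw [skipIndex_val (by omega), if_pos (by omega)]
      omega
    have hb' : c' b = f (l + 1) := by
      rw [hs' b]
      · simp [insertSeq, hb]
      · intro x hx h
        rw [h, skipIndex_val (by omega)] at hb
        split_ifs at hb <;> omega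
    refine ⟨_, hr.trans (hslide (t := b) hc' hb' ?_), ?_⟩
    · intro y hy s
      by_cases hs : ∃ x < i + 1, s = skipIndex p i x
      · obtain ⟨x, hx, rfl⟩ := hs
        rw [hτ' x hx]
        rcases lt_trichotomy (x + 1) i with h | h | h
        · rw [if_pos h, if_pos (by omega), if_pos (by omega)]
          exact (hfq _ (by omega) _ (by omega)).symm
        · rw [if_neg h.not_lt, if_pos h, if_pos (by omega), if_pos (by omega)]
          exact (hfq _ (by omega) _ (by omega)).symm
        · rw [if_neg (show ¬x + 1 < i by omega), if_neg (show ¬x + 1 = i by omega),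
            if_neg (by omega)]
          exact hgf _ (by omega)
      · push Not at hs
        rw [hs' s hs]
        rcases hcase s with ⟨-, h⟩ | ⟨x, hx, h⟩
        · rw [h]
          intro hh
          have := hf.1 _ (by omega) _ (by omega) hh
          omega
        · rw [h]
          exact (hfq y (by omega) x hx).symm
    · rw [Function.update_self, Function.update_of_ne (by rintro rfl; omega), ha',
        hτ' _ (by omega), if_neg (show ¬i - 1 + 1 < i by omega),
        if_pos (show i - 1 + 1 = i by omega), if_pos (by omega), if_pos (by omega)]
      exact hadj

end Linkable
section FiniteTheorem

variable {W : Type*} {H : SimpleGraph W}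

open Classical in
theorem IsPathSeq.card_compl [Fintype W] {q : ℕ → W} {p : ℕ} (hq : IsPathSeq H q p) :
    Fintype.card {w : W // ∀ x < p, w ≠ q x} + p = Fintype.card W := by
  have h1 : ((Finset.range p).image q).card = p := by
    rw [Finset.card_image_of_injOn, Finset.card_range]
    intro i hi j hj hij
    exact hq.1 i (by simpa using hi) j (by simpa using hj) hij
  have h2 := Finset.card_compl_add_card ((Finset.range p).image q)
  rw [h1] at h2
  rw [← h2, Fintype.card_subtype]
  congr 2
  ext w
  simp [eq_comm]

/-- Beads on part of a longest path together with tokens on all vertices off the path. -/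
theorem IsPathSeq.linkableTokens_of_longest [Fintype W] (hH : H.Connected) {q : ℕ → W} {p : ℕ}
    (hq : IsPathSeq H q p) (hmax : ∀ q' N, IsPathSeq H q' N → N ≤ p) (hp : 2 ≤ p) :
    LinkableTokens H (Fintype.card W - (p + 1) / 2) := by
  classical
  let F := {w : W // ∀ x < p, w ≠ q x}
  have hcard : Fintype.card F + p = Fintype.card W := hq.card_compl
  set n := p - (p + 1) / 2 with hn
  have hhang := fun w : F => IsPathSeq.exists_hanging hH (q := q) (p := p) (by omega) w.2
  choose r e j he hj h0 hre hr hdis using hhang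
  have harm : ∀ w, e w ≤ j w ∧ e w + j w + 1 ≤ p := by
    intro w
    have h := hr w
    have hew := he w
    refine hq.arm_le hmax ((h.reverse (M := e w) (by omega)).mono (M := e w) (by omega)) (hj w)
      (fun i hi => hdis w _ (by omega) (by omega)) ?_
    have := h.2 0 (by omega)
    rw [h0] at this
    rw [show e w - (e w - 1) = 0 + 1 by omega]
    exact this.symm
  let c : Fin n ⊕ F → W := Sum.elim (fun i => q i) (fun w => w.1)
  have hc : Function.Injective c := by
    rintro (a | a) (b | b) hab
    · have := hq.1 a (by omega) b (by omega) hab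
      rw [Fin.ext this]
    · exact absurd hab.symm (b.2 a (by omega))
    · exact absurd hab (a.2 b (by omega))
    · rw [Subtype.ext hab]
  let τ : ℕ → Fin n ⊕ F := fun i => if h : i < n then Sum.inl ⟨i, h⟩ else Sum.inl ⟨0, by omega⟩
  have hτ : ∀ i (h : i < n), τ i = Sum.inl ⟨i, h⟩ := fun i h => dif_pos h
  let g : Fin n ⊕ F → ℕ := Sum.elim (fun i => i) (fun w => min (j w) n - 1)
  have := linkableTokens_of_beads (H := H) hc (n := n) τ g ?_ ?_ ?_ ?_
  · rw [Fintype.card_sum, Fintype.card_fin] at this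
    rwa [show Fintype.card W - (p + 1) / 2 = n + Fintype.card F by omega]
  · rintro (a | a)
    · exact a.2
    · change min (j a) n - 1 < n
      omega
  · intro i hi
    rw [hτ i hi]
    rfl
  · intro i hi
    refine ⟨c, Relation.ReflTransGen.refl, ?_⟩
    rw [hτ i (by omega), hτ _ hi]
    exact hq.2 i (by omega)
  · rintro (a | w) ha
    · exact absurd (hτ a a.2).symm ha
    · have hσ : ∀ i, 1 ≤ i → i ≤ e w → ∀ x < p, r w i ≠ q x := hdis w
      have hew := he w
      have ha := harm w
      have := swappable_bead (τ := τ)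
        (σ := fun i => if h : ∀ x < p, r w i ≠ q x then Sum.inr ⟨r w i, h⟩ else Sum.inr w)
        hq (hr w) (he w) (h0 w) (hdis w) (n := n) (by omega) ha.1 ha.2 (by omega) hc
        (fun i hi => by rw [hτ i hi]; rfl) ?_ ?_
      · have hw : (if h : ∀ x < p, r w (e w) ≠ q x then (Sum.inr ⟨r w (e w), h⟩ : Fin n ⊕ F)
            else Sum.inr w) = Sum.inr w := by
          rw [dif_pos (hσ _ hew le_rfl)]
          congr 1
          exact Subtype.ext (hre w)
        rwa [hw] at this
      · rintro (a | w') hs x hx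
        · exact absurd (hτ a a.2).symm (hs a a.2)
        · exact w'.2 x hx
      · intro i hi hi'
        rw [dif_pos (hσ i hi hi')]
        rfl

theorem IsPathSeq.linkableTokens_succ [Fintype W] (hH : H.Connected) {q : ℕ → W} {p : ℕ}
    (hq : IsPathSeq H q p) (hmax : ∀ q' N, IsPathSeq H q' N → N ≤ p) (hp : 1 ≤ p)
    (hcard : 3 * p < 2 * Fintype.card W) : LinkableTokens H (p + 1) := by
  classical
  have hF := hq.card_compl
  have hne : ∃ w, ∀ x < p, w ≠ q x := by
    have : 0 < Fintype.card {w : W // ∀ x < p, w ≠ q x} := by omega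
    obtain ⟨w⟩ := Fintype.card_pos_iff.mp this
    exact ⟨w.1, w.2⟩
  obtain ⟨w, hw⟩ := hne
  obtain ⟨_, ⟨i, hi, rfl⟩, v, hv, hadj⟩ := hH.exists_adj_boundary (S := {u | ∃ x < p, q x = u})
    (a := q 0) (b := w) ⟨0, hp, rfl⟩ (by rintro ⟨x, hx, rfl⟩; exact hw x hx rfl)
  replace hv : ∀ x < p, v ≠ q x := fun x hx h => hv ⟨x, hx, h.symm⟩
  by_cases hgate : ∃ v', (∀ x < p, v' ≠ q x) ∧ v ≠ v' ∧ ∃ i' < p, H.Adj (q i') v'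
  · obtain ⟨v', hv', hvv', i', hi', hadj'⟩ := hgate
    rcases le_total i i' with h | h
    · exact hq.linkableTokens_of_two_gates h hi' hv hv' hvv' hadj hadj'
    · exact hq.linkableTokens_of_two_gates h hi hv' hv hvv'.symm hadj' hadj
  · push Not at hgate
    obtain ⟨N, ⟨f, hf, hf0, hfq⟩, hN, hNmax⟩ := Nat.exists_greatest_of_bounded
      (P := fun N => ∃ f, IsPathSeq H f N ∧ f 0 = v ∧ ∀ y < N, ∀ x < p, f y ≠ q x) (n := 1)
      ⟨fun _ => v, IsPathSeq.singleton v, rfl, fun _ _ => hv⟩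
      (b := p) (by rintro m ⟨f, hf, -⟩; exact hmax f m hf)
    have harm := hq.arm_le hmax ((hf.reverse (M := N - 1) (by omega)).mono (M := N) (by omega)) hi
      (fun y hy => hfq _ (by omega)) (by simpa [hf0] using hadj.symm)
    have hex : ∃ u, (∀ x < p, u ≠ q x) ∧ ∀ y < N, u ≠ f y := by
      by_contra! hcon
      have : (Finset.univ : Finset W).card ≤
          ((Finset.range p).image q ∪ (Finset.range N).image f).card := by
        refine Finset.card_le_card fun u _ => ?_
        by_cases hu : ∀ x < p, u ≠ q x
        · obtain ⟨y, hy, rfl⟩ := hcon u hu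
          exact Finset.mem_union_right _ (Finset.mem_image_of_mem f (Finset.mem_range.mpr hy))
        · push Not at hu
          obtain ⟨x, hx, rfl⟩ := hu
          exact Finset.mem_union_left _ (Finset.mem_image_of_mem q (Finset.mem_range.mpr hx))
      have h1 := Finset.card_union_le ((Finset.range p).image q) ((Finset.range N).image f)
      have h2 := Finset.card_image_le (s := Finset.range p) (f := q)
      have h3 := Finset.card_image_le (s := Finset.range N) (f := f)
      rw [Finset.card_range] at h2 h3
      rw [Finset.card_univ] at this
      omega
    obtain ⟨u, hu, huf⟩ := hex
    obtain ⟨z, hz, g, hg, hzg⟩ := hH.exists_adj_boundary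
      (S := {u | (∃ x < p, q x = u) ∨ ∃ y < N, f y = u}) (a := q 0) (b := u)
      (Or.inl ⟨0, hp, rfl⟩) (by
        rintro (⟨x, hx, rfl⟩ | ⟨y, hy, rfl⟩)
        · exact hu x hx rfl
        · exact huf y hy rfl)
    have hgq : ∀ x < p, g ≠ q x := fun x hx h => hg (Or.inl ⟨x, hx, h.symm⟩)
    have hgf : ∀ y < N, g ≠ f y := fun y hy h => hg (Or.inr ⟨y, hy, h.symm⟩)
    rcases hz with ⟨x, hx, rfl⟩ | ⟨l, hl, rfl⟩
    · by_cases hvg : v = g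
      · exact absurd (hvg.symm.trans hf0.symm) (hgf 0 hN)
      · exact absurd hzg (hgate g hgq hvg x hx)
    · rcases Nat.lt_or_ge (l + 1) N with h | h
      · exact hq.linkableTokens_of_branch hi (hf.mono (M := l + 2) h)
          (fun y hy => hfq y (by omega)) (by rwa [hf0]) hgq (fun y hy => hgf y (by omega)) hzg
      · have := hNmax (N + 1) ⟨_, hf.append (IsPathSeq.singleton g)
          (fun y hy _ _ => (hgf y hy).symm) (fun _ _ => by rwa [show N - 1 = l by omega]),
          by rw [if_pos (show 0 < N from hN), hf0], fun y hy x hx => by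
            split_ifs with h
            · exact hfq y h x hx
            · exact hgq x hx⟩
        omega

/-- In a connected graph on `m ≥ (3/2)k - 1` vertices one can place at least `k` linkable
tokens. -/
theorem SimpleGraph.Connected.exists_linkableTokens [Fintype W] (hH : H.Connected) {k : ℕ}
    (hk : 3 * k ≤ 2 * Fintype.card W + 2) : ∃ K, k ≤ K ∧ LinkableTokens H K := by
  obtain ⟨w⟩ := hH.nonempty
  obtain ⟨p, ⟨q, hq⟩, hp, hmax⟩ := Nat.exists_greatest_of_bounded
    (P := fun N => ∃ q, IsPathSeq H q N) (n := 1) ⟨_, IsPathSeq.singleton w⟩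
    (b := Fintype.card W) (by rintro m ⟨q, hq⟩; exact hq.le_card)
  replace hmax : ∀ q' N, IsPathSeq H q' N → N ≤ p := fun q' N h => hmax N ⟨q', h⟩
  rcases Nat.lt_or_ge p k with h | h
  · rcases Nat.lt_or_ge (Fintype.card W - (p + 1) / 2) k with h' | h'
    · exact ⟨p + 1, by omega, hq.linkableTokens_succ hH hmax hp (by omega)⟩
    · refine ⟨_, h', hq.linkableTokens_of_longest hH hmax ?_⟩
      by_contra hcon
      obtain rfl : p = 1 := by omega
      have hF := hq.le_card
      obtain ⟨a, b, hab⟩ := Fintype.one_lt_card_iff.mp (show 1 < Fintype.card W by omega)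
      obtain ⟨x, hx, y, -, hxy⟩ := hH.exists_adj_boundary (S := {a}) rfl
        (show b ∉ ({a} : Set W) from fun h => hab h.symm)
      have := hmax _ _ ((IsPathSeq.singleton (H := H) x).append (IsPathSeq.singleton y)
        (fun _ _ _ _ => hxy.ne) (fun _ _ => hxy))
      omega
  · exact ⟨p, h, hq.linkableTokens⟩

end FiniteTheorem
section Minors

variable {X Y Z : Type*} {G : SimpleGraph X}

theorem connected_induce_singleton (x : X) : (G.induce ({x} : Set X)).Connected := by
  have : Subsingleton ({x} : Set X) := Set.subsingleton_singleton.coe_sort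
  have : Nonempty ({x} : Set X) := ⟨⟨x, rfl⟩⟩
  exact ⟨SimpleGraph.Preconnected.of_subsingleton⟩

theorem connected_induce_iUnion_Ico {B : ℕ → Set X} {a b : ℕ} (hab : a < b)
    (hB : ∀ n, a ≤ n → n < b → (G.induce (B n)).Connected)
    (hadj : ∀ n, a ≤ n → n + 1 < b → ∃ u ∈ B n, ∃ v ∈ B (n + 1), G.Adj u v) :
    (G.induce {x | ∃ n, a ≤ n ∧ n < b ∧ x ∈ B n}).Connected := by
  induction b, Nat.succ_le_of_lt hab using Nat.le_induction with
  | base =>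
    have : {x | ∃ n, a ≤ n ∧ n < a + 1 ∧ x ∈ B n} = B a := by
      ext x
      constructor
      · rintro ⟨n, h1, h2, h⟩
        rwa [show a = n by omega]
      · exact fun h => ⟨a, le_rfl, by omega, h⟩
    change (G.induce {x | ∃ n, a ≤ n ∧ n < a + 1 ∧ x ∈ B n}).Connected
    rw [this]
    exact hB a le_rfl (by omega)
  | succ b hb ih =>
    have hb' : a < b := hb
    have : {x | ∃ n, a ≤ n ∧ n < b + 1 ∧ x ∈ B n} =
        {x | ∃ n, a ≤ n ∧ n < b ∧ x ∈ B n} ∪ B b := by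
      ext x
      constructor
      · rintro ⟨n, h1, h2, h⟩
        rcases Nat.lt_or_ge n b with h' | h'
        · exact Or.inl ⟨n, h1, h', h⟩
        · rw [show n = b by omega] at h
          exact Or.inr h
      · rintro (⟨n, h1, h2, h⟩ | h)
        · exact ⟨n, h1, by omega, h⟩
        · exact ⟨b, by omega, by omega, h⟩
    rw [this]
    obtain ⟨u, hu, v, hv, huv⟩ := hadj (b - 1) (by omega) (by omega)
    rw [show b - 1 + 1 = b by omega] at hv
    exact connected_induce_union (ih hb' (fun n h1 h2 => hB n h1 (by omega))
      (fun n h1 h2 => hadj n h1 (by omega))).preconnected (hB b (by omega) (by omega)).preconnected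
      ⟨b - 1, by omega, by omega, hu⟩ hv huv

theorem connected_induce_biUnion {M : SimpleGraph Y} {I : Set Y} {B : Y → Set X}
    (hI : (M.induce I).Connected) (hB : ∀ y, (G.induce (B y)).Connected)
    (hadj : ∀ y z, M.Adj y z → ∃ u ∈ B y, ∃ v ∈ B z, G.Adj u v) :
    (G.induce (⋃ y ∈ I, B y)).Connected := by
  obtain ⟨⟨y₀, hy₀⟩⟩ := hI.nonempty
  obtain ⟨⟨u, hu⟩⟩ := (hB y₀).nonempty
  refine G.induce_connected_of_patches u (Set.mem_biUnion hy₀ hu) ?_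
  intro v hv
  obtain ⟨y, hy, hvy⟩ := Set.mem_iUnion₂.mp hv
  have key : ∀ {a b : I} (w : (M.induce I).Walk a b),
      (G.induce {x | ∃ z ∈ w.support, x ∈ B z.1}).Connected := by
    intro a b w
    induction w with
    | @nil u =>
      have : {x | ∃ z ∈ (Walk.nil : (M.induce I).Walk u u).support, x ∈ B z.1} = B u.1 := by
        ext x
        simp
      rw [this]
      exact hB _
    | @cons a c b h w ih =>
      obtain ⟨x, hx, x', hx', hxx⟩ := hadj a.1 c.1 h
      have : {x | ∃ z ∈ (Walk.cons h w).support, x ∈ B z.1} =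
          B a.1 ∪ {x | ∃ z ∈ w.support, x ∈ B z.1} := by
        ext x
        simp only [Walk.support_cons, List.mem_cons, Set.mem_ofPred_eq, Set.mem_union]
        constructor
        · rintro ⟨z, hz | hz, hxz⟩
          · exact Or.inl (hz ▸ hxz)
          · exact Or.inr ⟨z, hz, hxz⟩
        · rintro (hxa | ⟨z, hz, hxz⟩)
          · exact ⟨a, Or.inl rfl, hxa⟩
          · exact ⟨z, Or.inr hz, hxz⟩
      rw [this]
      exact connected_induce_union (hB a).preconnected ih.preconnected hx
        ⟨c, Walk.start_mem_support w, hx'⟩ hxx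
  obtain ⟨w⟩ := hI.preconnected ⟨y₀, hy₀⟩ ⟨y, hy⟩
  refine ⟨{x | ∃ z ∈ w.support, x ∈ B z.1}, ?_, ⟨_, w.start_mem_support, hu⟩,
    ⟨_, w.end_mem_support, hvy⟩, (key w).preconnected _ _⟩
  rintro x ⟨z, -, hx⟩
  exact Set.mem_biUnion z.2 hx

theorem HasMinor.trans {M : SimpleGraph Y} {N : SimpleGraph Z} (h : HasMinor G M)
    (h' : HasMinor M N) : HasMinor G N := by
  obtain ⟨B, hne, hdis, hconn, hadj⟩ := h
  obtain ⟨B', hne', hdis', hconn', hadj'⟩ := h'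
  refine ⟨fun z => ⋃ y ∈ B' z, B y, ?_, ?_, ?_, ?_⟩
  · intro z
    obtain ⟨y, hy⟩ := hne' z
    obtain ⟨x, hx⟩ := hne y
    exact ⟨x, Set.mem_biUnion hy hx⟩
  · intro z z' hzz
    refine Set.disjoint_left.mpr fun x hx hx' => ?_
    obtain ⟨y, hy, hxy⟩ := Set.mem_iUnion₂.mp hx
    obtain ⟨y', hy', hxy'⟩ := Set.mem_iUnion₂.mp hx'
    by_cases h : y = y'
    · subst h
      exact Set.disjoint_left.mp (hdis' hzz) hy hy'
    · exact Set.disjoint_left.mp (hdis h) hxy hxy'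
  · intro z
    exact connected_induce_biUnion (hconn' z) hconn (fun y z h => hadj h)
  · intro z z' hzz
    obtain ⟨y, hy, y', hy', hyy⟩ := hadj' hzz
    obtain ⟨x, hx, x', hx', hxx⟩ := hadj hyy
    exact ⟨x, Set.mem_biUnion hy hx, x', Set.mem_biUnion hy' hx', hxx⟩

theorem HasMinor.of_injective {M : SimpleGraph Y} {N : SimpleGraph Z} (h : HasMinor G M)
    (φ : Z → Y) (hφ : Function.Injective φ) (hadj : ∀ a b, N.Adj a b → M.Adj (φ a) (φ b)) :
    HasMinor G N := by
  obtain ⟨B, hne, hdis, hconn, hB⟩ := h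
  exact ⟨B ∘ φ, fun z => hne _, fun z z' hzz => hdis (hφ.ne hzz), fun z => hconn _,
    fun z z' hzz => hB (hadj _ _ hzz)⟩

/-- The Cartesian product of a graph with a ray. -/
def rayProduct (Q : SimpleGraph Y) : SimpleGraph (Y × ℕ) :=
  SimpleGraph.fromRel fun a b => (a.1 = b.1 ∧ b.2 = a.2 + 1) ∨ (a.2 = b.2 ∧ Q.Adj a.1 b.1)

theorem rayProduct_adj_succ (Q : SimpleGraph Y) (y : Y) (n : ℕ) :
    (rayProduct Q).Adj (y, n) (y, n + 1) := by
  simp [rayProduct]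

theorem rayProduct_adj_of_adj {Q : SimpleGraph Y} {y z : Y} (h : Q.Adj y z) (n : ℕ) :
    (rayProduct Q).Adj (y, n) (z, n) := by
  simp [rayProduct, h, h.ne]

/-- Consecutive connected segments, one family for each vertex of `Q`, grouped into blocks of
length `M` such that every edge of `Q` is realised in every block, contain the product of `Q` with
a ray as a minor. -/
theorem hasMinor_rayProduct {Q : SimpleGraph Y} {B : ℕ → Y → Set X} {M : ℕ} (hM : 0 < M)
    (hconn : ∀ n y, (G.induce (B n y)).Connected)
    (hdis : ∀ n n' y y' x, x ∈ B n y → x ∈ B n' y' → n = n' ∧ y = y')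
    (hsucc : ∀ n y, ∃ u ∈ B n y, ∃ v ∈ B (n + 1) y, G.Adj u v)
    (hadj : ∀ y z, Q.Adj y z → ∀ r, ∃ n, r * M ≤ n ∧ n < (r + 1) * M ∧
      ∃ u ∈ B n y, ∃ v ∈ B n z, G.Adj u v) : HasMinor G (rayProduct Q) := by
  have hlt : ∀ r, r * M < (r + 1) * M := fun r => by rw [Nat.succ_mul]; omega
  have hblock : ∀ r r' n, r * M ≤ n → n < (r + 1) * M → r' * M ≤ n → n < (r' + 1) * M →
      r = r' := by
    intro r r' n h1 h2 h3 h4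
    have h5 : r < r' + 1 := Nat.lt_of_mul_lt_mul_right (h1.trans_lt h4)
    have h6 : r' < r + 1 := Nat.lt_of_mul_lt_mul_right (h3.trans_lt h2)
    omega
  have hconn' : ∀ z : Y × ℕ, (G.induce {x | ∃ n, z.2 * M ≤ n ∧ n < (z.2 + 1) * M ∧
      x ∈ B n z.1}).Connected := fun z =>
    connected_induce_iUnion_Ico (B := fun n => B n z.1) (hlt _) (fun n _ _ => hconn n _)
      (fun n _ _ => hsucc n _)
  refine ⟨fun z => {x | ∃ n, z.2 * M ≤ n ∧ n < (z.2 + 1) * M ∧ x ∈ B n z.1}, ?_, ?_, hconn', ?_⟩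
  · intro z
    obtain ⟨⟨x, hx⟩⟩ := (hconn' z).nonempty
    exact ⟨x, hx⟩
  · intro z z' hzz
    refine Set.disjoint_left.mpr ?_
    rintro x ⟨n, h1, h2, h⟩ ⟨n', h1', h2', h'⟩
    obtain ⟨rfl, hz⟩ := hdis _ _ _ _ _ h h'
    exact hzz (Prod.ext hz (hblock _ _ _ h1 h2 h1' h2'))
  · have key : ∀ z z' : Y × ℕ,
        ((z.1 = z'.1 ∧ z'.2 = z.2 + 1) ∨ (z.2 = z'.2 ∧ Q.Adj z.1 z'.1)) →
        ∃ u ∈ {x | ∃ n, z.2 * M ≤ n ∧ n < (z.2 + 1) * M ∧ x ∈ B n z.1},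
        ∃ v ∈ {x | ∃ n, z'.2 * M ≤ n ∧ n < (z'.2 + 1) * M ∧ x ∈ B n z'.1}, G.Adj u v := by
      rintro ⟨y, r⟩ ⟨y', r'⟩ (⟨h1, h2⟩ | ⟨h1, h2⟩)
      · dsimp only at h1 h2
        subst h1 h2
        have h3 := hlt r
        have h4 := hlt (r + 1)
        obtain ⟨u, hu, v, hv, huv⟩ := hsucc ((r + 1) * M - 1) y
        rw [show (r + 1) * M - 1 + 1 = (r + 1) * M by omega] at hv
        exact ⟨u, ⟨_, by dsimp only; omega, by dsimp only; omega, hu⟩, v, ⟨_, le_rfl, h4, hv⟩, huv⟩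
      · dsimp only at h1 h2
        subst h1
        obtain ⟨n, h3, h4, u, hu, v, hv, huv⟩ := hadj _ _ h2 r
        exact ⟨u, ⟨n, h3, h4, hu⟩, v, ⟨n, h3, h4, hv⟩, huv⟩
    intro z z' hzz
    simp only [rayProduct, SimpleGraph.fromRel_adj] at hzz
    rcases hzz.2 with h | h
    · exact key z z' h
    · obtain ⟨u, hu, v, hv, huv⟩ := key z' z h
      exact ⟨v, hv, u, hu, huv.symm⟩

end Minors

section TokenGrid

variable {W : Type*} {ι : Type*} {H : SimpleGraph W}

/-- The graph of placements of tokens. -/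
def placementGraph (ι : Type*) (H : SimpleGraph W) : SimpleGraph (ι → W) where
  Adj := TokenMove H
  symm := ⟨fun _ _ h => TokenMove.symm h⟩
  loopless := ⟨fun _ h => by
    obtain ⟨-, -, t, h, -⟩ := h
    exact h.ne rfl⟩

theorem TokenReach.reachable {c c' : ι → W} (h : TokenReach H c c') :
    (placementGraph ι H).Reachable c c' := by
  induction h with
  | refl => exact Reachable.refl _
  | tail _ hm ih => exact ih.trans (show (placementGraph ι H).Adj _ _ from hm).reachable

theorem exists_closed_walk_of_tokenRel {c : ι → W} (P : Finset (ι × ι))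
    (hP : ∀ x ∈ P, TokenRel H c x.1 x.2) : ∃ w : (placementGraph ι H).Walk c c,
      ∀ x ∈ P, ∃ d ∈ w.support, H.Adj (d x.1) (d x.2) := by
  classical
  induction P using Finset.induction_on with
  | empty => exact ⟨Walk.nil, by simp⟩
  | insert x P _ ih =>
    obtain ⟨w, hw⟩ := ih fun y hy => hP y (Finset.mem_insert_of_mem hy)
    obtain ⟨d, hr, hd⟩ := hP x (Finset.mem_insert_self _ _)
    obtain ⟨v⟩ := hr.reachable
    refine ⟨w.append (v.append v.reverse), ?_⟩
    intro y hy
    rcases Finset.mem_insert.mp hy with rfl | hy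
    · exact ⟨d, by simp [Walk.mem_support_append_iff], hd⟩
    · obtain ⟨d', hd', h⟩ := hw y hy
      exact ⟨d', by simp [Walk.mem_support_append_iff, hd'], h⟩

/-- Linkable tokens on `H` yield a grid minor in the product of `H` with a ray. -/
theorem LinkableTokens.hasMinor {K : ℕ} (h : LinkableTokens H K) :
    HasMinor (rayProduct H) (gridN K) := by
  classical
  obtain ⟨c, hc, hrel⟩ := h
  obtain ⟨w, hw⟩ := exists_closed_walk_of_tokenRel
    (Finset.univ.filter fun x : Fin K × Fin K => (x.2 : ℕ) = x.1 + 1)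
    (fun x hx => hrel _ _ (Finset.mem_filter.mp hx).2)
  set L := w.length + 1 with hL
  let d : ℕ → Fin K → W := fun n => w.getVert (n % L)
  have hstep : ∀ n, d (n + 1) = d n ∨ TokenMove H (d n) (d (n + 1)) := by
    intro n
    have hlt : n % L < L := Nat.mod_lt _ (by omega)
    rcases Nat.lt_or_ge (n % L) w.length with h | h
    · right
      have h1 : (n + 1) % L = n % L + 1 := by
        rw [Nat.add_mod_of_add_mod_lt] <;> rw [Nat.mod_eq_of_lt (by omega : 1 < L)]
        omega
      have := w.adj_getVert_succ h
      simp only [d, h1]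
      exact this
    · left
      have h1 : n % L = w.length := by omega
      have h2 : (n + 1) % L = 0 := by
        rw [Nat.add_mod, h1, Nat.add_mod_mod]
        simp [hL]
      simp [d, h1, h2]
  have hinj : ∀ n, Function.Injective (d n) := by
    intro n
    induction n with
    | zero => simpa [d] using hc
    | succ n ih =>
      rcases hstep n with h | h
      · rwa [h]
      · exact h.2.1
  have hne : ∀ n t t', t ≠ t' → d n t ≠ d (n + 1) t' := by
    intro n t t' htt h
    rcases hstep n with h' | ⟨_, _, s, hadj, hs⟩
    · rw [h'] at h
      exact htt (hinj n h)
    · by_cases h1 : t' = s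
      · rw [← hs t (h1 ▸ htt)] at h
        exact htt (hinj _ h)
      · rw [hs t' h1] at h
        exact htt (hinj _ h)
  have hgrid : HasMinor (rayProduct H) (rayProduct (SimpleGraph.fromRel
      fun i j : Fin K => (j : ℕ) = i + 1)) := by
    refine hasMinor_rayProduct (M := L) (B := fun n t => {(d n t, n), (d (n + 1) t, n)})
      (by omega) ?_ ?_ ?_ ?_
    · intro n t
      have hcase : d (n + 1) t = d n t ∨ H.Adj (d n t) (d (n + 1) t) := by
        rcases hstep n with h | ⟨_, _, s, hadj, hs⟩
        · exact Or.inl (by rw [h])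
        · by_cases h1 : t = s
          · exact Or.inr (h1 ▸ hadj)
          · exact Or.inl (hs t h1)
      rcases hcase with h | h
      · rw [h, Set.pair_eq_singleton]
        exact connected_induce_singleton _
      · exact induce_pair_connected_of_adj (rayProduct_adj_of_adj h n)
    · intro n n' t t' x hx hx'
      have h1 : x.2 = n := by rcases hx with rfl | rfl <;> rfl
      have h2 : x.2 = n' := by rcases hx' with rfl | rfl <;> rfl
      obtain rfl : n = n' := h1.symm.trans h2
      refine ⟨rfl, ?_⟩
      by_contra htt
      rcases hx with rfl | rfl <;> rcases hx' with h | h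
      · exact htt (hinj n (Prod.ext_iff.mp h).1)
      · exact hne n _ _ htt (Prod.ext_iff.mp h).1
      · exact hne n _ _ (Ne.symm htt) (Prod.ext_iff.mp h).1.symm
      · exact htt (hinj (n + 1) (Prod.ext_iff.mp h).1)
    · intro n t
      exact ⟨_, Or.inr rfl, _, Or.inl rfl, rayProduct_adj_succ _ _ _⟩
    · have key : ∀ i j : Fin K, (j : ℕ) = i + 1 → ∀ r, ∃ n, r * L ≤ n ∧ n < (r + 1) * L ∧
          H.Adj (d n i) (d n j) := by
        intro i j hij r
        obtain ⟨c', hc', hadj⟩ := hw (i, j) (by simpa using hij)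
        obtain ⟨n, rfl, hn⟩ := Walk.mem_support_iff_exists_getVert.mp hc'
        refine ⟨r * L + n, by omega, by rw [Nat.succ_mul]; omega, ?_⟩
        have : (r * L + n) % L = n := by
          rw [Nat.mul_add_mod_self_right, Nat.mod_eq_of_lt (by omega)]
        simpa only [d, this] using hadj
      intro i j hij r
      rw [SimpleGraph.fromRel_adj] at hij
      have : ∃ n, r * L ≤ n ∧ n < (r + 1) * L ∧ H.Adj (d n i) (d n j) := by
        rcases hij.2 with h | h
        · exact key i j h r
        · obtain ⟨n, h1, h2, h3⟩ := key j i h r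
          exact ⟨n, h1, h2, h3.symm⟩
      obtain ⟨n, h1, h2, h3⟩ := this
      exact ⟨n, h1, h2, _, Or.inl rfl, _, Or.inl rfl, rayProduct_adj_of_adj h3 n⟩
  refine hgrid.of_injective id Function.injective_id ?_
  intro a b hab
  simp only [gridN, rayProduct, SimpleGraph.fromRel_adj, id] at hab ⊢
  refine ⟨hab.1, ?_⟩
  rcases hab.2 with (h | ⟨h1, h2⟩) | (h | ⟨h1, h2⟩)
  · exact Or.inl (Or.inl h)
  · exact Or.inl (Or.inr ⟨h1, fun h => by rw [h] at h2; omega, Or.inl h2⟩)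
  · exact Or.inr (Or.inl h)
  · exact Or.inr (Or.inr ⟨h1, fun h => by rw [h] at h2; omega, Or.inl h2⟩)

theorem HasMinor.gridN_of_le {X : Type*} {G : SimpleGraph X} {k K : ℕ} (hkK : k ≤ K)
    (h : HasMinor G (gridN K)) : HasMinor G (gridN k) := by
  refine h.of_injective (Prod.map (Fin.castLE hkK) id)
    ((Fin.castLE_injective hkK).prodMap Function.injective_id) ?_
  intro a b hab
  simp only [gridN, SimpleGraph.fromRel_adj, Prod.map_fst, Prod.map_snd, id, Fin.val_castLE,
    Fin.castLE_inj, ne_eq, Prod.ext_iff] at hab ⊢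
  exact hab

end TokenGrid
section RayGraph

variable {ι : Type*} {G : SimpleGraph V} {F : ι → ℕ → V} {f : ℕ → V}

theorem Walk.exists_subwalk_between {X Y : Set V} {u v : V} (w : G.Walk u v) (hu : u ∈ X)
    (hv : v ∈ Y) : ∃ u' ∈ X, ∃ v' ∈ Y, ∃ w' : G.Walk u' v', (∀ x ∈ w'.support, x ∈ w.support) ∧
      ∀ x ∈ w'.support, x ∈ X ∪ Y → x = u' ∨ x = v' := by
  classical
  induction hn : w.length using Nat.strong_induction_on generalizing u v with
  | _ n ih =>
    subst hn
    by_cases h : ∀ x ∈ w.support, x ∈ X ∪ Y → x = u ∨ x = v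
    · exact ⟨u, hu, v, hv, w, fun _ hx => hx, h⟩
    · push Not at h
      obtain ⟨x, hx, hxXY, hxu, hxv⟩ := h
      rcases hxXY with hxX | hxY
      · obtain ⟨u', hu', v', hv', w', h1, h2⟩ := ih _ (w.length_dropUntil_lt_length hx hxu)
          (w.dropUntil x hx) hxX hv rfl
        exact ⟨u', hu', v', hv', w',
          fun y hy => w.support_dropUntil_subset_support hx (h1 y hy), h2⟩
      · obtain ⟨u', hu', v', hv', w', h1, h2⟩ := ih _ (w.length_takeUntil_lt_length hx hxv)
          (w.takeUntil x hx) hu hxY rfl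
        exact ⟨u', hu', v', hv', w',
          fun y hy => w.support_takeUntil_subset_support hx (h1 y hy), h2⟩

/-- Two rays of a family are linked if, outside every finite set, there is a walk between them
that meets the rays of the family in its endpoints only. -/
def RayLink (G : SimpleGraph V) (F : ι → ℕ → V) (i j : ι) : Prop :=
  ∀ S : Finset V, ∃ a b, ∃ w : G.Walk (F i a) (F j b), (∀ x ∈ w.support, x ∉ S) ∧
    ∀ l y, F l y ∈ w.support → F l y = F i a ∨ F l y = F j b

theorem RayLink.symm {i j : ι} (h : RayLink G F i j) : RayLink G F j i := by
  intro S
  obtain ⟨a, b, w, h1, h2⟩ := h S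
  refine ⟨b, a, w.reverse, fun x hx => h1 x (by simpa using hx), fun l y hy => ?_⟩
  exact (h2 l y (by simpa using hy)).symm

/-- The graph on a family of rays in which linked rays are adjacent. -/
def rayGraph (G : SimpleGraph V) (F : ι → ℕ → V) : SimpleGraph ι where
  Adj i j := i ≠ j ∧ RayLink G F i j
  symm := ⟨fun _ _ h => ⟨h.1.symm, h.2.symm⟩⟩
  loopless := ⟨fun _ h => h.1 rfl⟩

theorem IsRay.exists_walk (hf : IsRay G f) {m n : ℕ} (hmn : m ≤ n) :
    ∃ w : G.Walk (f m) (f n), ∀ x ∈ w.support, ∃ l, m ≤ l ∧ x = f l := by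
  induction n, hmn using Nat.le_induction with
  | base => exact ⟨Walk.nil, fun x hx => ⟨m, le_rfl, by simpa using hx⟩⟩
  | succ n hmn ih =>
    obtain ⟨w, hw⟩ := ih
    refine ⟨w.concat (hf.2 n), fun x hx => ?_⟩
    rw [Walk.support_concat, List.mem_append, List.mem_singleton] at hx
    rcases hx with hx | rfl
    · exact hw x hx
    · exact ⟨n + 1, by omega, rfl⟩

theorem IsRay.exists_forall_notMem (hf : IsRay G f) (S : Finset V) :
    ∃ N, ∀ n, N ≤ n → f n ∉ S := by
  have hfin : (f ⁻¹' (S : Set V)).Finite := S.finite_toSet.preimage hf.1.injOn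
  obtain ⟨N, hN⟩ := hfin.bddAbove
  refine ⟨N + 1, fun n hn h => ?_⟩
  have := hN (show n ∈ f ⁻¹' (S : Set V) from h)
  omega

theorem rayGraph_connected [Finite ι] [Nonempty ι] (hf : IsRay G f)
    (hFf : ∀ i, RayEquiv G (F i) f) : (rayGraph G F).Connected := by
  classical
  have := Fintype.ofFinite ι
  refine ⟨fun i₀ j₀ => ?_⟩
  by_contra hij
  let I : Set ι := {j | (rayGraph G F).Reachable i₀ j}
  have hI : ∀ i j, ∃ S : Finset V, i ∈ I → j ∉ I → ∀ a b, ∀ w : G.Walk (F i a) (F j b),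
      (∀ x ∈ w.support, x ∉ S) → ¬ ∀ l y, F l y ∈ w.support → F l y = F i a ∨ F l y = F j b := by
    intro i j
    by_cases h : i ∈ I ∧ j ∉ I
    · have hl : ¬ RayLink G F i j := fun hl =>
        h.2 (Reachable.trans h.1 (Adj.reachable
          (show (rayGraph G F).Adj i j from ⟨fun he => h.2 (he ▸ h.1), hl⟩)))
      unfold RayLink at hl
      push Not at hl
      obtain ⟨S, hS⟩ := hl
      refine ⟨S, fun _ _ a b w hw hc => ?_⟩
      obtain ⟨l, y, h1, h2, h3⟩ := hS a b w hw
      rcases hc l y h1 with h | h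
      · exact h2 h
      · exact h3 h
    · exact ⟨∅, fun h1 h2 => absurd ⟨h1, h2⟩ h⟩
  choose S hS using hI
  let T : Finset V := Finset.univ.biUnion fun x : ι × ι => S x.1 x.2
  obtain ⟨N, hN⟩ := hf.exists_forall_notMem T
  obtain ⟨a, n, -, hn, w₁, hw₁⟩ := hFf i₀ T 0 N
  obtain ⟨b, n', -, hn', w₂, hw₂⟩ := hFf j₀ T 0 N
  obtain ⟨v₁, hv₁⟩ := hf.exists_walk hn
  obtain ⟨v₂, hv₂⟩ := hf.exists_walk hn'
  have hv : ∀ x, (x ∈ v₁.support ∨ x ∈ v₂.support) → x ∉ T := by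
    rintro x (hx | hx)
    · obtain ⟨l, hl, rfl⟩ := hv₁ x hx
      exact hN l hl
    · obtain ⟨l, hl, rfl⟩ := hv₂ x hx
      exact hN l hl
  obtain ⟨u', ⟨i, hi, a', rfl⟩, v', ⟨j, hj, b', rfl⟩, w, h1, h2⟩ := Walk.exists_subwalk_between
    (X := {x | ∃ i ∈ I, ∃ a, F i a = x}) (Y := {x | ∃ j ∉ I, ∃ b, F j b = x})
    (w₁.append (v₁.reverse.append (v₂.append w₂.reverse)))
    ⟨i₀, Reachable.refl _, a, rfl⟩ ⟨j₀, hij, b, rfl⟩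
  refine hS i j hi hj a' b' w (fun x hx hxS => ?_) (fun l y hy => h2 _ hy ?_)
  · have hxT : x ∈ T := Finset.mem_biUnion.mpr ⟨(i, j), Finset.mem_univ _, hxS⟩
    have hx' := h1 x hx
    simp only [Walk.mem_support_append_iff, Walk.support_reverse, List.mem_reverse] at hx'
    rcases hx' with h | h | h | h
    · exact hw₁ x h hxT
    · exact hv x (Or.inl h) hxT
    · exact hv x (Or.inr h) hxT
    · exact hw₂ x h hxT
  · by_cases h : l ∈ I
    · exact Or.inl ⟨l, h, y, rfl⟩
    · exact Or.inr ⟨l, h, y, rfl⟩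

/-- A finite connected set far out that contains exactly one ray vertex, on a prescribed ray, and
is adjacent to a far vertex of a second ray whenever the two rays are linked. -/
theorem exists_linking_set [Finite ι] (hF : ∀ i, IsRay G (F i))
    (hdis : ∀ i j x y, F i x = F j y → i = j ∧ x = y) (i j : ι) (N : ℕ) (U : Finset V) :
    ∃ (a b : ℕ) (D : Finset V), N ≤ a ∧ N ≤ b ∧ F i a ∈ D ∧ (G.induce (D : Set V)).Connected ∧
      (∀ x ∈ D, x ∉ U) ∧ (∀ l y, F l y ∈ D → l = i ∧ y = a) ∧
      ((rayGraph G F).Adj i j → ∃ u ∈ D, G.Adj u (F j b)) := by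
  classical
  have := Fintype.ofFinite ι
  by_cases hij : (rayGraph G F).Adj i j
  · let S : Finset V := U ∪ (Finset.univ ×ˢ Finset.range N).image fun x : ι × ℕ => F x.1 x.2
    have hS : ∀ l y, F l y ∉ S → N ≤ y := by
      intro l y h
      by_contra hy
      exact h (Finset.mem_union_right _ (Finset.mem_image.mpr ⟨(l, y), by simpa using hy, rfl⟩))
    obtain ⟨a, b, w, h1, h2⟩ := hij.2 S
    have hp : w.bypass.reverse.IsPath := w.bypass_isPath.reverse
    have hsub : ∀ x ∈ w.bypass.reverse.support, x ∈ w.support := fun x hx =>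
      w.support_bypass_subset_support (by simpa using hx)
    have hba : F j b ≠ F i a := fun h => hij.1 (hdis _ _ _ _ h).1.symm
    generalize w.bypass.reverse = p at hp hsub
    obtain ⟨c, hadj, q, rfl⟩ := Walk.exists_eq_cons_of_ne hba p
    rw [Walk.cons_isPath_iff] at hp
    have hq : ∀ x ∈ q.support, x ∈ w.support := fun x hx => hsub x (by simp [hx])
    refine ⟨a, b, q.support.toFinset, hS i a (h1 _ w.start_mem_support),
      hS j b (h1 _ w.end_mem_support), by simp, ?_, ?_, ?_, fun _ => ⟨c, by simp, hadj.symm⟩⟩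
    · rw [List.coe_toFinset]
      exact q.connected_induce_support
    · intro x hx hxU
      exact h1 x (hq x (List.mem_toFinset.mp hx)) (Finset.mem_union_left _ hxU)
    · intro l y hy
      rw [List.mem_toFinset] at hy
      rcases h2 l y (hq _ hy) with h | h
      · exact hdis _ _ _ _ h
      · exact absurd (h ▸ hy) hp.2
  · obtain ⟨N', hN'⟩ := (hF i).exists_forall_notMem U
    refine ⟨N + N', N, {F i (N + N')}, by omega, le_rfl, by simp, ?_, ?_, ?_,
      fun h => absurd h hij⟩
    · rw [Finset.coe_singleton]
      exact connected_induce_singleton _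
    · intro x hx
      rw [Finset.mem_singleton] at hx
      exact hx ▸ hN' _ (by omega)
    · intro l y hy
      exact hdis _ _ _ _ (Finset.mem_singleton.mp hy)

theorem exists_linking_sequence [Finite ι] (hF : ∀ i, IsRay G (F i))
    (hdis : ∀ i j x y, F i x = F j y → i = j ∧ x = y) (p : ℕ → ι × ι) :
    ∃ (N a b : ℕ → ℕ) (D : ℕ → Finset V), (∀ n, N n ≤ a n ∧ a n < N (n + 1)) ∧
      (∀ n, N n ≤ b n ∧ b n < N (n + 1)) ∧ (∀ n, F (p n).1 (a n) ∈ D n) ∧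
      (∀ n, (G.induce (D n : Set V)).Connected) ∧
      (∀ n n' x, x ∈ D n → x ∈ D n' → n = n') ∧
      (∀ n l y, F l y ∈ D n → l = (p n).1 ∧ y = a n) ∧
      (∀ n, (rayGraph G F).Adj (p n).1 (p n).2 → ∃ u ∈ D n, G.Adj u (F (p n).2 (b n))) := by
  classical
  choose a b D ha hb haD hD hU hy hadj using exists_linking_set (G := G) hF hdis
  let st : ℕ → ℕ × Finset V := fun n => Nat.rec (0, ∅) (fun n s =>
    (a (p n).1 (p n).2 s.1 s.2 + b (p n).1 (p n).2 s.1 s.2 + 1,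
      s.2 ∪ D (p n).1 (p n).2 s.1 s.2)) n
  have hN : ∀ n, (st (n + 1)).1 = a (p n).1 (p n).2 (st n).1 (st n).2 +
    b (p n).1 (p n).2 (st n).1 (st n).2 + 1 := fun n => rfl
  have hU' : ∀ n, (st (n + 1)).2 = (st n).2 ∪ D (p n).1 (p n).2 (st n).1 (st n).2 := fun n => rfl
  have hmono : Monotone fun n => (st n).2 := monotone_nat_of_le_succ fun n => by
    rw [hU']
    exact Finset.subset_union_left
  have hlt : ∀ n n' x, n < n' → x ∈ D (p n).1 (p n).2 (st n).1 (st n).2 →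
      x ∉ D (p n').1 (p n').2 (st n').1 (st n').2 := by
    intro n n' x hnn hx hx'
    refine hU _ _ _ _ x hx' (hmono (Nat.succ_le_of_lt hnn) ?_)
    change x ∈ (st (n + 1)).2
    rw [hU']
    exact Finset.mem_union_right _ hx
  refine ⟨fun n => (st n).1, fun n => a (p n).1 (p n).2 (st n).1 (st n).2,
    fun n => b (p n).1 (p n).2 (st n).1 (st n).2, fun n => D (p n).1 (p n).2 (st n).1 (st n).2,
    fun n => ⟨ha _ _ _ _, ?_⟩, fun n => ⟨hb _ _ _ _, ?_⟩, fun n => haD _ _ _ _,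
    fun n => hD _ _ _ _, ?_, fun n => hy _ _ _ _, fun n => hadj _ _ _ _⟩
  · beta_reduce
    rw [hN]
    omega
  · beta_reduce
    rw [hN]
    omega
  · intro n n' x hx hx'
    rcases lt_trichotomy n n' with h | h | h
    · exact absurd hx' (hlt n n' x h hx)
    · exact h
    · exact absurd hx (hlt n' n x h hx')

/-- A finite family of disjoint rays yields the product of its ray graph with a ray as a minor. -/
theorem hasMinor_rayProduct_rayGraph [Finite ι] [Nonempty ι] (hF : ∀ i, IsRay G (F i))
    (hdis : ∀ i j x y, F i x = F j y → i = j ∧ x = y) :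
    HasMinor G (rayProduct (rayGraph G F)) := by
  classical
  have := Fintype.ofFinite ι
  have hM : 0 < Fintype.card (ι × ι) := Fintype.card_pos
  let e := Fintype.equivFin (ι × ι)
  obtain ⟨N, a, b, D, ha, hb, haD, hD, hDD, hDF, hadj⟩ :=
    exists_linking_sequence hF hdis fun n => e.symm ⟨n % Fintype.card (ι × ι), Nat.mod_lt _ hM⟩
  have hlt : ∀ n, N n < N (n + 1) := fun n => (ha n).1.trans_lt (ha n).2
  have hmono : StrictMono N := strictMono_nat_of_lt_succ hlt
  have hblock : ∀ n n' x, N n ≤ x → x < N (n + 1) → N n' ≤ x → x < N (n' + 1) → n = n' := by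
    intro n n' x h1 h2 h3 h4
    have h5 := hmono.lt_iff_lt.mp (h1.trans_lt h4)
    have h6 := hmono.lt_iff_lt.mp (h3.trans_lt h2)
    omega
  set p : ℕ → ι × ι := fun n => e.symm ⟨n % Fintype.card (ι × ι), Nat.mod_lt _ hM⟩ with hp
  refine hasMinor_rayProduct hM (B := fun n l => {x | ∃ y, N n ≤ y ∧ y < N (n + 1) ∧
    x ∈ ({F l y} : Set V)} ∪ {x | l = (p n).1 ∧ x ∈ D n}) ?_ ?_ ?_ ?_
  · intro n l
    have hc : (G.induce {x | ∃ y, N n ≤ y ∧ y < N (n + 1) ∧ x ∈ ({F l y} : Set V)}).Connected :=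
      connected_induce_iUnion_Ico (B := fun y => {F l y}) (hlt n)
        (fun y _ _ => connected_induce_singleton _)
        fun y _ _ => ⟨_, rfl, _, rfl, (hF l).2 y⟩
    by_cases hl : l = (p n).1
    · have : {x | l = (p n).1 ∧ x ∈ D n} = (D n : Set V) := by
        ext x
        simp [hl]
      rw [this]
      exact induce_union_connected hc.preconnected (hD n).preconnected
        ⟨F l (a n), ⟨a n, (ha n).1, (ha n).2, rfl⟩, hl ▸ haD n⟩
    · have : {x | l = (p n).1 ∧ x ∈ D n} = ∅ := by
        ext x
        simp [hl]
      rw [this, Set.union_empty]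
      exact hc
  · rintro n n' l l' x (⟨y, h1, h2, rfl⟩ | ⟨rfl, h1⟩) (⟨y', h1', h2', h'⟩ | ⟨rfl, h1'⟩)
    · obtain ⟨rfl, rfl⟩ := hdis _ _ _ _ h'
      exact ⟨hblock _ _ _ h1 h2 h1' h2', rfl⟩
    · obtain ⟨rfl, rfl⟩ := hDF _ _ _ h1'
      exact ⟨hblock _ _ _ h1 h2 (ha n').1 (ha n').2, rfl⟩
    · rw [Set.mem_singleton_iff] at h'
      subst h'
      obtain ⟨rfl, rfl⟩ := hDF _ _ _ h1
      exact ⟨hblock _ _ _ (ha n).1 (ha n).2 h1' h2', rfl⟩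
    · obtain rfl := hDD _ _ _ h1 h1'
      exact ⟨rfl, rfl⟩
  · intro n l
    have h1 := hlt n
    have h2 := hlt (n + 1)
    have h3 := (hF l).2 (N (n + 1) - 1)
    rw [show N (n + 1) - 1 + 1 = N (n + 1) by omega] at h3
    exact ⟨_, Or.inl ⟨_, by omega, by omega, rfl⟩, _, Or.inl ⟨_, le_rfl, h2, rfl⟩, h3⟩
  · intro y z hyz r
    have he := (e (y, z)).2
    have hpn : p (r * Fintype.card (ι × ι) + e (y, z)) = (y, z) := by
      simp only [hp]
      rw [Equiv.symm_apply_eq]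
      ext
      simp only [Nat.mul_add_mod_self_right, Nat.mod_eq_of_lt he]
    refine ⟨r * Fintype.card (ι × ι) + e (y, z), by omega, by rw [Nat.succ_mul]; omega, ?_⟩
    generalize r * Fintype.card (ι × ι) + (e (y, z) : ℕ) = n at hpn
    have hadj' := hadj n
    change (rayGraph G F).Adj (p n).1 (p n).2 → ∃ u ∈ D n, G.Adj u (F (p n).2 (b n)) at hadj'
    rw [hpn] at hadj'
    obtain ⟨u, hu, huv⟩ := hadj' hyz
    exact ⟨u, Or.inr ⟨by rw [hpn], hu⟩, _, Or.inl ⟨b n, (hb n).1, (hb n).2, rfl⟩, huv⟩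

end RayGraph

/-- If `G` has an end of vertex-degree at least `(3/2)k - 1`, then the `[k] × ℕ` grid is a
minor of `G`. -/
theorem stmt7 {V : Type u} (G : SimpleGraph V) (k : ℕ) (f : ℕ → V) (hf : IsRay G f)
    (hdeg : ∃ m : ℕ, 3 * (k : ℚ) / 2 - 1 ≤ (m : ℚ) ∧ HasVDisjointRays G f m) :
    HasMinor G (gridN k) := by
  obtain ⟨m, hm, F, hF, hFf, hdis⟩ := hdeg
  have hkm : 3 * k ≤ 2 * m + 2 := by
    have : (3 : ℚ) * k ≤ 2 * m + 2 := by linarith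
    exact_mod_cast this
  rcases Nat.eq_zero_or_pos k with rfl | hk
  · exact ⟨fun _ => ∅, fun x => x.1.elim0, fun x => x.1.elim0, fun x => x.1.elim0,
      fun x => x.1.elim0⟩
  have : Nonempty (Fin m) := ⟨⟨0, by omega⟩⟩
  have hdis' : ∀ i j x y, F i x = F j y → i = j ∧ x = y := by
    intro i j x y h
    by_cases hij : i = j
    · subst hij
      exact ⟨rfl, (hF i).1 h⟩
    · exact absurd ⟨y, h.symm⟩ (Set.disjoint_left.mp (hdis hij) ⟨x, rfl⟩)
  obtain ⟨K, hK, hlink⟩ := (rayGraph_connected hf hFf).exists_linkableTokens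
    (k := k) (by rwa [Fintype.card_fin])
  exact ((hasMinor_rayProduct_rayGraph hF hdis').trans hlink.hasMinor).gridN_of_le hK
end

section
/- Every graph that has an end of infinite vertex-degree contains the ℕ × ℕ grid as a minor. -/
open SimpleGraph Cardinal

universe u v

variable {V : Type u}

/-- `r` and `s` cannot be separated by a finite vertex set in the graph obtained by
deleting `W`. -/
def Linked (G : SimpleGraph V) (W : Set V) (r s : ℕ → V) : Prop :=
  ∀ S : Finset V, ∃ m n : ℕ, ∃ w : G.Walk (r m) (s n), ∀ x ∈ w.support, x ∉ S ∧ x ∉ W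

section Walks

variable {G : SimpleGraph V} {W W' : Set V} {r s t : ℕ → V}

theorem IsRay.exists_walk_s8 (hr : IsRay G r) {a b : ℕ} (hab : a ≤ b) :
    ∃ w : G.Walk (r a) (r b), {x | x ∈ w.support} = r '' Set.Icc a b := by
  induction b, hab using Nat.le_induction with
  | base => exact ⟨.nil, by ext; simp⟩
  | succ b hab ih =>
    obtain ⟨w, hw⟩ := ih
    refine ⟨w.concat (hr.2 b), ?_⟩
    rw [show Set.Icc a (b + 1) = insert (b + 1) (Set.Icc a b) by ext; simp; omega,
      Set.image_insert_eq, ← hw]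
    ext x
    simp [Walk.support_concat, or_comm]

theorem IsRay.connected_induce_segment (hr : IsRay G r) {a b : ℕ} (hab : a < b) :
    (G.induce (r '' Set.Ico a b)).Connected := by
  obtain ⟨b, rfl⟩ : ∃ c, b = c + 1 := ⟨b - 1, by omega⟩
  obtain ⟨w, hw⟩ := hr.exists_walk_s8 (show a ≤ b by omega)
  rw [show Set.Ico a (b + 1) = Set.Icc a b by ext; simp, ← hw]
  exact w.connected_induce_support

/-- A walk ending in `T` but starting outside it has an initial part outside `T` that can be
extended by an edge into `T`. -/
theorem exists_walk_to_first_hit (T : Set V) {x y : V} (w : G.Walk x y) (hx : x ∉ T)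
    (hy : y ∈ T) : ∃ x' y' : V, ∃ w' : G.Walk x x', (∀ z ∈ w'.support, z ∈ w.support ∧ z ∉ T) ∧
      G.Adj x' y' ∧ y' ∈ T ∧ y' ∈ w.support := by
  induction w with
  | nil => exact absurd hy hx
  | @cons u v _ h p ih =>
    by_cases hv : v ∈ T
    · exact ⟨u, v, .nil, by simpa using hx, h, hv, by simp⟩
    · obtain ⟨x', y', w', h1, h2, h3, h4⟩ := ih hv hy
      refine ⟨x', y', .cons h w', fun z hz => ?_, h2, h3, by simp [h4]⟩
      rw [Walk.support_cons, List.mem_cons] at hz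
      rcases hz with rfl | hz
      · exact ⟨by simp, hx⟩
      · exact ⟨by simp [(h1 z hz).1], (h1 z hz).2⟩

theorem Linked.symm (h : Linked G W r s) : Linked G W s r := fun S => by
  obtain ⟨m, n, w, hw⟩ := h S
  exact ⟨n, m, w.reverse, by simpa using hw⟩

theorem Linked.mono (hW : W ⊆ W') (h : Linked G W' r s) : Linked G W r s := fun S => by
  obtain ⟨m, n, w, hw⟩ := h S
  exact ⟨m, n, w, fun x hx => ⟨(hw x hx).1, fun h' => (hw x hx).2 (hW h')⟩⟩

theorem RayEquiv.linked (h : RayEquiv G r s) : Linked G ∅ r s := fun S => by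
  obtain ⟨m, n, -, -, w, hw⟩ := h S 0 0
  exact ⟨m, n, w, fun x hx => ⟨hw x hx, by simp⟩⟩

theorem Linked.trans (hs : IsRay G s) (hsW : ∀ i, s i ∉ W) (h₁ : Linked G W r s)
    (h₂ : Linked G W s t) : Linked G W r t := fun S => by
  classical
  obtain ⟨N, hN⟩ := (S.finite_toSet.preimage hs.1.injOn).bddAbove
  have hN' : ∀ i, N < i → s i ∉ S := fun i hi h => hi.not_ge (hN h)
  set S' := S ∪ (Finset.range (N + 1)).image s
  have hS' : ∀ i, s i ∉ S' → N < i := fun i hi => by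
    by_contra hlt
    exact hi (Finset.mem_union_right _ (Finset.mem_image_of_mem _ (by simp; omega)))
  obtain ⟨m, n, w, hw⟩ := h₁ S'
  obtain ⟨m', n', w', hw'⟩ := h₂ S'
  have hn := hS' n (hw _ w.end_mem_support).1
  have hm' := hS' m' (hw' _ w'.start_mem_support).1
  obtain ⟨q, hq⟩ : ∃ q : G.Walk (s n) (s m'), ∀ x ∈ q.support, x ∉ S ∧ x ∉ W := by
    rcases le_total n m' with h | h
    · obtain ⟨q, hq⟩ := hs.exists_walk_s8 h
      refine ⟨q, fun x hx => ?_⟩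
      obtain ⟨i, ⟨h1, -⟩, rfl⟩ := hq.subset hx
      exact ⟨hN' i (by omega), hsW i⟩
    · obtain ⟨q, hq⟩ := hs.exists_walk_s8 h
      refine ⟨q.reverse, fun x hx => ?_⟩
      obtain ⟨i, ⟨h1, -⟩, rfl⟩ := hq.subset (by simpa using hx)
      exact ⟨hN' i (by omega), hsW i⟩
  refine ⟨m, n', (w.append q).append w', fun x hx => ?_⟩
  rw [Walk.mem_support_append_iff, Walk.mem_support_append_iff] at hx
  rcases hx with (hx | hx) | hx
  · exact ⟨fun h => (hw x hx).1 (Finset.mem_union_left _ h), (hw x hx).2⟩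
  · exact hq x hx
  · exact ⟨fun h => (hw' x hx).1 (Finset.mem_union_left _ h), (hw' x hx).2⟩

/-- A ray linked to one of finitely many rays is linked to one of them avoiding the others. -/
theorem Linked.exists_avoiding {R : ℕ → ℕ → V}
    (hd : Pairwise fun i j => Disjoint (Set.range (R i)) (Set.range (R j)))
    {F : Finset ℕ} {j : ℕ} (hj : j ∈ F) {i : ℕ} (hi : i ∉ F) (h : Linked G W (R i) (R j)) :
    ∃ f ∈ F, Linked G (W ∪ ⋃ q ∈ F.erase f, Set.range (R q)) (R i) (R f) := by
  classical
  by_contra! hcon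
  simp only [Linked, not_forall] at hcon
  choose S hS using hcon
  obtain ⟨m, n, w, hw⟩ := h (F.attach.biUnion fun f => S f.1 f.2)
  have hstart : R i m ∉ ⋃ q ∈ F, Set.range (R q) := by
    simp only [Set.mem_iUnion, not_exists]
    intro q hq hmem
    exact (hd (show i ≠ q by rintro rfl; exact hi hq)).ne_of_mem (Set.mem_range_self m) hmem rfl
  obtain ⟨x', y', w', hw', hadj, hy', hyw⟩ := exists_walk_to_first_hit _ w hstart
    (by simp only [Set.mem_iUnion]; exact ⟨j, hj, n, rfl⟩)
  simp only [Set.mem_iUnion] at hy'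
  obtain ⟨f, hf, k, rfl⟩ := hy'
  refine hS f hf ⟨m, k, w'.concat hadj, fun z hz => ?_⟩
  have hzw : z ∈ w.support := by
    rw [Walk.support_concat, List.mem_append] at hz
    rcases hz with hz | hz
    · exact (hw' z hz).1
    · rwa [List.mem_singleton.1 hz]
  refine ⟨fun h' => (hw z hzw).1 (Finset.mem_biUnion.2 ⟨⟨f, hf⟩, by simp, h'⟩), ?_⟩
  rintro (h' | h')
  · exact (hw z hzw).2 h'
  · simp only [Set.mem_iUnion] at h'
    obtain ⟨q, hq, hzq⟩ := h'
    rw [Finset.mem_erase] at hq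
    rw [Walk.support_concat, List.mem_append] at hz
    rcases hz with hz | hz
    · refine (hw' z hz).2 ?_
      simp only [Set.mem_iUnion]
      exact ⟨q, hq.2, hzq⟩
    · rw [List.mem_singleton.1 hz] at hzq
      exact (hd hq.1).ne_of_mem hzq (Set.mem_range_self k) rfl

/-- If `r` and `s` are linked outside `W`, then there are arbitrarily late finite connected sets
that meet `r`, avoid `W` and `s`, and send an edge to `s`. -/
theorem Linked.exists_finset (hd : Disjoint (Set.range r) (Set.range s)) (h : Linked G W r s)
    (S : Finset V) : ∃ (X : Finset V) (n : ℕ), (G.induce (X : Set V)).Connected ∧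
      (∃ m, r m ∈ X) ∧ (∀ x ∈ X, x ∉ S ∧ x ∉ W ∧ x ∉ Set.range s) ∧ s n ∉ S ∧
      ∃ x ∈ X, G.Adj x (s n) := by
  classical
  obtain ⟨m, n, w, hw⟩ := h S
  obtain ⟨x', y', w', hw', hadj, ⟨k, rfl⟩, hyw⟩ := exists_walk_to_first_hit (Set.range s) w
    (fun h' => hd.ne_of_mem (Set.mem_range_self m) h' rfl) (Set.mem_range_self n)
  refine ⟨w'.support.toFinset, k, ?_, ⟨m, by simp⟩, fun x hx => ?_, (hw _ hyw).1, x', by simp, hadj⟩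
  · have := w'.connected_induce_support
    rwa [List.coe_toFinset]
  · have := hw' x (by simpa using hx)
    exact ⟨(hw x this.1).1, (hw x this.1).2, this.2⟩

end Walks

/-- The abstract properties of the relation `rel Q i j`, saying that no finite set separates the
rays `i` and `j` once the rays in `Q` are deleted, for disjoint rays in a common end. -/
structure IsLinkage (rel : Finset ℕ → ℕ → ℕ → Prop) : Prop where
  total : ∀ i j, rel ∅ i j
  symm : ∀ {Q i j}, rel Q i j → rel Q j i
  trans : ∀ {Q i j k}, j ∉ Q → rel Q i j → rel Q j k → rel Q i k
  mono : ∀ {Q Q' i j}, Q ⊆ Q' → rel Q' i j → rel Q i j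
  exchange : ∀ {Q F : Finset ℕ} {i j}, j ∈ F → i ∉ F → rel Q i j → ∃ f ∈ F, rel (Q ∪ F.erase f) i f

namespace IsLinkage

variable {rel : Finset ℕ → ℕ → ℕ → Prop}

/-- Some `b ∈ M` is related to `a` however we delete elements of some infinite
`M' ⊆ M` containing `b`. -/
def Good (rel : Finset ℕ → ℕ → ℕ → Prop) (a : ℕ) (M : Set ℕ) : Prop :=
  ∃ M' ⊆ M, M'.Infinite ∧ ∃ b ∈ M', ∀ Q : Finset ℕ, ↑Q ⊆ M' → b ∉ Q → rel Q a b

theorem exists_mem_separator (h : IsLinkage rel) {i j : ℕ} {C : Finset ℕ} {N : Set ℕ}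
    (hiC : i ∉ C) (hiN : i ∉ N) (hj : j ∈ N) (hsep : ∀ n ∈ N, n ∉ C ∧ ¬ rel C i n) :
    ∃ c ∈ C, ∀ Q : Finset ℕ, (Q : Set ℕ) ⊆ C ∪ N → c ∉ Q → rel Q i c := by
  by_contra! hcon
  choose Q hQ hcQ hrel using hcon
  set F : Finset ℕ := C ∪ insert j (C.attach.biUnion fun c => Q c.1 c.2) with hF
  have hFN : ∀ f ∈ F, f ∈ C ∨ f ∈ N := by
    intro f hf
    simp only [hF, Finset.mem_union, Finset.mem_insert, Finset.mem_biUnion] at hf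
    rcases hf with hf | rfl | ⟨c, -, hf⟩
    · exact .inl hf
    · exact .inr hj
    · exact hQ c.1 c.2 hf
  obtain ⟨f, hf, hrf⟩ := h.exchange (F := F) (i := i) (j := j) (by simp [hF])
    (fun hi => (hFN i hi).elim hiC hiN) (h.total i j)
  by_cases hfC : f ∈ C
  · refine hrel f hfC (h.mono (fun q hq => ?_) hrf)
    refine Finset.mem_union_right _ (Finset.mem_erase.2 ⟨?_, ?_⟩)
    · rintro rfl
      exact hcQ q hfC hq
    · simp only [hF, Finset.mem_union, Finset.mem_insert, Finset.mem_biUnion]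
      exact .inr (.inr ⟨⟨f, hfC⟩, by simp, hq⟩)
  · refine (hsep f ((hFN f hf).resolve_left hfC)).2 (h.mono (fun q hq => ?_) hrf)
    refine Finset.mem_union_right _ (Finset.mem_erase.2 ⟨?_, ?_⟩)
    · rintro rfl
      exact hfC hq
    · simp [hF, hq]

theorem good_or_good (h : IsLinkage rel) {a b : ℕ} (hab : a ≠ b) {M : Set ℕ} (hM : M.Infinite)
    (ha : a ∉ M) (hb : b ∉ M) : Good rel a (insert b M) ∨ Good rel b M := by
  by_contra! hcon
  obtain ⟨hna, hnb⟩ := hcon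
  obtain ⟨C, hCM, hbC, hC⟩ : ∃ C : Finset ℕ, (C : Set ℕ) ⊆ M ∧ b ∉ C ∧ ¬ rel C a b := by
    by_contra! hall
    refine hna ⟨insert b M, subset_rfl, hM.mono (Set.subset_insert _ _), b, by simp,
      fun Q hQ hbQ => hall Q (fun q hq => ?_) hbQ⟩
    refine (hQ hq).resolve_left ?_
    rintro rfl
    exact hbQ hq
  have haC : a ∉ C := fun h' => ha (hCM h')
  set N : Set ℕ := {m ∈ M | m ∉ C ∧ rel C a m}
  by_cases hN : N.Infinite
  · obtain ⟨c, hcC, hc⟩ := h.exists_mem_separator (i := b) (j := a) (C := C) (N := insert a N) hbC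
      (by simpa [hab.symm] using fun h' => hb h'.1) (by simp) (by
        rintro n (rfl | ⟨-, hn, hrn⟩)
        · exact ⟨haC, fun h' => hC (h.symm h')⟩
        · exact ⟨hn, fun h' => hC (h.trans hn hrn (h.symm h'))⟩)
    refine hnb ⟨C ∪ N, Set.union_subset hCM fun x hx => hx.1, hN.mono Set.subset_union_right, c,
      .inl hcC, fun Q hQ => hc Q (hQ.trans ?_)⟩
    exact Set.union_subset_union_right _ (Set.subset_insert _ _)
  · have hinf : (M \ (C ∪ N)).Infinite :=
      hM.sdiff (C.finite_toSet.union (Set.not_infinite.1 hN))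
    obtain ⟨c, hcC, hc⟩ := h.exists_mem_separator (i := a) (j := b) (C := C)
      (N := insert b (M \ (C ∪ N))) haC
      (by simpa [hab] using fun h' => absurd h' ha) (by simp) (by
        rintro n (rfl | ⟨hnM, hn⟩)
        · exact ⟨hbC, hC⟩
        · have hnC : n ∉ C := fun h' => hn (.inl h')
          exact ⟨hnC, fun h' => hn (.inr ⟨hnM, hnC, h'⟩)⟩)
    refine hna ⟨C ∪ M \ (C ∪ N), ?_, hinf.mono Set.subset_union_right, c,
      .inl hcC, fun Q hQ => hc Q (hQ.trans ?_)⟩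
    · exact (Set.union_subset hCM Set.sdiff_subset).trans (Set.subset_insert _ _)
    · exact Set.union_subset_union_right _ (Set.subset_insert _ _)

theorem exists_forall_good (h : IsLinkage rel) :
    ∃ (a : ℕ) (M : Set ℕ), M.Infinite ∧ a ∉ M ∧ ∀ M' ⊆ M, M'.Infinite → Good rel a M' := by
  by_cases h0 : ∀ M' ⊆ Set.Ioi 0, M'.Infinite → Good rel 0 M'
  · exact ⟨0, Set.Ioi 0, Set.Ioi_infinite 0, by simp, h0⟩
  push Not at h0
  obtain ⟨M, hM0, hM, hbad⟩ := h0
  obtain ⟨b, hb⟩ := hM.nonempty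
  refine ⟨b, M \ {b}, hM.sdiff (Set.finite_singleton b), by simp, fun M' hM' hinf => ?_⟩
  refine (h.good_or_good (a := 0) (b := b) (hM0 hb).ne hinf (fun h' => ?_)
    fun h' => (hM' h').2 rfl).resolve_left ?_
  · exact lt_irrefl 0 (hM0 (hM' h').1)
  · rintro ⟨N, hN, hN'⟩
    exact hbad ⟨N, hN.trans (Set.insert_subset hb (hM'.trans Set.sdiff_subset)), hN'⟩

theorem exists_extension (h : IsLinkage rel) {a : ℕ} {A : Finset ℕ} {M : Set ℕ} (ha : a ∈ A)
    (hAM : ∀ x ∈ A, x ∉ M) (hgood : Good rel a M) :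
    ∃ M' ⊆ M, M'.Infinite ∧ ∃ b ∈ M, b ∉ M' ∧ ∃ c ∈ A,
      ∀ Q : Finset ℕ, (Q : Set ℕ) ⊆ M' → rel (Q ∪ A.erase c) b c := by
  obtain ⟨N, hNM, hN, b, hb, hrel⟩ := hgood
  refine ⟨N \ {b}, Set.sdiff_subset.trans hNM, hN.sdiff (Set.finite_singleton b), b, hNM hb,
    by simp, ?_⟩
  by_contra! hcon
  choose Q hQ hnrel using hcon
  have key := hrel (A.attach.biUnion fun c => Q c.1 c.2)
    (fun q hq => by
      obtain ⟨c, -, hc⟩ := Finset.mem_biUnion.1 (Finset.mem_coe.1 hq)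
      exact (hQ _ _ hc).1)
    (fun hq => by
      obtain ⟨c, -, hc⟩ := Finset.mem_biUnion.1 hq
      exact (hQ _ _ hc).2 rfl)
  obtain ⟨f, hf, hrf⟩ := h.exchange ha (fun h' => hAM b h' (hNM hb)) (h.symm key)
  refine hnrel f hf (h.mono (Finset.union_subset_union_left fun q hq => ?_) hrf)
  exact Finset.mem_biUnion.2 ⟨⟨f, hf⟩, by simp, hq⟩

/-- There is an infinite tree of indices whose edges survive deleting other indices. -/
theorem exists_tree (h : IsLinkage rel) :
    ∃ g p : ℕ → ℕ, g.Injective ∧ (∀ n, p n ≤ n) ∧ ∀ (n : ℕ) (Q : Finset ℕ), n + 1 ∉ Q →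
      p n ∉ Q → rel (Q.image g) (g (n + 1)) (g (p n)) := by
  obtain ⟨a, M, hM, haM, hgood⟩ := h.exists_forall_good
  let State := {s : Finset ℕ × Set ℕ // a ∈ s.1 ∧ (∀ x ∈ s.1, x ∉ s.2) ∧ s.2.Infinite ∧ s.2 ⊆ M}
  have step (s : State) := h.exists_extension s.2.1 s.2.2.1 (hgood _ s.2.2.2.2 s.2.2.2.1)
  choose M' hM'sub hM'inf b hb hbM' c hc hrel using step
  let next (s : State) : State := ⟨(insert (b s) s.1.1, M' s), by
    refine ⟨Finset.mem_insert_of_mem s.2.1, fun x hx => ?_, hM'inf s,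
      (hM'sub s).trans s.2.2.2.2⟩
    rcases Finset.mem_insert.1 hx with rfl | hx
    · exact hbM' s
    · exact fun h' => s.2.2.1 x hx (hM'sub s h')⟩
  let st (n : ℕ) : State := next^[n] ⟨({a}, M), by simp, by simpa using haM, hM, subset_rfl⟩
  have st_succ (n : ℕ) : st (n + 1) = next (st n) := Function.iterate_succ_apply' _ _ _
  let g (n : ℕ) : ℕ := Nat.casesOn n a fun m => b (st m)
  have hA (n : ℕ) : (st n).1.1 = (Finset.range (n + 1)).image g := by
    induction n with
    | zero => simp [st, g]
    | succ n ih =>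
      rw [Finset.range_add_one, Finset.image_insert, ← ih, st_succ]
  have hManti : Antitone fun n => (st n).1.2 := antitone_nat_of_succ_le fun n => by
    simpa only [st_succ] using hM'sub (st n)
  have hinj : g.Injective := .of_lt_imp_ne fun m n hmn heq => by
    obtain ⟨n, rfl⟩ : ∃ k, n = k + 1 := ⟨n - 1, by omega⟩
    refine (st n).2.2.1 (g m) ?_ (heq ▸ hb (st n))
    rw [hA]
    exact Finset.mem_image_of_mem _ (by simpa using hmn)
  have hc' (n : ℕ) : ∃ p ≤ n, g p = c (st n) := by
    have := hc (st n)
    rw [hA, Finset.mem_image] at this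
    obtain ⟨p, hp, hpc⟩ := this
    exact ⟨p, by simpa [Nat.lt_succ_iff] using hp, hpc⟩
  choose p hp hpc using hc'
  refine ⟨g, p, hinj, hp, fun n Q hnQ hpQ => ?_⟩
  rw [hpc]
  refine h.mono ?_ (hrel (st n) ((Q.filter (n + 1 < ·)).image g) ?_)
  · intro x hx
    obtain ⟨q, hq, rfl⟩ := Finset.mem_image.1 hx
    by_cases hqn : n + 1 < q
    · exact Finset.mem_union_left _ (Finset.mem_image_of_mem _ (by simp [hq, hqn]))
    · have hqn' : q ≠ n + 1 := fun h' => hnQ (h' ▸ hq)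
      refine Finset.mem_union_right _ (Finset.mem_erase.2 ⟨?_, ?_⟩)
      · rw [← hpc]
        exact fun h' => hpQ (hinj h' ▸ hq)
      · rw [hA]
        exact Finset.mem_image_of_mem _ (by simp; omega)
  · intro x hx
    obtain ⟨q, hq, rfl⟩ := Finset.mem_image.1 (Finset.mem_coe.1 hx)
    obtain ⟨q, rfl⟩ : ∃ k, q = k + 1 := ⟨q - 1, by simp at hq; omega⟩
    have : n + 1 ≤ q := by simp at hq; omega
    have h' := hManti this (hb (st q))
    simpa only [st_succ] using h'

/-- There is an infinite sequence of indices such that consecutive ones remain related after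
deleting finitely many others. -/
theorem exists_path (h : IsLinkage rel) :
    ∃ g : ℕ → ℕ, g.Injective ∧ ∀ (k : ℕ) (Q : Finset ℕ), k ∉ Q → k + 1 ∉ Q →
      rel (Q.image g) (g k) (g (k + 1)) := by
  obtain ⟨g, p, hg, hp, hrel⟩ := h.exists_tree
  by_cases hfin : ∀ v, {n | p n = v}.Finite
  · let r (x y : ℕ) : Prop := ∃ m, y = m + 1 ∧ p m = x
    have hzero (n : ℕ) : Relation.ReflTransGen r 0 n := by
      induction n using Nat.strong_induction_on with
      | _ n ih =>
        rcases n with _ | n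
        · exact .refl
        · exact (ih (p n) (by have := hp n; omega)).tail ⟨n, rfl, rfl⟩
    have hchild (v : {v // {n | Relation.ReflTransGen r v n}.Infinite}) :
        ∃ n, p n = v ∧ {m | Relation.ReflTransGen r (n + 1) m}.Infinite := by
      by_contra! hcon
      refine v.2 (((Set.finite_singleton v.1).union ((hfin v.1).biUnion hcon)).subset fun m hm => ?_)
      rcases Relation.ReflTransGen.cases_head hm with rfl | ⟨_, ⟨n, rfl, hn⟩, hnm⟩
      · exact .inl rfl
      · exact .inr (Set.mem_biUnion hn hnm)
    choose child hpc hinf using hchild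
    let e (k : ℕ) : {v // {n | Relation.ReflTransGen r v n}.Infinite} :=
      (fun v => ⟨child v + 1, hinf v⟩)^[k]
        ⟨0, by simpa [hzero] using Set.infinite_univ⟩
    have he (k : ℕ) : (e (k + 1)).1 = child (e k) + 1 :=
      congrArg Subtype.val (Function.iterate_succ_apply' _ _ _)
    have hmono : StrictMono fun k => (e k).1 := strictMono_nat_of_lt_succ fun k => by
      have := hp (child (e k))
      rw [hpc] at this
      rw [he]
      omega
    refine ⟨fun k => g (e k).1, hg.comp hmono.injective, fun k Q h1 h2 => ?_⟩
    have := hrel (child (e k)) (Q.image fun k => (e k).1)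
      (by rw [← he]; simpa [hmono.injective.eq_iff] using h2)
      (by rw [hpc]; simpa [hmono.injective.eq_iff] using h1)
    rw [← he, hpc, Finset.image_image] at this
    exact h.symm this
  · push Not at hfin
    obtain ⟨v, hv⟩ := hfin
    let e := Set.Infinite.natEmbedding _ hv
    have hev (k : ℕ) : p (e k) = v := (e k).2
    have hinj : Function.Injective fun k => (e k : ℕ) + 1 := fun a b hab =>
      e.injective (Subtype.ext (by simpa using hab))
    have hne (k : ℕ) : (e k : ℕ) + 1 ≠ v := by
      have := hp (e k)
      rw [hev] at this
      omega
    refine ⟨fun k => g (e k + 1), hg.comp hinj, fun k Q h1 h2 => ?_⟩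
    have key (i : ℕ) (hi : i ∉ Q) := hrel (e i) (Q.image fun k => (e k : ℕ) + 1)
      (by simpa [Subtype.ext_iff.symm] using hi) (by rw [hev]; simpa using fun x _ => hne x)
    simp only [hev, Finset.image_image] at key
    refine h.trans (j := g v) ?_ (key k h1) (h.symm (key (k + 1) h2))
    simpa [hg.eq_iff] using fun x _ => hne x

end IsLinkage

section Grid

variable {G : SimpleGraph V} {R : ℕ → ℕ → V}

theorem isLinkage_linked (hR : ∀ i, IsRay G (R i))
    (hd : Pairwise fun i j => Disjoint (Set.range (R i)) (Set.range (R j)))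
    (htot : ∀ i j, Linked G ∅ (R i) (R j)) :
    IsLinkage fun Q i j => Linked G (⋃ q ∈ Q, Set.range (R q)) (R i) (R j) where
  total i j := by simpa using htot i j
  symm h := h.symm
  trans {Q i j k} hj h₁ h₂ := by
    refine h₁.trans (hR j) (fun m hm => ?_) h₂
    simp only [Set.mem_iUnion] at hm
    obtain ⟨q, hq, hm⟩ := hm
    exact (hd (show j ≠ q by rintro rfl; exact hj hq)).ne_of_mem (Set.mem_range_self m) hm rfl
  mono hQ h := h.mono (Set.biUnion_subset_biUnion_left hQ)
  exchange hj hi h := by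
    obtain ⟨f, hf, hlink⟩ := h.exists_avoiding hd hj hi
    exact ⟨f, hf, by rwa [Finset.set_biUnion_union]⟩

theorem exists_bound_of_finset (hR : ∀ i, IsRay G (R i))
    (hd : Pairwise fun i j => Disjoint (Set.range (R i)) (Set.range (R j))) (X : Finset V) :
    ∃ N, ∀ q i, R q i ∈ X → i < N := by
  have hinj : Function.Injective fun x : ℕ × ℕ => R x.1 x.2 := by
    rintro ⟨q, i⟩ ⟨q', i'⟩ h
    obtain rfl : q = q' := by
      by_contra hne
      exact (hd hne).ne_of_mem ⟨i, rfl⟩ ⟨i', rfl⟩ h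
    exact Prod.ext rfl ((hR q).1 h)
  obtain ⟨N, hN⟩ := ((X.finite_toSet.preimage hinj.injOn).image Prod.snd).bddAbove
  exact ⟨N + 1, fun q i h => Nat.lt_succ_of_le (hN ⟨(q, i), h, rfl⟩)⟩

/-- A new connected set `X` joining `R k` to `R (k + 1)` by an edge, beyond the `l`-th vertices of
these rays, avoiding `U` and the first few other rays. -/
theorem exists_rung (hR : ∀ i, IsRay G (R i))
    (hd : Pairwise fun i j => Disjoint (Set.range (R i)) (Set.range (R j)))
    (hlink : ∀ (k : ℕ) (Q : Finset ℕ), k ∉ Q → k + 1 ∉ Q →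
      Linked G (⋃ q ∈ Q, Set.range (R q)) (R k) (R (k + 1)))
    (n k : ℕ) (U : Finset V) (l : ℕ) :
    ∃ (X : Finset V) (l' : ℕ), (G.induce (X : Set V)).Connected ∧ Disjoint X U ∧
      (∀ q ≤ n + 1, q ≠ k → ∀ i, R q i ∉ X) ∧ (∀ i, R k i ∈ X → l ≤ i) ∧ (∃ i, R k i ∈ X) ∧
      (∀ q i, R q i ∈ X → i < l') ∧ ∃ i, l ≤ i ∧ i < l' ∧ ∃ x ∈ X, G.Adj x (R (k + 1) i) := by
  classical
  obtain ⟨X, i, hX, hk, hav, hi, hadj⟩ := (hlink k (((Finset.range (n + 2)).erase k).erase (k + 1))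
    (by simp) (by simp)).exists_finset (hd (by simp))
    (U ∪ ((Finset.range l).image (R k) ∪ (Finset.range l).image (R (k + 1))))
  simp only [Finset.mem_union, not_or, Finset.mem_image, Finset.mem_range, not_exists,
    not_and] at hav hi
  obtain ⟨N, hN⟩ := exists_bound_of_finset hR hd X
  refine ⟨X, max N (i + 1), hX, Finset.disjoint_left.2 fun x hx => (hav x hx).1.1,
    fun q hq hqk m hm => ?_, fun m hm => ?_, hk, fun q m hm => lt_max_of_lt_left (hN q m hm),
    i, ?_, lt_max_of_lt_right i.lt_succ_self, hadj⟩
  · by_cases hqk' : q = k + 1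
    · subst hqk'
      exact (hav _ hm).2.2 ⟨m, rfl⟩
    · refine (hav _ hm).2.1 ?_
      simp only [Set.mem_iUnion]
      exact ⟨q, by simp [hqk, hqk']; omega, m, rfl⟩
  · by_contra! hlt
    exact (hav _ hm).1.2.1 m hlt rfl
  · by_contra! hlt
    exact hi.2.2 i hlt rfl

theorem exists_rungs (hR : ∀ i, IsRay G (R i))
    (hd : Pairwise fun i j => Disjoint (Set.range (R i)) (Set.range (R j)))
    (hlink : ∀ (k : ℕ) (Q : Finset ℕ), k ∉ Q → k + 1 ∉ Q →
      Linked G (⋃ q ∈ Q, Set.range (R q)) (R k) (R (k + 1))) (κ : ℕ → ℕ) :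
    ∃ (X : ℕ → Finset V) (l : ℕ → ℕ), ∀ n, (G.induce (X n : Set V)).Connected ∧
      (∀ m < n, Disjoint (X n) (X m)) ∧
      (∀ q ≤ n + 1, q ≠ κ n → ∀ i, R q i ∉ X n) ∧ (∀ i, R (κ n) i ∈ X n → l n ≤ i) ∧
      (∃ i, R (κ n) i ∈ X n) ∧ (∀ q i, R q i ∈ X n → i < l (n + 1)) ∧
      ∃ i, l n ≤ i ∧ i < l (n + 1) ∧ ∃ x ∈ X n, G.Adj x (R (κ n + 1) i) := by
  classical
  choose Y l' hY using exists_rung hR hd hlink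
  let st (n : ℕ) : Finset V × ℕ :=
    Nat.rec (∅, 0) (fun n s => (s.1 ∪ Y n (κ n) s.1 s.2, l' n (κ n) s.1 s.2)) n
  have hmono : Monotone fun n => (st n).1 :=
    monotone_nat_of_le_succ fun n => Finset.subset_union_left
  refine ⟨fun n => Y n (κ n) (st n).1 (st n).2, fun n => (st n).2, fun n => ?_⟩
  obtain ⟨h1, h2, h3⟩ := hY n (κ n) (st n).1 (st n).2
  exact ⟨h1, fun m hm => h2.mono_right
    (Finset.subset_union_right.trans (hmono (Nat.succ_le_of_lt hm))), h3⟩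

theorem hasMinor_gridNN_of_linked (hR : ∀ i, IsRay G (R i))
    (hd : Pairwise fun i j => Disjoint (Set.range (R i)) (Set.range (R j)))
    (hlink : ∀ (k : ℕ) (Q : Finset ℕ), k ∉ Q → k + 1 ∉ Q →
      Linked G (⋃ q ∈ Q, Set.range (R q)) (R k) (R (k + 1))) :
    HasMinor G gridNN := by
  classical
  -- The rung from column `k` to column `k + 1` in row `j` is built at time `τ k j`.
  let τ (k j : ℕ) : ℕ := (k + j) * (k + j) + j
  let κ (n : ℕ) : ℕ := n.sqrt - (n - n.sqrt * n.sqrt)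
  have hκ (k j : ℕ) : κ (τ k j) = k := by
    have : (τ k j).sqrt = k + j := Nat.sqrt_add_eq _ (by omega)
    simp only [κ, this]
    simp only [τ]
    omega
  obtain ⟨X, l, hX⟩ := exists_rungs hR hd hlink κ
  choose hconn hdisj hother hlow hmeet hup y hylow hyup x hx hadj using hX
  have hl : StrictMono l := strictMono_nat_of_lt_succ fun n => (hylow n).trans_lt (hyup n)
  have hXX {m n : ℕ} (hmn : m ≠ n) : Disjoint (X m) (X n) := by
    rcases hmn.lt_or_gt with h | h
    · exact (hdisj n m h).symm
    · exact hdisj m n h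
  -- Row `j` of column `k` starts at time `α k j`.
  let α (k j : ℕ) : ℕ := (k + j - 1) * (k + j - 1) + j
  have hατ (k j : ℕ) : α k j ≤ τ k j :=
    Nat.add_le_add_right (Nat.mul_le_mul (Nat.sub_le _ _) (Nat.sub_le _ _)) _
  have hατ' (k j : ℕ) : α (k + 1) j = τ k j := by
    simp only [α, τ, show k + 1 + j - 1 = k + j by omega]
  have hτα (k j : ℕ) : τ k j < α k (j + 1) := by
    simp only [α, τ, show k + (j + 1) - 1 = k + j by omega]
    omega
  have hα (k : ℕ) : StrictMono (α k) :=
    strictMono_nat_of_lt_succ fun j => (hατ k j).trans_lt (hτα k j)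
  have hτα' (k j : ℕ) : τ k j < α (k + 1) (j + 1) := hατ' k j ▸ hα (k + 1) j.lt_succ_self
  have hα0 (k : ℕ) : k ≤ α k 0 + 1 := by
    simp only [α]
    have := Nat.le_mul_self (k + 0 - 1)
    omega
  let seg (k j : ℕ) : Set ℕ := Set.Ico (l (α k j)) (l (α k (j + 1)))
  have hseg_unique {k j j' i : ℕ} (h : i ∈ seg k j) (h' : i ∈ seg k j') : j = j' := by
    by_contra hne
    rcases Nat.lt_or_gt_of_ne hne with hlt | hlt
    · exact (h.2.trans_le ((hl.monotone ((hα k).monotone hlt)).trans h'.1)).false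
    · exact (h'.2.trans_le ((hl.monotone ((hα k).monotone hlt)).trans h.1)).false
  have hmem_seg {k j i : ℕ} (h : R k i ∈ X (τ k j)) : i ∈ seg k j :=
    ⟨(hl.monotone (hατ k j)).trans (hlow _ i (by rwa [hκ])),
      (hup _ _ _ h).trans_le (hl.monotone (hτα k j))⟩
  have hcross {k j k' j' i : ℕ} (hi : i ∈ seg k j) (h : R k i ∈ X (τ k' j')) :
      (k, j) = (k', j') := by
    have hlt : α k 0 < τ k' j' + 1 := hl.lt_iff_lt.1
      (((hl.monotone ((hα k).monotone j.zero_le)).trans hi.1).trans_lt (hup _ _ _ h))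
    obtain rfl : k = k' := by
      by_contra hne
      exact hother (τ k' j') k (by have := hα0 k; omega) (by rwa [hκ]) i h
    rw [hseg_unique hi (hmem_seg h)]
  have hRR {k k' i i' : ℕ} (h : R k i = R k' i') : k = k' ∧ i = i' := by
    obtain rfl : k = k' := by
      by_contra hne
      exact (hd hne).ne_of_mem ⟨i, rfl⟩ ⟨i', rfl⟩ h
    exact ⟨rfl, (hR k).1 h⟩
  let B (v : ℕ × ℕ) : Set V := R v.1 '' seg v.1 v.2 ∪ X (τ v.1 v.2)
  have hcol (k j : ℕ) : ∃ u ∈ B (k, j), ∃ z ∈ B (k, j + 1), G.Adj u z := by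
    have h1 : l (α k j) < l (α k (j + 1)) := hl (hα k j.lt_succ_self)
    have h2 : l (α k (j + 1)) < l (α k (j + 2)) := hl (hα k (j + 1).lt_succ_self)
    refine ⟨R k (l (α k (j + 1)) - 1), .inl ⟨_, ⟨Nat.le_sub_one_of_lt h1, Nat.sub_one_lt_of_lt h1⟩, rfl⟩,
      R k (l (α k (j + 1)) - 1 + 1), .inl ⟨_, ?_, rfl⟩, (hR k).2 _⟩
    rw [Nat.sub_add_cancel (by omega)]
    exact ⟨le_rfl, h2⟩
  have hrow (k j : ℕ) : ∃ u ∈ B (k, j), ∃ z ∈ B (k + 1, j), G.Adj u z := by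
    refine ⟨x (τ k j), .inr (hx _), R (k + 1) (y (τ k j)), .inl ⟨_, ⟨?_, ?_⟩, rfl⟩, ?_⟩
    · rw [hατ']
      exact hylow _
    · exact (hyup _).trans_le (hl.monotone (hτα' k j))
    · simpa only [hκ] using hadj (τ k j)
  refine ⟨B, fun v => ?_, fun v v' hne => ?_, fun v => ?_, ?_⟩
  · obtain ⟨i, hi⟩ := hmeet (τ v.1 v.2)
    exact ⟨_, .inr hi⟩
  · refine Set.disjoint_left.2 ?_
    rintro _ (⟨i, hi, rfl⟩ | hu) (⟨i', hi', h⟩ | hu')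
    · obtain ⟨hk, rfl⟩ := hRR h
      rw [hk] at hi'
      exact hne (Prod.ext hk.symm (hseg_unique hi hi'))
    · exact hne (hcross hi hu')
    · subst h
      exact hne (hcross hi' hu).symm
    · refine Finset.disjoint_left.1 (hXX fun h => hne ?_) hu hu'
      have hk : v.1 = v'.1 := by rw [← hκ v.1 v.2, h, hκ]
      obtain ⟨i, hi⟩ := hmeet (τ v.1 v.2)
      rw [hκ] at hi
      exact hcross (hmem_seg hi) (h ▸ hi)
  · obtain ⟨i, hi⟩ := hmeet (τ v.1 v.2)
    rw [hκ] at hi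
    exact induce_union_connected
      ((hR v.1).connected_induce_segment (hl (hα v.1 v.2.lt_succ_self))).preconnected
      (hconn _).preconnected ⟨R v.1 i, ⟨i, hmem_seg hi, rfl⟩, hi⟩
  · have hedge (v v' : ℕ × ℕ) (h : (v.1 = v'.1 ∧ v'.2 = v.2 + 1) ∨ (v.2 = v'.2 ∧ v'.1 = v.1 + 1)) :
        ∃ u ∈ B v, ∃ z ∈ B v', G.Adj u z := by
      obtain ⟨k, j⟩ := v
      obtain ⟨k', j'⟩ := v'
      rcases h with ⟨rfl, rfl⟩ | ⟨rfl, rfl⟩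
      · exact hcol k j
      · exact hrow k j
    rintro v v' ⟨-, h | h⟩
    · exact hedge v v' h
    · obtain ⟨u, hu, z, hz, huz⟩ := hedge v' v h
      exact ⟨z, hz, u, hu, huz.symm⟩

end Grid

/-- Halin's grid theorem: every graph with an end of infinite vertex-degree has the
`ℕ × ℕ` grid as a minor. -/
theorem stmt8 {V : Type u} (G : SimpleGraph V) (f : ℕ → V) (hf : IsRay G f)
    (hdeg : ∃ F : ℕ → ℕ → V, (∀ i, IsRay G (F i)) ∧ (∀ i, RayEquiv G (F i) f) ∧
      Pairwise fun i j => Disjoint (Set.range (F i)) (Set.range (F j))) :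
    HasMinor G gridNN := by
  obtain ⟨F, hF, hFf, hd⟩ := hdeg
  obtain ⟨g, hg, hlink⟩ := (isLinkage_linked hF hd fun i j =>
    (hFf i).linked.trans hf (fun _ => id) (hFf j).linked.symm).exists_path
  refine hasMinor_gridNN_of_linked (R := fun k => F (g k)) (fun k => hF (g k))
    (fun i j hij => hd (hg.ne hij)) fun k Q hk hk' => ?_
  simpa only [Finset.set_biUnion_finset_image] using hlink k Q hk hk'
end

section
/- For every ℓ ∈ ℕ and k = 2ℓ + 2, the graph Y(ℓ) = K_{1,3}(ℓ) × ℕ has a unique end, this end has vertex-degree 3ℓ + 1 = (3/2)k − 2, and the [k] × ℕ grid is NOT a minor of Y(ℓ). -/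
open SimpleGraph Cardinal

universe u v

variable {V : Type u}

/-- `K_{1,3}(ℓ)`: the star `K_{1,3}` with each edge subdivided into a path of length `ℓ`.
`none` is the centre; `some (j, m)` is the `(m+1)`-st vertex on branch `j`. -/
def KStarSub (l : ℕ) : SimpleGraph (Option (Fin 3 × Fin l)) :=
  SimpleGraph.fromRel fun a b =>
    (a = none ∧ ∃ (j : Fin 3) (m : Fin l), (m : ℕ) = 0 ∧ b = some (j, m)) ∨
    (∃ (j : Fin 3) (m₁ m₂ : Fin l), a = some (j, m₁) ∧ b = some (j, m₂) ∧
      (m₁ : ℕ) + 1 = (m₂ : ℕ))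

/-- The path graph on `ℕ`. -/
def pathGraphN : SimpleGraph ℕ := SimpleGraph.fromRel fun a b => b = a + 1

/-- `Y(ℓ) = K_{1,3}(ℓ) × ℕ`. -/
def Ygraph (l : ℕ) : SimpleGraph (Option (Fin 3 × Fin l) × ℕ) :=
  (KStarSub l).boxProd pathGraphN

/-- The signed position of a vertex of `K_{1,3}(ℓ)` relative to branch `j`: the distance from the
centre, counted positively on branch `j` and negatively on the two other branches. -/
def branchPos {l : ℕ} (j : Fin 3) : Option (Fin 3 × Fin l) → ℤ
  | none => 0
  | some (i, m) => if i = j then (m : ℤ) + 1 else -((m : ℤ) + 1)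

lemma kStarSub_adj_branchPos {l : ℕ} (j : Fin 3) {a b : Option (Fin 3 × Fin l)}
    (h : (KStarSub l).Adj a b) :
    branchPos j b = branchPos j a + 1 ∨ branchPos j a = branchPos j b + 1 := by
  rw [KStarSub, SimpleGraph.fromRel_adj] at h
  obtain ⟨-, (⟨rfl, i, m, hm, rfl⟩ | ⟨i, m, m', rfl, rfl, hm⟩) |
    (⟨rfl, i, m, hm, rfl⟩ | ⟨i, m, m', rfl, rfl, hm⟩)⟩ := h <;>
  · simp only [branchPos]
    split_ifs <;> omega

lemma branchPos_injOn_nonneg {l : ℕ} (j : Fin 3) {a b : Option (Fin 3 × Fin l)}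
    (h : branchPos j a = branchPos j b) (ha : 0 ≤ branchPos j a) : a = b := by
  rcases a with _ | ⟨i, m⟩ <;> rcases b with _ | ⟨i', m'⟩ <;> simp only [branchPos] at h ha
  · rfl
  · split_ifs at h <;> omega
  · split_ifs at h <;> omega
  · split_ifs at h ha <;> first | omega | skip
    subst_vars
    have : m = m' := by ext; omega
    rw [this]

lemma branchPos_neg_of_pos {l : ℕ} {i j : Fin 3} (hij : i ≠ j) {a : Option (Fin 3 × Fin l)}
    (h : 1 ≤ branchPos i a) : branchPos j a < 0 := by
  rcases a with _ | ⟨i', m'⟩ <;> simp only [branchPos] at h ⊢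
  · omega
  · split_ifs at h with h1
    · rw [if_neg (by rw [h1]; exact hij)]; omega
    · omega

lemma card_branchPos_lt_zero {l : ℕ} (j : Fin 3) :
    (Finset.univ.filter fun t : Option (Fin 3 × Fin l) => branchPos j t < 0).card ≤ 2 * l := by
  calc _ ≤ (((Finset.univ.erase j) ×ˢ (Finset.univ : Finset (Fin l))).image some).card := by
        apply Finset.card_le_card
        rintro (_ | ⟨i, m⟩) h
        · simp [branchPos] at h
        · replace h := (Finset.mem_filter.1 h).2
          simp only [branchPos] at h
          simp only [Finset.mem_image, Finset.mem_product, Finset.mem_erase, Finset.mem_univ,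
            and_true, Option.some.injEq, exists_eq_right]
          rintro rfl
          simp at h
          omega
    _ ≤ ((Finset.univ.erase j) ×ˢ (Finset.univ : Finset (Fin l))).card := Finset.card_image_le
    _ = 2 * l := by simp

lemma card_branchPos_lt_one {l : ℕ} (j : Fin 3) :
    (Finset.univ.filter fun t : Option (Fin 3 × Fin l) => branchPos j t < 1).card ≤ 2 * l + 1 := by
  calc _ ≤ (insert none (Finset.univ.filter
          fun t : Option (Fin 3 × Fin l) => branchPos j t < 0)).card := by
        apply Finset.card_le_card
        intro t h
        simp only [Finset.mem_filter, Finset.mem_univ, true_and, Finset.mem_insert] at h ⊢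
        by_cases h0 : branchPos j t < 0
        · exact Or.inr h0
        · exact Or.inl (branchPos_injOn_nonneg j (b := none) (by change _ = (0 : ℤ); omega)
            (by omega))
    _ ≤ _ := (Finset.card_insert_le _ _).trans (by have := card_branchPos_lt_zero (l := l) j; omega)

lemma pathGraphN_adj {a b : ℕ} : pathGraphN.Adj a b ↔ b = a + 1 ∨ a = b + 1 := by
  rw [pathGraphN, SimpleGraph.fromRel_adj]
  omega

lemma yGraph_adj_cases {l : ℕ} (j : Fin 3) {a b : Option (Fin 3 × Fin l) × ℕ}
    (h : (Ygraph l).Adj a b) :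
    (a.1 = b.1 ∧ (b.2 = a.2 + 1 ∨ a.2 = b.2 + 1)) ∨
    (a.2 = b.2 ∧ (branchPos j b.1 = branchPos j a.1 + 1 ∨
      branchPos j a.1 = branchPos j b.1 + 1)) := by
  rw [Ygraph, SimpleGraph.boxProd_adj] at h
  rcases h with ⟨h, h'⟩ | ⟨h, h'⟩
  · exact Or.inr ⟨h', kStarSub_adj_branchPos j h⟩
  · exact Or.inl ⟨h', pathGraphN_adj.1 h⟩

/-- Indicator of a step between levels `n` and `n + 1` beyond position `p` of branch `j`. -/
def stepCross {l : ℕ} (j : Fin 3) (p : ℤ) (n : ℕ) (a b : Option (Fin 3 × Fin l) × ℕ) : ZMod 2 :=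
  if p < branchPos j a.1 ∧ p < branchPos j b.1 ∧
    ((a.2 = n ∧ b.2 = n + 1) ∨ (a.2 = n + 1 ∧ b.2 = n)) then 1 else 0

/-- The parity of the number of steps of a walk between levels `n` and `n + 1` beyond position `p`
of branch `j`. -/
def crossParity {l : ℕ} (j : Fin 3) (p : ℤ) (n : ℕ) :
    ∀ {u v : Option (Fin 3 × Fin l) × ℕ}, (Ygraph l).Walk u v → ZMod 2
  | _, _, .nil => 0
  | a, _, .cons (v := b) _ w => stepCross j p n a b + crossParity j p n w

lemma crossParity_succ_pos {l : ℕ} (j : Fin 3) (p : ℤ) (n : ℕ)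
    {u v : Option (Fin 3 × Fin l) × ℕ} (w : (Ygraph l).Walk u v)
    (hw : ∀ x ∈ w.support, ¬ (branchPos j x.1 = p + 1 ∧ x.2 = n)) :
    crossParity j p n w = crossParity j (p + 1) n w := by
  induction w with
  | nil => rfl
  | @cons a b c h w ih =>
    simp only [SimpleGraph.Walk.support_cons, List.mem_cons, forall_eq_or_imp] at hw
    rw [crossParity, crossParity, ih hw.2]
    congr 1
    have h1 := hw.1
    have h2 := hw.2 b w.start_mem_support
    unfold stepCross
    congr 1
    rcases yGraph_adj_cases j h with ⟨h3, h4⟩ | ⟨h3, h4⟩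
    · rw [← h3] at h2 ⊢
      apply propext
      omega
    · apply propext
      omega

lemma crossParity_succ_level {l : ℕ} (j : Fin 3) (p : ℤ) (n : ℕ)
    {u v : Option (Fin 3 × Fin l) × ℕ} (w : (Ygraph l).Walk u v)
    (hw : ∀ x ∈ w.support, ¬ (branchPos j x.1 = p ∧ x.2 = n + 1)) :
    crossParity j p n w + crossParity j p (n + 1) w =
      (if p < branchPos j u.1 ∧ u.2 = n + 1 then 1 else 0) +
      (if p < branchPos j v.1 ∧ v.2 = n + 1 then 1 else 0) := by
  induction w with
  | nil => rw [crossParity, crossParity, CharTwo.add_self_eq_zero, CharTwo.add_self_eq_zero]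
  | @cons a b c h w ih =>
    simp only [SimpleGraph.Walk.support_cons, List.mem_cons, forall_eq_or_imp] at hw
    have h1 := hw.1
    have h2 := hw.2 b w.start_mem_support
    have key : stepCross j p n a b + stepCross j p (n + 1) a b =
      (if p < branchPos j a.1 ∧ a.2 = n + 1 then 1 else 0) +
      (if p < branchPos j b.1 ∧ b.2 = n + 1 then 1 else 0) := by
      unfold stepCross
      rcases yGraph_adj_cases j h with ⟨h3, h4⟩ | h3
      · rw [← h3] at h2 ⊢
        split_ifs <;> first | rfl | (exfalso; omega)
      · split_ifs <;> first | rfl | (exfalso; omega)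
    rw [crossParity, crossParity, add_add_add_comm, key, ih hw.2, add_assoc,
      CharTwo.add_cancel_left]

lemma crossParity_eq_levels {l : ℕ} (j : Fin 3) (p : ℤ) (n : ℕ)
    {u v : Option (Fin 3 × Fin l) × ℕ} (w : (Ygraph l).Walk u v)
    (hw : ∀ x ∈ w.support, ¬ (branchPos j x.1 ≤ p ∧ x.2 = n)) :
    crossParity j p n w = (if u.2 ≤ n then 1 else 0) + (if v.2 ≤ n then 1 else 0) := by
  induction w with
  | nil => rw [crossParity, CharTwo.add_self_eq_zero]
  | @cons a b c h w ih =>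
    simp only [SimpleGraph.Walk.support_cons, List.mem_cons, forall_eq_or_imp] at hw
    have h1 := hw.1
    have h2 := hw.2 b w.start_mem_support
    have key : stepCross j p n a b =
      (if a.2 ≤ n then 1 else 0) + (if b.2 ≤ n then 1 else 0) := by
      unfold stepCross
      rcases yGraph_adj_cases j h with ⟨h3, h4⟩ | h3
      · rw [← h3] at h2 ⊢
        split_ifs <;> first | rfl | (exfalso; omega)
      · split_ifs <;> first | rfl | (exfalso; omega)
    rw [crossParity, key, ih hw.2, add_assoc, CharTwo.add_cancel_left]

/-- The crossing parity of a walk, as seen from a vertex of branch `j`, does not change when that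
vertex moves along branch `j` without meeting the walk. -/
lemma crossParity_eq_of_disjoint_walk {l : ℕ} (j : Fin 3) {s : ℤ} (hs : 0 ≤ s)
    {u v : Option (Fin 3 × Fin l) × ℕ} (w : (Ygraph l).Walk u v)
    (hu : branchPos j u.1 ≤ s) (hv : branchPos j v.1 ≤ s)
    {x y : Option (Fin 3 × Fin l) × ℕ} (d : (Ygraph l).Walk x y)
    (hd : ∀ z ∈ d.support, s ≤ branchPos j z.1 ∧ z ∉ w.support) :
    crossParity j (branchPos j x.1) x.2 w = crossParity j (branchPos j y.1) y.2 w := by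
  have avoid : ∀ z : Option (Fin 3 × Fin l) × ℕ, s ≤ branchPos j z.1 ∧ z ∉ w.support →
      ∀ t ∈ w.support, ¬ (branchPos j t.1 = branchPos j z.1 ∧ t.2 = z.2) := by
    rintro z ⟨h1, h2⟩ t ht ⟨h3, h4⟩
    exact h2 (Prod.ext (branchPos_injOn_nonneg j h3 (by omega)) h4 ▸ ht)
  have level : ∀ (p : ℤ) (n : ℕ), s ≤ p →
      (∀ t ∈ w.support, ¬ (branchPos j t.1 = p ∧ t.2 = n + 1)) →
      crossParity j p n w = crossParity j p (n + 1) w := by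
    intro p n hp h
    have := crossParity_succ_level j p n w h
    rwa [if_neg (by omega), if_neg (by omega), add_zero, CharTwo.add_eq_zero] at this
  induction d with
  | nil => rfl
  | @cons a b c h d ih =>
    simp only [SimpleGraph.Walk.support_cons, List.mem_cons, forall_eq_or_imp] at hd
    rw [← ih hd.2]
    have ha := avoid a hd.1
    have hb := avoid b (hd.2 b d.start_mem_support)
    have hb' := (hd.2 b d.start_mem_support).1
    rcases yGraph_adj_cases j h with ⟨h3, h4 | h4⟩ | ⟨h3, h4 | h4⟩
    · rw [h3, h4]; rw [h4] at hb
      exact level _ _ hb' hb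
    · rw [← h3, h4]; rw [h4] at ha
      exact (level _ _ hd.1.1 ha).symm
    · rw [← h3, h4]; rw [h4, ← h3] at hb
      exact crossParity_succ_pos j _ _ w hb
    · rw [h3, h4]; rw [h4, h3] at ha
      exact (crossParity_succ_pos j _ _ w ha).symm

/-- A walk inside `C` along branch `j` from position `s` onwards, whose two ends are at position `s`
and have on their levels vertices of `C` before position `s`. -/
structure IsChord {l : ℕ} (j : Fin 3) (s : ℤ) (C : Set (Option (Fin 3 × Fin l) × ℕ))
    {a b : Option (Fin 3 × Fin l) × ℕ} (w : (Ygraph l).Walk a b) : Prop where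
  start_pos : branchPos j a.1 = s
  end_pos : branchPos j b.1 = s
  support : ∀ x ∈ w.support, x ∈ C ∧ s ≤ branchPos j x.1
  start_exit : ∃ x ∈ C, branchPos j x.1 < s ∧ x.2 = a.2
  end_exit : ∃ x ∈ C, branchPos j x.1 < s ∧ x.2 = b.2

lemma IsChord.reverse {l : ℕ} {j : Fin 3} {s : ℤ} {C : Set (Option (Fin 3 × Fin l) × ℕ)}
    {a b : Option (Fin 3 × Fin l) × ℕ} {w : (Ygraph l).Walk a b} (h : IsChord j s C w) :
    IsChord j s C w.reverse :=
  ⟨h.end_pos, h.start_pos, fun x hx => h.support x (by simpa using hx), h.end_exit, h.start_exit⟩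

/-- A walk inside `C` ending before position `s` either leaves branch `j` for the first time
through position `s`, or, if it crosses level `n` oddly often from position `s` onwards, contains
a chord which does so too. -/
lemma exists_chord_of_walk {l : ℕ} (j : Fin 3) (s : ℤ) (n : ℕ)
    (C : Set (Option (Fin 3 × Fin l) × ℕ)) {u v : Option (Fin 3 × Fin l) × ℕ}
    (w : (Ygraph l).Walk u v) (hC : ∀ x ∈ w.support, x ∈ C) (hv : branchPos j v.1 < s) :
    (branchPos j u.1 < s → crossParity j (s - 1) n w ≠ 0 →
      ∃ a b, ∃ d : (Ygraph l).Walk a b, IsChord j s C d ∧ crossParity j (s - 1) n d ≠ 0) ∧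
    (s ≤ branchPos j u.1 → ∃ b, ∃ d : (Ygraph l).Walk u b,
      (∀ x ∈ d.support, x ∈ C ∧ s ≤ branchPos j x.1) ∧ branchPos j b.1 = s ∧
      (∃ x ∈ C, branchPos j x.1 < s ∧ x.2 = b.2) ∧
      (crossParity j (s - 1) n w = crossParity j (s - 1) n d ∨
        ∃ a b, ∃ d : (Ygraph l).Walk a b,
          IsChord j s C d ∧ crossParity j (s - 1) n d ≠ 0)) := by
  induction w with
  | nil => exact ⟨fun _ h => absurd rfl h, fun h => by omega⟩
  | @cons u t v h w ih =>
    simp only [SimpleGraph.Walk.support_cons, List.mem_cons, forall_eq_or_imp] at hC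
    obtain ⟨ih1, ih2⟩ := ih hC.2 hv
    have htC : t ∈ C := hC.2 t w.start_mem_support
    have hadj := yGraph_adj_cases j h
    have hstep : (branchPos j u.1 < s ∨ branchPos j t.1 < s) →
        crossParity j (s - 1) n (SimpleGraph.Walk.cons h w) = crossParity j (s - 1) n w := by
      intro h1
      rw [crossParity, stepCross, if_neg (by omega), zero_add]
    have hexit : ∀ x y : Option (Fin 3 × Fin l) × ℕ, (Ygraph l).Adj x y → branchPos j x.1 < s →
        s ≤ branchPos j y.1 → branchPos j y.1 = s ∧ x.2 = y.2 := by
      intro x y hxy hx hy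
      rcases yGraph_adj_cases j hxy with ⟨h1, -⟩ | ⟨h1, h2⟩
      · rw [h1] at hx; omega
      · exact ⟨by omega, h1⟩
    constructor
    · intro hu
      rw [hstep (Or.inl hu)]
      intro hne
      rcases lt_or_ge (branchPos j t.1) s with ht | ht
      · exact ih1 ht hne
      · obtain ⟨b, d, hd, hb, hbx, h1 | h1⟩ := ih2 ht
        · have := hexit u t h hu ht
          exact ⟨t, b, d, ⟨this.1, hb, hd, ⟨u, hC.1, hu, this.2⟩, hbx⟩, h1 ▸ hne⟩
        · exact h1
    · intro hu
      rcases lt_or_ge (branchPos j t.1) s with ht | ht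
      · have := hexit t u h.symm ht hu
        refine ⟨u, .nil, by simpa using ⟨hC.1, hu⟩, this.1, ⟨t, htC, ht, this.2⟩, ?_⟩
        rw [hstep (Or.inr ht)]
        by_cases h0 : crossParity j (s - 1) n w = 0
        · exact Or.inl h0
        · exact Or.inr (ih1 ht h0)
      · obtain ⟨b, d, hd, hb, hbx, h1⟩ := ih2 ht
        refine ⟨b, .cons h d, by simpa using ⟨⟨hC.1, hu⟩, fun x y => hd (x, y)⟩, hb, hbx,
          h1.imp_left fun h1 => ?_⟩
        rw [crossParity, crossParity, h1]

/-- Two disjoint walks along branch `j` do not interleave. -/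
lemma levels_eq_of_disjoint_walks {l : ℕ} (j : Fin 3) {s : ℤ} (hs : 0 ≤ s)
    {a b c d : Option (Fin 3 × Fin l) × ℕ} (w : (Ygraph l).Walk a b) (w' : (Ygraph l).Walk c d)
    (ha : branchPos j a.1 = s) (hb : branchPos j b.1 = s)
    (hc : branchPos j c.1 = s) (hd : branchPos j d.1 = s)
    (hw : ∀ x ∈ w.support, s ≤ branchPos j x.1) (hw' : ∀ x ∈ w'.support, s ≤ branchPos j x.1)
    (hdisj : ∀ x ∈ w'.support, x ∉ w.support) :
    ((if a.2 ≤ c.2 then 1 else 0) + (if b.2 ≤ c.2 then 1 else 0) : ZMod 2) =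
      (if a.2 ≤ d.2 then 1 else 0) + (if b.2 ≤ d.2 then 1 else 0) := by
  have key : ∀ y ∈ w'.support, branchPos j y.1 = s → crossParity j s y.2 w =
      (if a.2 ≤ y.2 then 1 else 0) + (if b.2 ≤ y.2 then 1 else 0) := by
    intro y hy hys
    refine crossParity_eq_levels j s y.2 w fun x hx h => hdisj y hy ?_
    have := hw x hx
    have hxy : x = y := Prod.ext (branchPos_injOn_nonneg j (by omega) (by omega)) h.2
    rwa [← hxy]
  have := crossParity_eq_of_disjoint_walk j hs w ha.le hb.le w'
    fun z hz => ⟨hw' z hz, hdisj z hz⟩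
  rwa [hc, hd, key c w'.start_mem_support hc, key d w'.end_mem_support hd] at this

/-- Among disjoint connected sets in `Y(ℓ)` that outnumber the positions before `s` of branch `j`,
one is eventually contained in the part of branch `j` from position `s` onwards. -/
lemma exists_eventually_le_branchPos {l : ℕ} (j : Fin 3) {s : ℤ} (hs : 0 ≤ s) {ι : Type*}
    [Fintype ι] (C : ι → Set (Option (Fin 3 × Fin l) × ℕ))
    (hdisj : Pairwise fun i i' => Disjoint (C i) (C i'))
    (hconn : ∀ i, ∀ u ∈ C i, ∀ v ∈ C i, ∃ w : (Ygraph l).Walk u v, ∀ x ∈ w.support, x ∈ C i)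
    (hcard : (Finset.univ.filter fun t : Option (Fin 3 × Fin l) => branchPos j t < s).card <
      Fintype.card ι) :
    ∃ i, ∃ N : ℕ, ∀ v ∈ C i, N ≤ v.2 → s ≤ branchPos j v.1 := by
  by_contra! hcon
  have disj : ∀ {i i' x}, x ∈ C i → x ∈ C i' → i = i' := by
    intro i i' x h h'
    by_contra hne
    exact Set.disjoint_left.1 (hdisj hne) h h'
  have havoid : ∀ n : ℕ, ∃ i, ∀ v ∈ C i, v.2 = n → s ≤ branchPos j v.1 := by
    intro n
    by_contra! h
    choose f hf hfn hfs using h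
    refine hcard.not_ge (Finset.card_le_card_of_injOn (fun i => (f i).1) ?_ ?_)
    · intro i _
      simpa using hfs i
    · intro i _ i' _ h
      have : f i = f i' := Prod.ext h ((hfn i).trans (hfn i').symm)
      exact disj (hf i) (this ▸ hf i')
  choose u hu _ hus using fun i => hcon i 0
  obtain ⟨N, hN⟩ : ∃ N, ∀ i, (u i).2 ≤ N :=
    ⟨Finset.univ.sup fun i => (u i).2, fun i => Finset.le_sup (f := fun i => (u i).2) (by simp)⟩
  have hchord : ∀ n, N ≤ n → ∀ i, (∀ v ∈ C i, v.2 = n → s ≤ branchPos j v.1) →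
      ∃ a b, ∃ d : (Ygraph l).Walk a b, IsChord j s (C i) d ∧ a.2 ≤ n ∧ n < b.2 := by
    intro n hn i hi
    obtain ⟨v, hv, hvn, hvs⟩ := hcon i (n + 1)
    obtain ⟨w, hw⟩ := hconn i (u i) (hu i) v hv
    have hcross : crossParity j (s - 1) n w ≠ 0 := by
      rw [crossParity_eq_levels j (s - 1) n w, if_pos ((hN i).trans hn), if_neg (by omega)]
      · decide
      · rintro x hx ⟨h1, h2⟩
        have := hi x (hw x hx) h2
        omega
    obtain ⟨a, b, d, hd, hd'⟩ := (exists_chord_of_walk j s n (C i) w hw hvs).1 (hus i) hcross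
    rw [crossParity_eq_levels j (s - 1) n d fun x hx h => by
      have := (hd.support x hx).2
      omega] at hd'
    rcases le_or_gt a.2 n with ha | ha <;> rcases le_or_gt b.2 n with hb | hb
    · rw [if_pos ha, if_pos hb] at hd'
      exact absurd (by decide) hd'
    · exact ⟨a, b, d, hd, ha, hb⟩
    · exact ⟨b, a, d.reverse, hd.reverse, hb, ha⟩
    · rw [if_neg ha.not_ge, if_neg hb.not_ge] at hd'
      exact absurd (by decide) hd'
  have hdescent : ∀ (n : ℕ) (i : ι) (a b : Option (Fin 3 × Fin l) × ℕ)
      (d : (Ygraph l).Walk a b), IsChord j s (C i) d → a.2 = n → a.2 ≤ b.2 → N ≤ b.2 → False := by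
    intro n
    induction n using Nat.strong_induction_on with
    | _ n ih =>
      intro i a b d hd han hab hb
      obtain ⟨i', hi'⟩ := havoid b.2
      obtain ⟨x, hxC, hxs, hxb⟩ := hd.end_exit
      have hne : i' ≠ i := by
        rintro rfl
        have := hi' x hxC hxb
        omega
      obtain ⟨a', b', d', hd', ha', hb'⟩ := hchord b.2 hb i' hi'
      have hsup : ∀ x ∈ d.support, x ∉ d'.support := fun x hx hx' =>
        hne (disj (hd'.support x hx').1 (hd.support x hx).1)
      have := levels_eq_of_disjoint_walks j hs d' d hd'.start_pos hd'.end_pos hd.start_pos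
        hd.end_pos (fun x hx => (hd'.support x hx).2) (fun x hx => (hd.support x hx).2) hsup
      rw [if_neg (show ¬ b'.2 ≤ a.2 by omega), if_neg (show ¬ b'.2 ≤ b.2 by omega),
        if_pos ha'] at this
      have hle : a'.2 ≤ a.2 := by
        by_contra h
        rw [if_neg h] at this
        exact absurd this (by decide)
      have hlt : a'.2 ≠ a.2 := by
        intro h
        have haa : a' = a := Prod.ext (branchPos_injOn_nonneg j
          (hd'.start_pos.trans hd.start_pos.symm) (by rw [hd'.start_pos]; exact hs)) h
        subst haa
        exact hsup _ d.start_mem_support d'.start_mem_support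
      exact ih a'.2 (by omega) i' a' b' d' hd' rfl (by omega) (by omega)
  obtain ⟨i, hi⟩ := havoid N
  obtain ⟨a, b, d, hd, ha, hb⟩ := hchord N le_rfl i hi
  exact hdescent _ i a b d hd rfl (by omega) hb.le

/-- Two disjoint sets cannot both contain vertices from which arbitrarily high vertices over the
centre can be reached along branch `j`. -/
lemma not_disjoint_of_unbounded_exits {l : ℕ} (j : Fin 3)
    {A E : Set (Option (Fin 3 × Fin l) × ℕ)} (hAE : Disjoint A E)
    {p q : Option (Fin 3 × Fin l) × ℕ}
    (hp : ∀ N : ℕ, ∃ x, N ≤ x.2 ∧ branchPos j x.1 = 0 ∧ ∃ w : (Ygraph l).Walk p x,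
      ∀ y ∈ w.support, y ∈ A ∧ 0 ≤ branchPos j y.1)
    (hq : ∀ N : ℕ, ∃ x, N ≤ x.2 ∧ branchPos j x.1 = 0 ∧ ∃ w : (Ygraph l).Walk q x,
      ∀ y ∈ w.support, y ∈ E ∧ 0 ≤ branchPos j y.1) : False := by
  obtain ⟨x₁, -, hx₁, w₁, hw₁⟩ := hp 0
  obtain ⟨y₁, hy₁, hy₁', v₁, hv₁⟩ := hq (x₁.2 + 1)
  obtain ⟨x₂, hx₂, hx₂', w₂, hw₂⟩ := hp (y₁.2 + 1)
  obtain ⟨y₂, hy₂, hy₂', v₂, hv₂⟩ := hq (x₂.2 + 1)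
  have hw : ∀ y ∈ (w₁.reverse.append w₂).support, y ∈ A ∧ 0 ≤ branchPos j y.1 := by
    intro y hy
    rw [SimpleGraph.Walk.mem_support_append_iff, SimpleGraph.Walk.support_reverse,
      List.mem_reverse] at hy
    exact hy.elim (hw₁ y) (hw₂ y)
  have hv : ∀ y ∈ (v₁.reverse.append v₂).support, y ∈ E ∧ 0 ≤ branchPos j y.1 := by
    intro y hy
    rw [SimpleGraph.Walk.mem_support_append_iff, SimpleGraph.Walk.support_reverse,
      List.mem_reverse] at hy
    exact hy.elim (hv₁ y) (hv₂ y)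
  have := levels_eq_of_disjoint_walks j le_rfl (w₁.reverse.append w₂) (v₁.reverse.append v₂)
    hx₁ hx₂' hy₁' hy₂' (fun y hy => (hw y hy).2) (fun y hy => (hv y hy).2)
    fun y hy hy' => Set.disjoint_left.1 hAE (hw y hy').1 (hv y hy).1
  rw [if_pos (by omega), if_neg (by omega), if_pos (by omega), if_pos (by omega)] at this
  exact absurd this (by decide)

/-- `u` and `v` are joined by a walk inside `S`. -/
def LinkedIn (G : SimpleGraph V) (S : Set V) (u v : V) : Prop :=
  ∃ w : G.Walk u v, ∀ x ∈ w.support, x ∈ S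

lemma LinkedIn.refl {G : SimpleGraph V} {S : Set V} {u : V} (h : u ∈ S) : LinkedIn G S u u :=
  ⟨.nil, by simpa using h⟩

lemma LinkedIn.symm {G : SimpleGraph V} {S : Set V} {u v : V} (h : LinkedIn G S u v) :
    LinkedIn G S v u := by
  obtain ⟨w, hw⟩ := h
  exact ⟨w.reverse, fun x hx => hw x (by simpa using hx)⟩

lemma LinkedIn.trans {G : SimpleGraph V} {S : Set V} {u v t : V} (h : LinkedIn G S u v)
    (h' : LinkedIn G S v t) : LinkedIn G S u t := by
  obtain ⟨w, hw⟩ := h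
  obtain ⟨w', hw'⟩ := h'
  exact ⟨w.append w', fun x hx => (SimpleGraph.Walk.mem_support_append_iff _ _ |>.1 hx).elim
    (hw x) (hw' x)⟩

lemma LinkedIn.mono {G : SimpleGraph V} {S T : Set V} {u v : V} (hST : S ⊆ T)
    (h : LinkedIn G S u v) : LinkedIn G T u v := by
  obtain ⟨w, hw⟩ := h
  exact ⟨w, fun x hx => hST (hw x hx)⟩

lemma LinkedIn.of_adj {G : SimpleGraph V} {S : Set V} {u v : V} (h : G.Adj u v) (hu : u ∈ S)
    (hv : v ∈ S) : LinkedIn G S u v :=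
  ⟨.cons h .nil, by simpa using ⟨hu, hv⟩⟩

lemma linkedIn_of_induce_connected {G : SimpleGraph V} {S : Set V} (h : (G.induce S).Connected)
    {u v : V} (hu : u ∈ S) (hv : v ∈ S) : LinkedIn G S u v := by
  obtain ⟨w⟩ := h.preconnected ⟨u, hu⟩ ⟨v, hv⟩
  refine ⟨w.map (SimpleGraph.Embedding.induce S).toHom, fun x hx => ?_⟩
  obtain ⟨y, -, rfl⟩ := List.mem_map.1 ((SimpleGraph.Walk.support_map _ _) ▸ hx)
  exact y.2

lemma gridN_adj_right {k : ℕ} (i : Fin k) (m : ℕ) : (gridN k).Adj (i, m) (i, m + 1) := by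
  rw [gridN, SimpleGraph.fromRel_adj]
  simp

lemma gridN_adj_up {k : ℕ} {i i' : Fin k} (h : (i' : ℕ) = i + 1) (m : ℕ) :
    (gridN k).Adj (i, m) (i', m) := by
  rw [gridN, SimpleGraph.fromRel_adj]
  refine ⟨fun h' => ?_, Or.inl (Or.inr ⟨rfl, h⟩)⟩
  rw [Prod.mk.injEq] at h'
  rw [h'.1] at h
  omega

/-- The union of the sets `B (i, m)` over `lo ≤ i < hi` and `n ≤ m`. -/
def gridPart {k : ℕ} (B : Fin k × ℕ → Set V) (lo hi n : ℕ) : Set V :=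
  {v | ∃ (i : Fin k) (m : ℕ), lo ≤ i ∧ (i : ℕ) < hi ∧ n ≤ m ∧ v ∈ B (i, m)}

lemma gridPart_mono {k : ℕ} (B : Fin k × ℕ → Set V) {lo hi lo' hi' n n' : ℕ} (h : lo' ≤ lo)
    (h' : hi ≤ hi') (hn : n' ≤ n) : gridPart B lo hi n ⊆ gridPart B lo' hi' n' := by
  rintro v ⟨i, m, h1, h2, h3, h4⟩
  exact ⟨i, m, by omega, by omega, by omega, h4⟩

lemma gridPart_disjoint {k : ℕ} {B : Fin k × ℕ → Set V}
    (hdisj : Pairwise fun w w' => Disjoint (B w) (B w')) {lo hi lo' hi' n n' : ℕ}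
    (h : hi ≤ lo') : Disjoint (gridPart B lo hi n) (gridPart B lo' hi' n') := by
  rw [Set.disjoint_left]
  rintro v ⟨i, m, h1, h2, h3, h4⟩ ⟨i', m', h1', h2', h3', h4'⟩
  refine Set.disjoint_left.1 (hdisj (i := (i, m)) (j := (i', m')) fun h => ?_) h4 h4'
  rw [Prod.mk.injEq] at h
  rw [h.1] at h2
  omega

lemma gridPart_linkedIn {k : ℕ} {G : SimpleGraph V} {B : Fin k × ℕ → Set V}
    (hne : ∀ w, (B w).Nonempty) (hconn : ∀ w, (G.induce (B w)).Connected)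
    (hadj : ∀ ⦃w w'⦄, (gridN k).Adj w w' → ∃ u ∈ B w, ∃ x ∈ B w', G.Adj u x)
    {lo hi n : ℕ} {u v : V} (hu : u ∈ gridPart B lo hi n) (hv : v ∈ gridPart B lo hi n) :
    LinkedIn G (gridPart B lo hi n) u v := by
  have hstep : ∀ (i i' : Fin k) (m m' : ℕ), (gridN k).Adj (i, m) (i', m') →
      B (i, m) ⊆ gridPart B lo hi n → B (i', m') ⊆ gridPart B lo hi n →
      ∀ u ∈ B (i, m), ∀ v ∈ B (i', m'), LinkedIn G (gridPart B lo hi n) u v := by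
    intro i i' m m' h hi hi' u hu v hv
    obtain ⟨x, hx, y, hy, hxy⟩ := hadj h
    exact ((linkedIn_of_induce_connected (hconn _) hu hx).mono hi).trans
      ((LinkedIn.of_adj hxy (hi hx) (hi' hy)).trans
        ((linkedIn_of_induce_connected (hconn _) hy hv).mono hi'))
  have hsub : ∀ (i : Fin k) (m : ℕ), lo ≤ i → (i : ℕ) < hi → n ≤ m →
      B (i, m) ⊆ gridPart B lo hi n := fun i m h1 h2 h3 v hv => ⟨i, m, h1, h2, h3, hv⟩
  have hcol : ∀ (i : Fin k), lo ≤ i → (i : ℕ) < hi → ∀ d, ∀ u ∈ B (i, n), ∀ v ∈ B (i, n + d),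
      LinkedIn G (gridPart B lo hi n) u v := by
    intro i h1 h2 d
    induction d with
    | zero =>
      intro u hu v hv
      exact (linkedIn_of_induce_connected (hconn _) hu hv).mono (hsub i n h1 h2 le_rfl)
    | succ d ih =>
      intro u hu v hv
      obtain ⟨t, ht⟩ := hne (i, n + d)
      exact (ih u hu t ht).trans (hstep i i _ _ (gridN_adj_right i (n + d))
        (hsub i _ h1 h2 (by omega)) (hsub i _ h1 h2 (by omega)) t ht v hv)
  have hrow : ∀ d, ∀ i i' : Fin k, lo ≤ i → (i' : ℕ) < hi → (i' : ℕ) = i + d →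
      ∀ u ∈ B (i, n), ∀ v ∈ B (i', n), LinkedIn G (gridPart B lo hi n) u v := by
    intro d
    induction d with
    | zero =>
      intro i i' h1 h2 h3 u hu v hv
      obtain rfl : i' = i := Fin.ext (by omega)
      exact (linkedIn_of_induce_connected (hconn _) hu hv).mono (hsub i' n h1 h2 le_rfl)
    | succ d ih =>
      intro i i' h1 h2 h3 u hu v hv
      have hlt : (i : ℕ) + d < k := by omega
      obtain ⟨t, ht⟩ := hne (⟨i + d, hlt⟩, n)
      refine (ih i ⟨i + d, hlt⟩ h1 (by simp only; omega) rfl u hu t ht).trans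
        (hstep _ i' _ _ (gridN_adj_up (by simp only; omega) n) (hsub _ _ (by simp only; omega)
          (by simp only; omega) le_rfl) (hsub i' _ (by omega) h2 le_rfl) t ht v hv)
  obtain ⟨i, m, h1, h2, h3, h4⟩ := hu
  obtain ⟨i', m', h1', h2', h3', h4'⟩ := hv
  obtain ⟨x, hx⟩ := hne (i, n)
  obtain ⟨y, hy⟩ := hne (i', n)
  have hux := hcol i h1 h2 (m - n) x hx u (by rwa [Nat.add_sub_cancel' h3])
  have hvy := hcol i' h1' h2' (m' - n) y hy v (by rwa [Nat.add_sub_cancel' h3'])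
  refine hux.symm.trans (LinkedIn.trans ?_ hvy)
  rcases le_total (i : ℕ) i' with h | h
  · exact hrow (i' - i) i i' h1 h2' (by omega) x hx y hy
  · exact (hrow (i - i') i' i h1' h2 (by omega) y hy x hx).symm

/-- Far out in the grid, all branch sets of a grid minor lie on high levels. -/
lemma exists_row_le_level {l k : ℕ} {B : Fin k × ℕ → Set (Option (Fin 3 × Fin l) × ℕ)}
    (hdisj : Pairwise fun w w' => Disjoint (B w) (B w')) (N : ℕ) :
    ∃ n, ∀ i m, n ≤ m → ∀ v ∈ B (i, m), N ≤ v.2 := by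
  have hv : ∀ v : Option (Fin 3 × Fin l) × ℕ, ∃ n, ∀ i m, v ∈ B (i, m) → m < n := by
    intro v
    by_cases h : ∃ i m, v ∈ B (i, m)
    · obtain ⟨i, m, h⟩ := h
      refine ⟨m + 1, fun i' m' h' => ?_⟩
      by_contra hm
      refine Set.disjoint_left.1 (hdisj (i := (i, m)) (j := (i', m')) fun h => ?_) h h'
      rw [Prod.mk.injEq] at h
      omega
    · push Not at h
      exact ⟨0, fun i m h' => absurd h' (h i m)⟩
  choose f hf using hv
  refine ⟨((Finset.univ : Finset (Option (Fin 3 × Fin l))) ×ˢ Finset.range N).sup f,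
    fun i m hm v hvB => ?_⟩
  by_contra hlt
  have h1 : f v ≤ ((Finset.univ : Finset (Option (Fin 3 × Fin l))) ×ˢ Finset.range N).sup f :=
    Finset.le_sup (by simpa using hlt)
  have := hf v i m hvB
  omega

/-- If, in a block of columns of a grid minor, some column `z` eventually lies on branch `j` or the
centre, and some column `q` eventually does not, then `z` reaches arbitrarily high vertices over the
centre along branch `j` inside the block. -/
lemma exists_unbounded_exits {l k : ℕ} (j : Fin 3)
    {B : Fin k × ℕ → Set (Option (Fin 3 × Fin l) × ℕ)} (hne : ∀ w, (B w).Nonempty)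
    (hdisj : Pairwise fun w w' => Disjoint (B w) (B w'))
    (hconn : ∀ w, ((Ygraph l).induce (B w)).Connected)
    (hadj : ∀ ⦃w w'⦄, (gridN k).Adj w w' → ∃ u ∈ B w, ∃ x ∈ B w', (Ygraph l).Adj u x)
    {lo hi : ℕ} {z q : Fin k} (hz : lo ≤ z) (hz' : (z : ℕ) < hi) (hq : lo ≤ q)
    (hq' : (q : ℕ) < hi)
    (hzpos : ∃ N : ℕ, ∀ m, ∀ v ∈ B (z, m), N ≤ v.2 → 0 ≤ branchPos j v.1)
    (hqneg : ∃ N : ℕ, ∀ m, ∀ v ∈ B (q, m), N ≤ v.2 → branchPos j v.1 < 0) :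
    ∃ p, ∀ N : ℕ, ∃ x, N ≤ x.2 ∧ branchPos j x.1 = 0 ∧ ∃ w : (Ygraph l).Walk p x,
      ∀ y ∈ w.support, y ∈ gridPart B lo hi 0 ∧ 0 ≤ branchPos j y.1 := by
  obtain ⟨N₁, hN₁⟩ := hzpos
  obtain ⟨N₂, hN₂⟩ := hqneg
  obtain ⟨n₁, hn₁⟩ := exists_row_le_level hdisj N₁
  obtain ⟨p, hp⟩ := hne (z, n₁)
  refine ⟨p, fun N => ?_⟩
  obtain ⟨n₂, hn₂⟩ := exists_row_le_level hdisj (max N N₂)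
  obtain ⟨t, ht⟩ := hne (z, max n₁ n₂)
  obtain ⟨r, hr⟩ := hne (q, n₂)
  obtain ⟨w, hw⟩ := gridPart_linkedIn hne hconn hadj (lo := z) (hi := z + 1) (n := n₁)
    ⟨z, n₁, le_rfl, by omega, le_rfl, hp⟩
    ⟨z, max n₁ n₂, le_rfl, by omega, le_max_left _ _, ht⟩
  have hcol : ∀ x ∈ gridPart B z (z + 1) n₁, 0 ≤ branchPos j x.1 := by
    rintro x ⟨i, m, h1, h2, h3, h4⟩
    obtain rfl : i = z := Fin.ext (by omega)
    exact hN₁ m x h4 (hn₁ _ m h3 x h4)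
  obtain ⟨w', hw'⟩ := gridPart_linkedIn hne hconn hadj (lo := lo) (hi := hi) (n := n₂)
    ⟨z, max n₁ n₂, hz, hz', le_max_right _ _, ht⟩ ⟨q, n₂, hq, hq', le_rfl, hr⟩
  obtain ⟨x, d, hd, hx, -, -⟩ := (exists_chord_of_walk j 0 0 _ w' hw' (hN₂ n₂ r hr
    ((le_max_right _ _).trans (hn₂ q n₂ le_rfl r hr)))).2 (hcol t (hw t w.end_mem_support))
  refine ⟨x, ?_, hx, w.append d, fun y hy => ?_⟩
  · obtain ⟨i, m, -, -, h3, h4⟩ := (hd x d.end_mem_support).1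
    exact (le_max_left _ _).trans (hn₂ i m h3 x h4)
  · rw [SimpleGraph.Walk.mem_support_append_iff] at hy
    rcases hy with hy | hy
    · exact ⟨gridPart_mono B hz hz' (Nat.zero_le _) (hw y hy), hcol y (hw y hy)⟩
    · exact ⟨gridPart_mono B le_rfl le_rfl (Nat.zero_le _) (hd y hy).1, (hd y hy).2⟩

/-- In a model of the `[2ℓ + 2] × ℕ` grid in `Y(ℓ)`, some column is eventually contained in the
interior of branch `j`, and another one in branch `j` together with the centre. -/
lemma exists_columns_eventually_in_branch {l : ℕ} (j : Fin 3)
    {B : Fin (2 * l + 2) × ℕ → Set (Option (Fin 3 × Fin l) × ℕ)} (hne : ∀ w, (B w).Nonempty)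
    (hdisj : Pairwise fun w w' => Disjoint (B w) (B w'))
    (hconn : ∀ w, ((Ygraph l).induce (B w)).Connected)
    (hadj : ∀ ⦃w w'⦄, (gridN (2 * l + 2)).Adj w w' → ∃ u ∈ B w, ∃ x ∈ B w', (Ygraph l).Adj u x) :
    ∃ b z : Fin (2 * l + 2), b ≠ z ∧
      (∃ N : ℕ, ∀ m, ∀ v ∈ B (b, m), N ≤ v.2 → 1 ≤ branchPos j v.1) ∧
      (∃ N : ℕ, ∀ m, ∀ v ∈ B (z, m), N ≤ v.2 → 0 ≤ branchPos j v.1) := by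
  have hd : Pairwise fun i i' : Fin (2 * l + 2) =>
      Disjoint (gridPart B i (i + 1) 0) (gridPart B i' (i' + 1) 0) := by
    intro i i' h
    rcases lt_or_gt_of_ne h with h | h
    · exact gridPart_disjoint hdisj (by omega)
    · exact (gridPart_disjoint hdisj (by omega)).symm
  obtain ⟨b, N, hb⟩ := exists_eventually_le_branchPos j zero_le_one
    (fun i : Fin (2 * l + 2) => gridPart B i (i + 1) 0) hd
    (fun i u hu v hv => gridPart_linkedIn hne hconn hadj hu hv)
    (by rw [Fintype.card_fin]; have := card_branchPos_lt_one (l := l) j; omega)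
  obtain ⟨z, N', hz⟩ := exists_eventually_le_branchPos j le_rfl
    (fun i : {i : Fin (2 * l + 2) // i ≠ b} => gridPart B i (i + 1) 0)
    (fun i i' h => hd fun h' => h (Subtype.ext h'))
    (fun i u hu v hv => gridPart_linkedIn hne hconn hadj hu hv)
    (by
      rw [Fintype.card_subtype_compl, Fintype.card_fin, Fintype.card_subtype_eq]
      have := card_branchPos_lt_zero (l := l) j
      omega)
  exact ⟨b, z, z.2.symm,
    ⟨N, fun m v hv => hb v ⟨b, m, le_rfl, by omega, Nat.zero_le _, hv⟩⟩,
    ⟨N', fun m v hv => hz v ⟨z, m, le_rfl, by omega, Nat.zero_le _, hv⟩⟩⟩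

/-- The `[2ℓ + 2] × ℕ` grid is not a minor of `Y(ℓ)`. -/
lemma not_hasMinor_gridN (l : ℕ) : ¬ HasMinor (Ygraph l) (gridN (2 * l + 2)) := by
  rintro ⟨B, hne, hdisj, hconn, hadj⟩
  choose b z hbz hb hz using fun j =>
    exists_columns_eventually_in_branch j hne hdisj hconn hadj
  have hneg : ∀ i j, i ≠ j → ∃ N : ℕ, ∀ m, ∀ v ∈ B (b i, m), N ≤ v.2 → branchPos j v.1 < 0 := by
    intro i j hij
    obtain ⟨N, hN⟩ := hb i
    exact ⟨N, fun m v hv h => branchPos_neg_of_pos hij (hN m v hv h)⟩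
  have hbpos : ∀ j, ∃ N : ℕ, ∀ m, ∀ v ∈ B (b j, m), N ≤ v.2 → 0 ≤ branchPos j v.1 := by
    intro j
    obtain ⟨N, hN⟩ := hb j
    exact ⟨N, fun m v hv h => zero_le_one.trans (hN m v hv h)⟩
  have hbne : ∀ i j, i ≠ j → b i ≠ b j := by
    intro i j hij h
    obtain ⟨N, hN⟩ := hneg i j hij
    obtain ⟨N', hN'⟩ := hbpos j
    obtain ⟨n, hn⟩ := exists_row_le_level hdisj (max N N')
    obtain ⟨v, hv⟩ := hne (b j, n)
    have hv' := hn _ n le_rfl v hv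
    have h1 := hN n v (h ▸ hv) ((le_max_left _ _).trans hv')
    have h2 := hN' n v hv ((le_max_right _ _).trans hv')
    omega
  have hsplit : ∀ (j : Fin 3) (c : ℕ) (z p q s : Fin (2 * l + 2)), (z : ℕ) < c → c ≤ p →
      (q : ℕ) < c → c ≤ s →
      (∃ N : ℕ, ∀ m, ∀ v ∈ B (z, m), N ≤ v.2 → 0 ≤ branchPos j v.1) →
      (∃ N : ℕ, ∀ m, ∀ v ∈ B (p, m), N ≤ v.2 → 0 ≤ branchPos j v.1) →
      (∃ N : ℕ, ∀ m, ∀ v ∈ B (q, m), N ≤ v.2 → branchPos j v.1 < 0) →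
      (∃ N : ℕ, ∀ m, ∀ v ∈ B (s, m), N ≤ v.2 → branchPos j v.1 < 0) → False := by
    intro j c z p q s hzc hpc hqc hsc hz hp hq hs
    obtain ⟨x, hx⟩ := exists_unbounded_exits j hne hdisj hconn hadj (Nat.zero_le _) hzc
      (Nat.zero_le _) hqc hz hq
    obtain ⟨y, hy⟩ := exists_unbounded_exits j hne hdisj hconn hadj hpc p.2 hsc s.2 hp hs
    exact not_disjoint_of_unbounded_exits j (gridPart_disjoint hdisj le_rfl) hx hy
  have hmid : ∀ i j k : Fin 3, i ≠ j → k ≠ j → b i < b j → b j < b k → False := by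
    intro i j k hij hkj h1 h2
    rcases lt_or_gt_of_ne (hbz j) with h | h
    · exact hsplit j (b j + 1) (b j) (z j) (b i) (b k) (by omega) (by omega) (by omega) (by omega)
        (hbpos j) (hz j) (hneg i j hij) (hneg k j hkj)
    · exact hsplit j (b j) (z j) (b j) (b i) (b k) (by omega) (by omega) (by omega) (by omega)
        (hz j) (hbpos j) (hneg i j hij) (hneg k j hkj)
  have h01 := hbne 0 1 (by decide)
  have h02 := hbne 0 2 (by decide)
  have h12 := hbne 1 2 (by decide)
  rcases lt_or_gt_of_ne h01 with h | h <;> rcases lt_or_gt_of_ne h02 with h' | h' <;>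
    rcases lt_or_gt_of_ne h12 with h'' | h'' <;>
  first
  | exact hmid 0 1 2 (by decide) (by decide) ‹_› ‹_›
  | exact hmid 2 1 0 (by decide) (by decide) ‹_› ‹_›
  | exact hmid 1 0 2 (by decide) (by decide) ‹_› ‹_›
  | exact hmid 2 0 1 (by decide) (by decide) ‹_› ‹_›
  | exact hmid 0 2 1 (by decide) (by decide) ‹_› ‹_›
  | exact hmid 1 2 0 (by decide) (by decide) ‹_› ‹_›

lemma yGraph_adj_level {l : ℕ} (t : Option (Fin 3 × Fin l)) (n : ℕ) :
    (Ygraph l).Adj (t, n) (t, n + 1) := by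
  rw [Ygraph, SimpleGraph.boxProd_adj]
  exact Or.inr ⟨pathGraphN_adj.2 (Or.inl rfl), rfl⟩

lemma kStarSub_reachable_none {l : ℕ} (t : Option (Fin 3 × Fin l)) :
    (KStarSub l).Reachable t none := by
  rcases t with _ | ⟨i, m, hm⟩
  · rfl
  · induction m with
    | zero =>
      refine SimpleGraph.Adj.reachable (SimpleGraph.Adj.symm ?_)
      rw [KStarSub, SimpleGraph.fromRel_adj]
      exact ⟨by simp, Or.inl (Or.inl ⟨rfl, i, _, rfl, rfl⟩)⟩
    | succ m ih =>
      refine (SimpleGraph.Adj.reachable (SimpleGraph.Adj.symm ?_)).trans (ih (by omega))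
      rw [KStarSub, SimpleGraph.fromRel_adj]
      exact ⟨by simp, Or.inl (Or.inr ⟨i, _, _, rfl, rfl, rfl⟩)⟩

lemma yGraph_linkedIn_level {l : ℕ} {S : Set (Option (Fin 3 × Fin l) × ℕ)} {n : ℕ}
    (hS : ∀ t, (t, n) ∈ S) (t t' : Option (Fin 3 × Fin l)) :
    LinkedIn (Ygraph l) S (t, n) (t', n) := by
  obtain ⟨w⟩ := (kStarSub_reachable_none t).trans (kStarSub_reachable_none t').symm
  induction w with
  | nil => exact .refl (hS _)
  | cons h w ih =>
    refine (LinkedIn.of_adj ?_ (hS _) (hS _)).trans ih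
    rw [Ygraph, SimpleGraph.boxProd_adj]
    exact Or.inl ⟨h, rfl⟩

lemma yGraph_linkedIn_of_le_level {l N : ℕ} {u v : Option (Fin 3 × Fin l) × ℕ} (hu : N ≤ u.2)
    (hv : N ≤ v.2) : LinkedIn (Ygraph l) {x | N ≤ x.2} u v := by
  have hup : ∀ (t : Option (Fin 3 × Fin l)) (d : ℕ),
      LinkedIn (Ygraph l) {x | N ≤ x.2} (t, N) (t, N + d) := by
    intro t d
    induction d with
    | zero => exact .refl (le_refl N)
    | succ d ih =>
      exact ih.trans (.of_adj (yGraph_adj_level t (N + d)) (Nat.le_add_right N d)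
        (Nat.le_add_right N (d + 1)))
  obtain ⟨t, n⟩ := u
  obtain ⟨t', n'⟩ := v
  obtain ⟨d, rfl⟩ := Nat.exists_eq_add_of_le hu
  obtain ⟨d', rfl⟩ := Nat.exists_eq_add_of_le hv
  exact (hup t d).symm.trans
    ((yGraph_linkedIn_level (fun t => le_refl N) t t').trans (hup t' d'))

lemma exists_le_level_of_injective {l : ℕ} {f : ℕ → Option (Fin 3 × Fin l) × ℕ}
    (hf : Function.Injective f) (N m₀ : ℕ) : ∃ m, m₀ ≤ m ∧ N ≤ (f m).2 := by
  have hfin : (f ⁻¹' {x | x.2 < N}).Finite := by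
    refine Set.Finite.preimage hf.injOn ?_
    refine (Set.finite_univ.prod (Set.finite_lt_nat N)).subset fun x hx => ?_
    exact ⟨trivial, hx⟩
  obtain ⟨m, hm, hm'⟩ :=
    (Set.infinite_of_not_bddAbove (not_bddAbove_Ici m₀)).exists_notMem_finite hfin
  exact ⟨m, hm, not_lt.1 hm'⟩

lemma yGraph_rayEquiv {l : ℕ} {f g : ℕ → Option (Fin 3 × Fin l) × ℕ}
    (hf : IsRay (Ygraph l) f) (hg : IsRay (Ygraph l) g) : RayEquiv (Ygraph l) f g := by
  intro S m₀ n₀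
  obtain ⟨m, hm, hmN⟩ := exists_le_level_of_injective hf.1 (S.sup Prod.snd + 1) m₀
  obtain ⟨n, hn, hnN⟩ := exists_le_level_of_injective hg.1 (S.sup Prod.snd + 1) n₀
  obtain ⟨w, hw⟩ := yGraph_linkedIn_of_le_level hmN hnN
  refine ⟨m, n, hm, hn, w, fun x hx hxS => ?_⟩
  have h1 : S.sup Prod.snd + 1 ≤ x.2 := hw x hx
  have h2 : x.2 ≤ S.sup Prod.snd := Finset.le_sup hxS
  omega

lemma isRay_vertical {l : ℕ} (t : Option (Fin 3 × Fin l)) :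
    IsRay (Ygraph l) fun n => (t, n) :=
  ⟨fun _ _ h => (Prod.mk.inj h).2, fun n => yGraph_adj_level t n⟩

lemma exists_level_eq_of_isRay {l : ℕ} {f : ℕ → Option (Fin 3 × Fin l) × ℕ}
    (hf : IsRay (Ygraph l) f) {N : ℕ} (hN : (f 0).2 ≤ N) : ∃ m, (f m).2 = N := by
  obtain ⟨m, -, hm⟩ := exists_le_level_of_injective hf.1 N 0
  induction m with
  | zero => exact ⟨0, le_antisymm hN hm⟩
  | succ m ih =>
    rcases le_or_gt N (f m).2 with h | h
    · exact ih h
    · refine ⟨m + 1, ?_⟩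
      rcases yGraph_adj_cases 0 (hf.2 m) with ⟨-, h1⟩ | ⟨h1, -⟩ <;> omega

lemma hasVDisjointRays_yGraph {l : ℕ} {f : ℕ → Option (Fin 3 × Fin l) × ℕ}
    (hf : IsRay (Ygraph l) f) : HasVDisjointRays (Ygraph l) f (3 * l + 1) := by
  let e : Fin (3 * l + 1) ≃ Option (Fin 3 × Fin l) :=
    (Fintype.equivFinOfCardEq (by simp)).symm
  refine ⟨fun i n => (e i, n), fun i => isRay_vertical _,
    fun i => yGraph_rayEquiv (isRay_vertical _) hf, fun i i' h => ?_⟩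
  refine Set.disjoint_left.2 ?_
  rintro _ ⟨n, rfl⟩ ⟨n', h'⟩
  exact h (e.injective (Prod.mk.inj h').1.symm)

lemma not_hasVDisjointRays_yGraph {l : ℕ} (f : ℕ → Option (Fin 3 × Fin l) × ℕ) :
    ¬ HasVDisjointRays (Ygraph l) f (3 * l + 2) := by
  rintro ⟨F, hF, -, hdisj⟩
  have hlevel := fun i => exists_level_eq_of_isRay (hF i)
    (Finset.le_sup (f := fun i => (F i 0).2) (Finset.mem_univ i))
  choose m hm using hlevel
  have hinj : Function.Injective fun i => (F i (m i)).1 := by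
    intro i i' h
    by_contra hne
    have heq : F i (m i) = F i' (m i') := Prod.ext h ((hm i).trans (hm i').symm)
    exact Set.disjoint_left.1 (hdisj hne) ⟨m i, rfl⟩ ⟨m i', heq.symm⟩
  have := Fintype.card_le_of_injective _ hinj
  simp at this

/-- For `k = 2ℓ + 2`: `Y(ℓ)` has a unique end, of vertex-degree `3ℓ + 1 = (3/2)k - 2`,
and the `[k] × ℕ` grid is not a minor of `Y(ℓ)`. -/
theorem stmt9 (l : ℕ) :
    (3 * ((2 * l + 2 : ℕ) : ℚ) / 2 - 2 = ((3 * l + 1 : ℕ) : ℚ)) ∧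
    (∃ f, IsRay (Ygraph l) f) ∧
    (∀ f g, IsRay (Ygraph l) f → IsRay (Ygraph l) g → RayEquiv (Ygraph l) f g) ∧
    (∀ f, IsRay (Ygraph l) f →
      HasVDisjointRays (Ygraph l) f (3 * l + 1) ∧
      ¬ HasVDisjointRays (Ygraph l) f (3 * l + 2)) ∧
    ¬ HasMinor (Ygraph l) (gridN (2 * l + 2)) := by
  refine ⟨by push_cast; ring, ⟨_, isRay_vertical none⟩, fun f g hf hg => yGraph_rayEquiv hf hg,
    fun f hf => ⟨hasVDisjointRays_yGraph hf, not_hasVDisjointRays_yGraph f⟩,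
    not_hasMinor_gridN l⟩
end
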